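/- Let n ≥ 1, a > 1 and α = (n+2a+2)/(n+2a-2). Suppose u : ℝⁿ × [0,∞) → ℝ is nonnegative, of class C² up to the boundary, and satisfies y·∂²u/∂y² + a·∂u/∂y + Δₓu + u^α = 0 at every point of ℝⁿ × (0,∞). Then there exist x₀ ∈ ℝⁿ and t ≥ 0 such that u(x,y) = ( t·√((n+2a)(n+2a−2)) / (t² + 4y + |x−x₀|²) )^{(n+2a−2)/2} for all (x,y) (with u ≡ 0 when t = 0). -/

import Mathlib

/-- Second partial derivative in the `i`-th `x`-variable. -/
noncomputable def pdxx (n : ℕ) (u : (Fin n → ℝ) × ℝ → ℝ) (i : Fin n)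
    (x : Fin n → ℝ) (y : ℝ) : ℝ :=
  deriv (fun t => deriv (fun s => u (Function.update x i s, y)) t) (x i)

/-- First partial derivative in the `y`-variable. -/
noncomputable def pdy (n : ℕ) (u : (Fin n → ℝ) × ℝ → ℝ) (x : Fin n → ℝ) (y : ℝ) : ℝ :=
  deriv (fun t => u (x, t)) y

/-- Second partial derivative in the `y`-variable. -/
noncomputable def pdyy (n : ℕ) (u : (Fin n → ℝ) × ℝ → ℝ) (x : Fin n → ℝ) (y : ℝ) : ℝ :=
  deriv (fun t => deriv (fun s => u (x, s)) t) y

section Helpers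
open Real Set Filter Topology

/-- `g` has first derivative `p` and second derivative `q` at `t`. -/
def HasD2 {F : Type*} [NormedAddCommGroup F] [NormedSpace ℝ F] (g : ℝ → F) (t : ℝ) (p q : F) : Prop :=
  ∃ g' : ℝ → F, (∀ᶠ s in 𝓝 t, HasDerivAt g (g' s) s) ∧ g' t = p ∧ HasDerivAt g' q t

namespace HasD2

variable {F : Type*} [NormedAddCommGroup F] [NormedSpace ℝ F]

theorem hasDerivAt {g : ℝ → F} {t : ℝ} {p q : F} (h : HasD2 g t p q) : HasDerivAt g p t := by
  obtain ⟨g', h1, h2, h3⟩ := h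
  have := h1.self_of_nhds
  rwa [h2] at this

theorem const (c : F) (t : ℝ) : HasD2 (fun _ => c) t 0 0 :=
  ⟨fun _ => 0, Eventually.of_forall fun s => hasDerivAt_const s c, rfl, hasDerivAt_const t 0⟩

theorem id (t : ℝ) : HasD2 (fun s : ℝ => s) t 1 0 :=
  ⟨fun _ => 1, Eventually.of_forall fun s => hasDerivAt_id s, rfl, hasDerivAt_const t 1⟩

theorem add {f g : ℝ → F} {t : ℝ} {p q p' q' : F} (hf : HasD2 f t p q) (hg : HasD2 g t p' q') :
    HasD2 (fun s => f s + g s) t (p + p') (q + q') := by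
  obtain ⟨f', f1, f2, f3⟩ := hf
  obtain ⟨g', g1, g2, g3⟩ := hg
  refine ⟨fun s => f' s + g' s, ?_, by simp [f2, g2], f3.add g3⟩
  filter_upwards [f1, g1] with s h1 h2 using h1.add h2

theorem smul {f : ℝ → ℝ} {g : ℝ → F} {t : ℝ} {p q : ℝ} {p' q' : F} (hf : HasD2 f t p q)
    (hg : HasD2 g t p' q') :
    HasD2 (fun s => f s • g s) t (f t • p' + p • g t) (f t • q' + (2 * p) • p' + q • g t) := by
  have hf0 := hf.hasDerivAt
  have hg0 := hg.hasDerivAt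
  obtain ⟨f', f1, f2, f3⟩ := hf
  obtain ⟨g', g1, g2, g3⟩ := hg
  refine ⟨fun s => f s • g' s + f' s • g s, ?_, by simp [f2, g2], ?_⟩
  · filter_upwards [f1, g1] with s h1 h2 using h1.smul h2
  · refine ((hf0.smul g3).add (f3.smul hg0)).congr_deriv ?_
    rw [f2, g2]; module

theorem mul {f g : ℝ → ℝ} {t : ℝ} {p q p' q' : ℝ} (hf : HasD2 f t p q)
    (hg : HasD2 g t p' q') :
    HasD2 (fun s => f s * g s) t (f t * p' + p * g t) (f t * q' + 2 * p * p' + q * g t) := by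
  simpa using hf.smul hg

theorem const_mul {f : ℝ → ℝ} {t : ℝ} {p q : ℝ} (c : ℝ) (hf : HasD2 f t p q) :
    HasD2 (fun s => c * f s) t (c * p) (c * q) := by
  simpa using (HasD2.const c t).mul hf

theorem congr {f g : ℝ → F} {t : ℝ} {p q : F} (hf : HasD2 f t p q) (h : g =ᶠ[𝓝 t] f) :
    HasD2 g t p q := by
  obtain ⟨f', f1, f2, f3⟩ := hf
  refine ⟨f', ?_, f2, f3⟩
  filter_upwards [f1, h.eventuallyEq_nhds] with s h1 h2 using h1.congr_of_eventuallyEq h2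

theorem congr' {f : ℝ → F} {t : ℝ} {p q p' q' : F} (hf : HasD2 f t p q) (h : p = p') (h2 : q = q') :
    HasD2 f t p' q' := by subst h; subst h2; exact hf

theorem comp {f : ℝ → ℝ} {g : ℝ → ℝ} {t : ℝ} {p q p' q' : ℝ} (hf : HasD2 f (g t) p q)
    (hg : HasD2 g t p' q') :
    HasD2 (fun s => f (g s)) t (p * p') (q * p' ^ 2 + p * q') := by
  have hg0 := hg.hasDerivAt
  obtain ⟨f', f1, f2, f3⟩ := hf
  obtain ⟨g', g1, g2, g3⟩ := hg
  refine ⟨fun s => f' (g s) * g' s, ?_, by simp [f2, g2], ?_⟩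
  · filter_upwards [hg0.continuousAt.eventually f1, g1] with s h1 h2 using h1.comp s h2
  · have := (f3.comp t hg0).mul g3
    refine this.congr_deriv ?_
    simp only [Function.comp]
    rw [f2, g2]; ring

theorem unique {g : ℝ → F} {t : ℝ} {p q p' q' : F} (h : HasD2 g t p q) (h' : HasD2 g t p' q') :
    p = p' ∧ q = q' := by
  refine ⟨h.hasDerivAt.unique h'.hasDerivAt, ?_⟩
  obtain ⟨f', f1, f2, f3⟩ := h
  obtain ⟨g', g1, g2, g3⟩ := h'
  have : f' =ᶠ[𝓝 t] g' := by
    filter_upwards [f1, g1] with s h1 h2 using h1.unique h2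
  exact f3.unique (g3.congr_of_eventuallyEq this)

theorem of_contDiffAt {g : ℝ → F} {t : ℝ} (h : ContDiffAt ℝ 2 g t) :
    HasD2 g t (deriv g t) (deriv (deriv g) t) := by
  have h1 : ∀ᶠ s in 𝓝 t, ContDiffAt ℝ 2 g s := h.eventually (by simp)
  refine ⟨deriv g, ?_, rfl, ?_⟩
  · filter_upwards [h1] with s hs using (hs.differentiableAt (by norm_num)).hasDerivAt
  · have h2 : ContDiffAt ℝ 1 (deriv g) t := by
      have h3 : ContDiffAt ℝ 1 (fderiv ℝ g) t := h.fderiv_right (by norm_num)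
      have : deriv g = fun s => fderiv ℝ g s 1 := by ext s; simp
      rw [this]
      exact h3.clm_apply contDiffAt_const
    exact (h2.differentiableAt (by norm_num)).hasDerivAt

/-- Second derivative test (necessary condition). -/
theorem nonneg_of_isLocalMin {g : ℝ → ℝ} {t p q : ℝ} (h : HasD2 g t p q) (hm : IsLocalMin g t) :
    p = 0 ∧ 0 ≤ q := by
  have hp : p = 0 := hm.hasDerivAt_eq_zero h.hasDerivAt
  refine ⟨hp, ?_⟩
  by_contra hq
  push Not at hq
  obtain ⟨g', h1, h2, h3⟩ := h
  have h4 : ∀ᶠ s in 𝓝[≠] t, slope g' t s < 0 :=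
    (hasDerivAt_iff_tendsto_slope.1 h3).eventually (gt_mem_nhds hq)
  rw [eventually_nhdsWithin_iff] at h4
  obtain ⟨ε, hε, hb⟩ := Metric.eventually_nhds_iff.1 (h4.and (h1.and hm))
  have hs : ∀ s, t ≤ s → s ≤ t + ε / 2 → HasDerivAt g (g' s) s := fun s a b =>
    (hb (by rw [Real.dist_eq, abs_lt]; constructor <;> linarith)).2.1
  obtain ⟨c, hc, hc2⟩ := exists_hasDerivAt_eq_slope g g' (show t < t + ε / 2 by linarith)
    (fun s hs' => (hs s hs'.1 hs'.2).continuousAt.continuousWithinAt)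
    (fun s hs' => hs s hs'.1.le hs'.2.le)
  have hc3 := (hb (y := c) (by rw [Real.dist_eq, abs_lt]; constructor <;> linarith [hc.1, hc.2])).1
    (by simpa using hc.1.ne')
  have hc4 : g t ≤ g (t + ε / 2) :=
    (hb (y := t + ε / 2) (by rw [Real.dist_eq, abs_lt]; constructor <;> linarith)).2.2
  rw [slope_def_field, h2, hp, sub_zero, hc2] at hc3
  have h5 : 0 ≤ (g (t + ε / 2) - g t) / (t + ε / 2 - t) :=
    div_nonneg (by linarith) (by linarith)
  have h6 : 0 < c - t := by linarith [hc.1]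
  have := div_nonneg h5 h6.le
  linarith

theorem of_rpow {r : ℝ} (hr : 0 < r) (k : ℝ) :
    HasD2 (fun s : ℝ => s ^ k) r (k * r ^ (k - 1)) (k * (k - 1) * r ^ (k - 2)) := by
  refine ⟨fun s => k * s ^ (k - 1), ?_, rfl, ?_⟩
  · filter_upwards [lt_mem_nhds hr] with s hs
    exact Real.hasDerivAt_rpow_const (Or.inl hs.ne')
  · have := (Real.hasDerivAt_rpow_const (x := r) (p := k - 1) (Or.inl hr.ne')).const_mul k
    refine this.congr_deriv ?_
    rw [show k - 1 - 1 = k - 2 by ring]; ring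

theorem of_exp (r : ℝ) : HasD2 Real.exp r (Real.exp r) (Real.exp r) :=
  ⟨Real.exp, Eventually.of_forall fun s => Real.hasDerivAt_exp s, rfl, Real.hasDerivAt_exp r⟩

theorem of_sq (r : ℝ) : HasD2 (fun s : ℝ => s ^ 2) r (2 * r) 2 := by
  refine ⟨fun s => 2 * s, Eventually.of_forall fun s => ?_, rfl, ?_⟩
  · simpa using hasDerivAt_pow 2 s
  · simpa using (hasDerivAt_id r).const_mul 2

/-- Chain rule: `C²` function along a curve. -/
theorem comp_vec {u : F → ℝ} {c : ℝ → F} {t : ℝ} {p q : F} (hu : ContDiffAt ℝ 2 u (c t))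
    (hc : HasD2 c t p q) :
    HasD2 (fun s => u (c s)) t (fderiv ℝ u (c t) p)
      (fderiv ℝ (fderiv ℝ u) (c t) p p + fderiv ℝ u (c t) q) := by
  have hc0 := hc.hasDerivAt
  obtain ⟨c', c1, c2, c3⟩ := hc
  have h1 : ∀ᶠ s in 𝓝 (c t), ContDiffAt ℝ 2 u s := hu.eventually (by simp)
  have h3 : ContDiffAt ℝ 1 (fderiv ℝ u) (c t) := hu.fderiv_right (by norm_num)
  refine ⟨fun s => fderiv ℝ u (c s) (c' s), ?_, by simp [c2], ?_⟩
  · filter_upwards [hc0.continuousAt.eventually h1, c1] with s a b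
    exact (a.differentiableAt (by norm_num)).hasFDerivAt.comp_hasDerivAt s b
  · have := ((h3.differentiableAt (by norm_num)).hasFDerivAt.comp_hasDerivAt t hc0).clm_apply c3
    refine this.congr_deriv ?_
    simp [c2]

end HasD2

/-- 2-jet along coordinate lines -/
def HasJ {n : ℕ} (f : (Fin n → ℝ) × ℝ → ℝ) (x : Fin n → ℝ) (y : ℝ) (p q : ℝ) (d r : Fin n → ℝ) :
    Prop :=
  HasD2 (fun t => f (x, t)) y p q ∧
    ∀ i, HasD2 (fun t => f (Function.update x i t, y)) (x i) (d i) (r i)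

/-- `L f = l` at `(x,y)`. -/
def HasL {n : ℕ} (a : ℝ) (f : (Fin n → ℝ) × ℝ → ℝ) (x : Fin n → ℝ) (y l : ℝ) : Prop :=
  ∃ (p q : ℝ) (d r : Fin n → ℝ), HasJ f x y p q d r ∧ l = y * q + a * p + ∑ i, r i

theorem HasJ.hasL {n : ℕ} {a : ℝ} {f : (Fin n → ℝ) × ℝ → ℝ} {x : Fin n → ℝ} {y p q : ℝ}
    {d r : Fin n → ℝ} (h : HasJ f x y p q d r) : HasL a f x y (y * q + a * p + ∑ i, r i) :=
  ⟨p, q, d, r, h, rfl⟩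

namespace HasL
variable {n : ℕ} {a : ℝ} {f g : (Fin n → ℝ) × ℝ → ℝ} {x : Fin n → ℝ} {y l m : ℝ}

theorem add (hf : HasL a f x y l) (hg : HasL a g x y m) :
    HasL a (fun z => f z + g z) x y (l + m) := by
  obtain ⟨p, q, d, r, ⟨h1, h2⟩, rfl⟩ := hf
  obtain ⟨p', q', d', r', ⟨h1', h2'⟩, rfl⟩ := hg
  refine ⟨p + p', q + q', d + d', r + r', ⟨h1.add h1', fun i => (h2 i).add (h2' i)⟩, ?_⟩
  simp only [Pi.add_apply, Finset.sum_add_distrib]; ring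

theorem const_mul (c : ℝ) (hf : HasL a f x y l) : HasL a (fun z => c * f z) x y (c * l) := by
  obtain ⟨p, q, d, r, ⟨h1, h2⟩, rfl⟩ := hf
  refine ⟨c * p, c * q, fun i => c * d i, fun i => c * r i,
    ⟨h1.const_mul c, fun i => (h2 i).const_mul c⟩, ?_⟩
  rw [← Finset.mul_sum]; ring

theorem const (c : ℝ) : HasL a (fun _ => c) x y 0 :=
  ⟨0, 0, fun _ => 0, fun _ => 0, ⟨HasD2.const c y, fun i => HasD2.const c (x i)⟩, by simp⟩

theorem sub (hf : HasL a f x y l) (hg : HasL a g x y m) :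
    HasL a (fun z => f z - g z) x y (l - m) := by
  have := hf.add (hg.const_mul (-1))
  simpa [sub_eq_add_neg] using this

theorem congr (hf : HasL a f x y l) (h : g =ᶠ[𝓝 (x, y)] f) : HasL a g x y l := by
  obtain ⟨p, q, d, r, ⟨h1, h2⟩, rfl⟩ := hf
  refine ⟨p, q, d, r, ⟨h1.congr ?_, fun i => (h2 i).congr ?_⟩, rfl⟩
  · have hc : Continuous (fun t : ℝ => (x, t)) := by fun_prop
    exact hc.continuousAt.eventually h
  · have hc : Continuous (fun t : ℝ => (Function.update x i t, y)) :=
      ((continuous_const (y := x)).update i continuous_id).prodMk continuous_const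
    have : Tendsto (fun t : ℝ => (Function.update x i t, y)) (𝓝 (x i)) (𝓝 (x, y)) := by
      have := hc.tendsto (x i)
      simpa using this
    exact this.eventually h

theorem nonneg_of_isLocalMin (hf : HasL a f x y l) (hy : 0 ≤ y) (h : IsLocalMin f (x, y)) :
    0 ≤ l := by
  obtain ⟨p, q, d, r, ⟨h1, h2⟩, rfl⟩ := hf
  have e1 : IsLocalMin (fun t => f (x, t)) y := by
    have hc : Continuous (fun t : ℝ => (x, t)) := by fun_prop
    exact hc.continuousAt.eventually h
  have e2 : ∀ i, IsLocalMin (fun t => f (Function.update x i t, y)) (x i) := by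
    intro i
    have hc : Continuous (fun t : ℝ => (Function.update x i t, y)) :=
      ((continuous_const (y := x)).update i continuous_id).prodMk continuous_const
    have : Tendsto (fun t : ℝ => (Function.update x i t, y)) (𝓝 (x i)) (𝓝 (x, y)) := by
      have := hc.tendsto (x i)
      simpa using this
    have := this.eventually h
    simpa [IsLocalMin, IsMinFilter] using this
  obtain ⟨hp, hq⟩ := h1.nonneg_of_isLocalMin e1
  have := Finset.sum_nonneg (s := Finset.univ) (fun i _ => ((h2 i).nonneg_of_isLocalMin (e2 i)).2)
  rw [hp]
  have := mul_nonneg hy hq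
  linarith

theorem comp {F : ℝ → ℝ} {p q F1 F2 : ℝ} {d r : Fin n → ℝ} (hf : HasJ f x y p q d r)
    (hF : HasD2 F (f (x, y)) F1 F2) :
    HasL a (fun z => F (f z)) x y
      (F1 * (y * q + a * p + ∑ i, r i) + F2 * (y * p ^ 2 + ∑ i, d i ^ 2)) := by
  obtain ⟨h1, h2⟩ := hf
  refine ⟨_, _, fun i => F1 * d i, fun i => F2 * d i ^ 2 + F1 * r i,
    ⟨HasD2.comp hF h1, fun i => HasD2.comp (by simpa using hF) (h2 i)⟩, ?_⟩
  rw [Finset.sum_add_distrib, ← Finset.mul_sum, ← Finset.mul_sum]; ring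

end HasL

/-- The squared "distance" to the origin. -/
def rho {n : ℕ} (z : (Fin n → ℝ) × ℝ) : ℝ := ∑ i, z.1 i ^ 2 + 4 * z.2

theorem continuous_rho {n : ℕ} : Continuous (rho (n := n)) := by unfold rho; fun_prop

theorem sum_update_sub_sq {n : ℕ} (c x : Fin n → ℝ) (i : Fin n) (t : ℝ) :
    ∑ j, (Function.update x i t j - c j) ^ 2
      = (t - c i) ^ 2 + (∑ j, (x j - c j) ^ 2 - (x i - c i) ^ 2) := by
  rw [← Finset.add_sum_erase _ _ (Finset.mem_univ i),
    ← Finset.add_sum_erase (a := i) (s := Finset.univ) (f := fun j => (x j - c j) ^ 2)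
      (Finset.mem_univ i)]
  have : ∑ j ∈ Finset.univ.erase i, (Function.update x i t j - c j) ^ 2
      = ∑ j ∈ Finset.univ.erase i, (x j - c j) ^ 2 := by
    refine Finset.sum_congr rfl fun j hj => ?_
    rw [Function.update_of_ne (Finset.ne_of_mem_erase hj)]
  rw [this]; simp

/-- The jet of `κ (y - b)^2 + |x - c|^2 + m y`. -/
theorem hasJ_quad {n : ℕ} (κ b m : ℝ) (c x : Fin n → ℝ) (y : ℝ) :
    HasJ (fun z : (Fin n → ℝ) × ℝ => κ * (z.2 - b) ^ 2 + ∑ i, (z.1 i - c i) ^ 2 + m * z.2) x y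
      (2 * κ * (y - b) + m) (2 * κ) (fun i => 2 * (x i - c i)) (fun _ => 2) := by
  constructor
  · have h1 : HasD2 (fun t : ℝ => t + (-b)) y (1 + 0) (0 + 0) := (HasD2.id y).add (HasD2.const _ y)
    have h2 := (HasD2.comp (g := fun t : ℝ => t + (-b)) (HasD2.of_sq (y + -b)) h1).const_mul κ
    have h3 := (h2.add (HasD2.const (∑ i, (x i - c i) ^ 2) y)).add ((HasD2.id y).const_mul m)
    refine (h3.congr (Eventually.of_forall fun t => ?_)).congr' ?_ ?_
    · simp [sub_eq_add_neg]
    · ring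
    · ring
  · intro i
    have h1 : HasD2 (fun t : ℝ => t + (-c i)) (x i) (1 + 0) (0 + 0) :=
      (HasD2.id _).add (HasD2.const _ _)
    have h2 := (HasD2.comp (g := fun t : ℝ => t + (-c i)) (HasD2.of_sq (x i + -c i)) h1)
    have h3 := (h2.add (HasD2.const (κ * (y - b) ^ 2 +
      (∑ j, (x j - c j) ^ 2 - (x i - c i) ^ 2) + m * y) (x i)))
    refine (h3.congr (Eventually.of_forall fun t => ?_)).congr' ?_ ?_
    · simp only [sum_update_sub_sq]; ring
    · ring
    · ring

theorem hasJ_rho {n : ℕ} (x : Fin n → ℝ) (y : ℝ) :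
    HasJ (rho (n := n)) x y 4 0 (fun i => 2 * x i) (fun _ => 2) := by
  have := hasJ_quad (n := n) 0 0 4 0 x y
  have e : (rho (n := n)) = fun z => ∑ i, z.1 i ^ 2 + 4 * z.2 := rfl
  rw [e]
  simpa using this

theorem hasL_radial {n : ℕ} {a : ℝ} {F : ℝ → ℝ} {F1 F2 : ℝ} (x : Fin n → ℝ) (y : ℝ)
    (hF : HasD2 F (rho (x, y)) F1 F2) :
    HasL a (fun z => F (rho z)) x y (4 * rho (x, y) * F2 + 2 * (n + 2 * a) * F1) := by
  have := HasL.comp (a := a) (hasJ_rho x y) hF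
  convert this using 1
  simp only [rho, mul_pow, ← Finset.mul_sum]
  simp; ring

theorem hasL_rho {n : ℕ} {a : ℝ} (x : Fin n → ℝ) (y : ℝ) :
    HasL a (rho (n := n)) x y (2 * (n + 2 * a)) := by
  have := hasL_radial (a := a) x y (HasD2.id _)
  simpa using this

theorem hasL_rho_rpow {n : ℕ} {a : ℝ} (x : Fin n → ℝ) (y : ℝ) (h : 0 < rho (x, y)) :
    HasL a (fun z => rho z ^ (-((n + 2 * a - 2) / 2))) x y 0 := by
  have := hasL_radial (a := a) x y (HasD2.of_rpow h (-((n + 2 * a - 2) / 2)))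
  convert this using 1
  have e : rho (x, y) ^ (-((n + 2 * a - 2) / 2) - 1)
      = rho (x, y) * rho (x, y) ^ (-((n + 2 * a - 2) / 2) - 2) := by
    conv_rhs => rw [← Real.rpow_one (rho (x, y)), ← Real.rpow_mul h.le, ← Real.rpow_add h]
    congr 1; ring
  rw [e]; ring

theorem hasL_ypow {n : ℕ} {a : ℝ} (x : Fin n → ℝ) {y : ℝ} (hy : 0 < y) :
    HasL a (fun z : (Fin n → ℝ) × ℝ => z.2 ^ (1 - a)) x y 0 := by
  refine ⟨_, _, fun _ => 0, fun _ => 0, ⟨HasD2.of_rpow hy (1 - a), fun i => HasD2.const (y ^ (1 - a)) _⟩, ?_⟩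
  have e : y ^ (1 - a - 1) = y * y ^ (1 - a - 2) := by
    conv_rhs => rw [← Real.rpow_one y, ← Real.rpow_mul hy.le, ← Real.rpow_add hy]
    congr 1; ring
  rw [e]; simp; ring

/-- Weak minimum principle. The set `y = 0` is not seen since `1 < a`. -/
theorem min_principle {n : ℕ} {a : ℝ} (ha : 1 < a) {K : Set ((Fin n → ℝ) × ℝ)} (hK : IsCompact K)
    (w : (Fin n → ℝ) × ℝ → ℝ) (hw : ContinuousOn w K)
    (h : ∀ x y, (x, y) ∈ K → 0 < y → w (x, y) < 0 → K ∈ 𝓝 (x, y) ∧ ∃ l ≤ 0, HasL a w x y l) :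
    ∀ x y, (x, y) ∈ K → 0 < y → 0 ≤ w (x, y) := by
  intro x1 y1 h1 hy1
  by_contra hneg
  push Not at hneg
  -- bounds on K
  obtain ⟨B, hB⟩ := (hK.image_of_continuousOn hw).isBounded.subset_closedBall 0
  obtain ⟨M, hM⟩ := (hK.image_of_continuousOn continuous_rho.continuousOn).isBounded.subset_closedBall 0
  have hB' : ∀ z ∈ K, |w z| ≤ B := fun z hz => by simpa using hB (mem_image_of_mem w hz)
  have hM' : ∀ z ∈ K, rho z ≤ M := fun z hz => by
    have : |rho z| ≤ M := by simpa using hM (mem_image_of_mem rho hz)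
    exact (le_abs_self _).trans this
  set ε := -w (x1, y1) / 4 / y1 ^ (1 - a) with hε
  have hyp : 0 < y1 ^ (1 - a) := Real.rpow_pos_of_pos hy1 _
  have hεpos : 0 < ε := by apply div_pos _ hyp; linarith
  have hMr : 0 ≤ M - rho (x1, y1) := by linarith [hM' _ h1]
  set δ := -w (x1, y1) / 4 / (M - rho (x1, y1) + 1) with hδ
  have hδpos : 0 < δ := by apply div_pos <;> linarith
  let W : (Fin n → ℝ) × ℝ → ℝ := fun z => w z + ε * z.2 ^ (1 - a) + δ * (M - rho z)
  have hW1 : W (x1, y1) < 0 := by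
    have e1 : ε * y1 ^ (1 - a) = -w (x1, y1) / 4 := by rw [hε]; field_simp
    have e2 : δ * (M - rho (x1, y1)) ≤ -w (x1, y1) / 4 := by
      rw [hδ, div_mul_eq_mul_div, div_le_iff₀ (by linarith)]
      nlinarith
    simp only [W]; rw [e1]; linarith
  -- small y
  have hlim : ∀ᶠ y in 𝓝[>] (0:ℝ), B < ε * y ^ (1 - a) := by
    have : Tendsto (fun y : ℝ => y ^ (1 - a)) (𝓝[>] 0) atTop :=
      tendsto_rpow_neg_nhdsGT_zero (by linarith)
    exact (this.const_mul_atTop hεpos).eventually_gt_atTop B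
  obtain ⟨η, hη1, hη⟩ := (hlim.and (Ioo_mem_nhdsGT hy1)).exists
  have hη0 : 0 < η := hη.1
  let K' := K ∩ {z | η ≤ z.2}
  have hK' : IsCompact K' := hK.inter_right (isClosed_le continuous_const continuous_snd)
  have hWc : ContinuousOn W K' := by
    refine ((hw.mono inter_subset_left).add (continuousOn_const.mul ?_)).add
      (continuousOn_const.mul (continuousOn_const.sub continuous_rho.continuousOn))
    refine continuousOn_snd.rpow_const fun z hz => Or.inl ?_
    have : η ≤ z.2 := hz.2
    linarith
  obtain ⟨⟨x0, y0⟩, hz0, hmin⟩ := hK'.exists_isMinOn ⟨(x1, y1), h1, hη.2.le⟩ hWc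
  have hW0 : W (x0, y0) < 0 := (hmin (show (x1, y1) ∈ K' from ⟨h1, hη.2.le⟩)).trans_lt hW1
  have hy0' : η ≤ y0 := hz0.2
  have hy0 : 0 < y0 := by linarith
  have hp0 : 0 < y0 ^ (1 - a) := Real.rpow_pos_of_pos hy0 _
  have hr0 := hM' _ hz0.1
  have hw0 : w (x0, y0) < 0 := by
    have := mul_pos hεpos hp0
    have := mul_nonneg hδpos.le (sub_nonneg.2 hr0)
    simp only [W] at hW0; linarith
  have hy0'' : η < y0 := by
    refine lt_of_le_of_ne hy0' fun he => ?_
    have := (abs_le.1 (hB' _ hz0.1)).1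
    have := mul_nonneg hδpos.le (sub_nonneg.2 hr0)
    simp only [W] at hW0; rw [he] at hη1; linarith
  obtain ⟨hn, l, hl, hL⟩ := h x0 y0 hz0.1 hy0 hw0
  have hn' : K' ∈ 𝓝 (x0, y0) :=
    inter_mem hn (continuous_snd.continuousAt.eventually (eventually_ge_nhds hy0''))
  have hlm : IsLocalMin W (x0, y0) := hmin.isLocalMin hn'
  have hLW : HasL a W x0 y0 (l + ε * 0 + δ * (0 - 2 * (n + 2 * a))) :=
    (hL.add ((hasL_ypow x0 hy0).const_mul ε)).add (((HasL.const M).sub (hasL_rho x0 y0)).const_mul δ)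
  have := hLW.nonneg_of_isLocalMin hy0.le hlm
  have hn0 : (0:ℝ) ≤ n := Nat.cast_nonneg n
  nlinarith [mul_pos hδpos (show (0:ℝ) < n + 2 * a by linarith)]

theorem rho_eq {n : ℕ} (x : Fin n → ℝ) (y : ℝ) : rho (x, y) = ∑ i, x i ^ 2 + 4 * y := rfl

theorem sq_le_rho {n : ℕ} (x : Fin n → ℝ) {y : ℝ} (hy : 0 ≤ y) (i : Fin n) : x i ^ 2 ≤ rho (x, y) := by
  have := Finset.single_le_sum (f := fun i => x i ^ 2) (fun i _ => sq_nonneg (x i)) (Finset.mem_univ i)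
  simp only [rho_eq] at *; linarith

theorem isCompact_quad {n : ℕ} {κ : ℝ} (hκ : 0 < κ) (b m M : ℝ) (hm : 0 ≤ m) (c : Fin n → ℝ) :
    IsCompact {z : (Fin n → ℝ) × ℝ | 0 ≤ z.2 ∧ κ * (z.2 - b) ^ 2 + ∑ i, (z.1 i - c i) ^ 2 + m * z.2 ≤ M} := by
  have hb : {z : (Fin n → ℝ) × ℝ | 0 ≤ z.2 ∧
      κ * (z.2 - b) ^ 2 + ∑ i, (z.1 i - c i) ^ 2 + m * z.2 ≤ M} ⊆
      Metric.closedBall (c, b) (|M| + |M| / κ + 1) := by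
    rintro ⟨x, y⟩ ⟨hy, h⟩
    simp only at hy h
    have hM : 0 ≤ |M| := abs_nonneg M
    have hMk : 0 ≤ |M| / κ := by positivity
    have h0 := mul_nonneg hm hy
    have hs : 0 ≤ ∑ i, (x i - c i) ^ 2 := Finset.sum_nonneg fun i _ => sq_nonneg _
    have hk : 0 ≤ κ * (y - b) ^ 2 := by positivity
    have hMM := le_abs_self M
    rw [Metric.mem_closedBall, Prod.dist_eq, max_le_iff]
    constructor
    · rw [dist_pi_le_iff (by positivity)]
      intro i
      have := Finset.single_le_sum (f := fun i => (x i - c i) ^ 2) (fun i _ => sq_nonneg _) (Finset.mem_univ i)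
      rw [Real.dist_eq]
      have h3 : (x i - c i) ^ 2 ≤ |M| := by linarith
      have : |x i - c i| ≤ |M| + 1 := by
        apply abs_le_of_sq_le_sq _ (by positivity)
        nlinarith
      linarith
    · rw [Real.dist_eq]
      have h3 : (y - b) ^ 2 ≤ |M| / κ := by
        rw [le_div_iff₀ hκ]; linarith
      have : |y - b| ≤ |M| / κ + 1 := by
        apply abs_le_of_sq_le_sq _ (by positivity)
        nlinarith
      linarith
  refine Metric.isCompact_of_isClosed_isBounded ?_ (Metric.isBounded_closedBall.subset hb)
  exact (isClosed_le continuous_const continuous_snd).inter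
    (isClosed_le (f := fun z : (Fin n → ℝ) × ℝ => κ * (z.2 - b) ^ 2 + ∑ i, (z.1 i - c i) ^ 2 + m * z.2)
      (g := fun _ => M) (by fun_prop) continuous_const)

theorem isCompact_rho {n : ℕ} (R : ℝ) :
    IsCompact {z : (Fin n → ℝ) × ℝ | 0 ≤ z.2 ∧ rho z ≤ R} := by
  have hR : 0 ≤ |R| := abs_nonneg R
  refine (isCompact_quad (n := n) one_pos 0 4 (R ^ 2 + R) (by norm_num) 0).of_isClosed_subset ?_ ?_
  · exact (isClosed_le continuous_const continuous_snd).inter (isClosed_le continuous_rho continuous_const)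
  · rintro ⟨x, y⟩ ⟨h1, h2⟩
    refine ⟨h1, ?_⟩
    have hs : 0 ≤ ∑ i, x i ^ 2 := Finset.sum_nonneg fun i _ => sq_nonneg _
    simp only [rho_eq] at *
    simp only [Pi.zero_apply, sub_zero]
    nlinarith

theorem tendsto_up {n : ℕ} {S : Set ((Fin n → ℝ) × ℝ)} (x : Fin n → ℝ)
    (h : ∀ᶠ t in 𝓝[>] (0:ℝ), (x, t) ∈ S) :
    Tendsto (fun t : ℝ => (x, t)) (𝓝[>] 0) (𝓝[S] (x, 0)) := by
  refine tendsto_nhdsWithin_iff.2 ⟨?_, h⟩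
  have hc : Continuous (fun t : ℝ => (x, t)) := by fun_prop
  exact (hc.tendsto 0).mono_left nhdsWithin_le_nhds

theorem annulus_min {n : ℕ} {a : ℝ} (ha : 1 < a) {μ R : ℝ} (w : (Fin n → ℝ) × ℝ → ℝ)
    (hw : ContinuousOn w {z | 0 ≤ z.2 ∧ μ ≤ rho z ∧ rho z ≤ R})
    (hμ : ∀ x y, 0 ≤ y → rho (x, y) = μ → 0 ≤ w (x, y))
    (hR : ∀ x y, 0 ≤ y → rho (x, y) = R → 0 ≤ w (x, y))
    (h : ∀ x y, 0 < y → μ < rho (x, y) → rho (x, y) < R → w (x, y) < 0 → ∃ l ≤ 0, HasL a w x y l) :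
    ∀ x y, 0 ≤ y → μ ≤ rho (x, y) → rho (x, y) ≤ R → 0 ≤ w (x, y) := by
  have hK : IsCompact {z : (Fin n → ℝ) × ℝ | 0 ≤ z.2 ∧ μ ≤ rho z ∧ rho z ≤ R} := by
    refine (isCompact_rho R).of_isClosed_subset ?_ fun z hz => ⟨hz.1, hz.2.2⟩
    exact (isClosed_le continuous_const continuous_snd).inter
      ((isClosed_le continuous_const continuous_rho).inter (isClosed_le continuous_rho continuous_const))
  have key := min_principle ha hK w hw ?_
  · intro x y hy h1 h2
    rcases hy.lt_or_eq with hy | rfl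
    · exact key x y ⟨hy.le, h1, h2⟩ hy
    · rcases h2.lt_or_eq with h2 | h2
      · have ev : ∀ᶠ t in 𝓝[>] (0:ℝ), 0 < t ∧ (x, t) ∈ {z : (Fin n → ℝ) × ℝ | 0 ≤ z.2 ∧ μ ≤ rho z ∧ rho z ≤ R} := by
          filter_upwards [Ioo_mem_nhdsGT (show (0:ℝ) < (R - rho (x, 0)) / 4 by linarith)] with t ht
          simp only [mem_ofPred_eq, rho_eq] at *
          refine ⟨ht.1, ht.1.le, ?_, ?_⟩ <;> linarith [ht.1, ht.2]
        have h3 := (hw (x, 0) ⟨le_rfl, h1, h2.le⟩).tendsto.comp (tendsto_up x (ev.mono fun t ht => ht.2))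
        exact ge_of_tendsto h3 (ev.mono fun t ht => key x t ht.2 ht.1)
      · exact hR x 0 le_rfl h2
  · rintro x y ⟨h0, h1, h2⟩ hy hneg
    have h1' : μ < rho (x, y) := lt_of_le_of_ne h1 fun e => by linarith [hμ x y hy.le e.symm]
    have h2' : rho (x, y) < R := lt_of_le_of_ne h2 fun e => by linarith [hR x y hy.le e]
    refine ⟨?_, h x y hy h1' h2' hneg⟩
    have c1 : Tendsto (rho (n := n)) (𝓝 (x, y)) (𝓝 (rho (x, y))) := continuous_rho.continuousAt
    have c2 : Tendsto (Prod.snd : (Fin n → ℝ) × ℝ → ℝ) (𝓝 (x, y)) (𝓝 y) := continuous_snd.continuousAt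
    filter_upwards [c1.eventually (lt_mem_nhds h1'), c1.eventually (gt_mem_nhds h2'),
      c2.eventually (lt_mem_nhds hy)] with z a b c using ⟨c.le, a.le, b.le⟩

/-- Lower bound at infinity. -/
theorem far_lower {n : ℕ} {a : ℝ} (ha : 1 < a) {R m : ℝ} (hR : 0 < R) (hm : 0 < m)
    (w : (Fin n → ℝ) × ℝ → ℝ)
    (hw : ContinuousOn w {z | 0 ≤ z.2 ∧ R ≤ rho z})
    (hw0 : ∀ x y, 0 ≤ y → R ≤ rho (x, y) → 0 ≤ w (x, y))
    (hwR : ∀ x y, 0 ≤ y → rho (x, y) = R → m ≤ w (x, y))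
    (h : ∀ x y, 0 < y → R < rho (x, y) → ∃ l ≤ 0, HasL a w x y l) :
    ∀ x y, 0 ≤ y → R ≤ rho (x, y) →
      m * R ^ ((n + 2 * a - 2) / 2) * rho (x, y) ^ (-((n + 2 * a - 2) / 2)) ≤ w (x, y) := by
  set γ := ((n : ℝ) + 2 * a - 2) / 2 with hγ
  have hγ0 : 0 < γ := by
    have : (0:ℝ) ≤ n := Nat.cast_nonneg n
    rw [hγ]; linarith
  set c := m * R ^ γ with hc
  have hc0 : 0 < c := mul_pos hm (Real.rpow_pos_of_pos hR _)
  have key : ∀ T, R < T → ∀ x y, 0 ≤ y → R ≤ rho (x, y) → rho (x, y) ≤ T →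
      0 ≤ w (x, y) - c * (rho (x, y) ^ (-γ) - T ^ (-γ)) := by
    intro T hT
    refine annulus_min ha (μ := R) (R := T) (fun z => w z - c * (rho z ^ (-γ) - T ^ (-γ))) ?_ ?_ ?_ ?_
    · refine (hw.mono fun z hz => ⟨hz.1, hz.2.1⟩).sub (continuousOn_const.mul (ContinuousOn.sub ?_ continuousOn_const))
      refine continuous_rho.continuousOn.rpow_const fun z hz => Or.inl ?_
      have : R ≤ rho z := hz.2.1
      linarith
    · intro x y hy h1
      have h2 := hwR x y hy h1
      simp only [h1]
      have : c * R ^ (-γ) = m := by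
        rw [hc, mul_assoc, ← Real.rpow_add hR]; simp
      have h3 : 0 < c * T ^ (-γ) := mul_pos hc0 (Real.rpow_pos_of_pos (by linarith) _)
      rw [mul_sub, this]; linarith
    · intro x y hy h1
      simp only [h1, sub_self, mul_zero, sub_zero]
      exact hw0 x y hy (by linarith)
    · intro x y hy h1 h2 _
      obtain ⟨l, hl, hL⟩ := h x y hy h1
      refine ⟨l - c * (0 - 0), by linarith, hL.sub (((hasL_rho_rpow x y (by linarith)).sub (HasL.const _)).const_mul c)⟩
  intro x y hy h1
  have lim : Tendsto (fun T : ℝ => w (x, y) - c * (rho (x, y) ^ (-γ) - T ^ (-γ))) atTop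
      (𝓝 (w (x, y) - c * (rho (x, y) ^ (-γ) - 0))) :=
    tendsto_const_nhds.sub ((tendsto_const_nhds.sub (tendsto_rpow_neg_atTop hγ0)).const_mul c)
  have : 0 ≤ w (x, y) - c * (rho (x, y) ^ (-γ) - 0) := by
    refine ge_of_tendsto lim ?_
    filter_upwards [eventually_gt_atTop R, eventually_ge_atTop (rho (x, y))] with T h2 h3
    exact key T h2 x y hy h1 h3
  linarith

/-- Maximum principle in narrow annuli. -/
theorem narrow {n : ℕ} {a : ℝ} (ha : 1 < a) {μ R η C : ℝ} (hη : 0 < η) (hC : 0 ≤ C)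
    (hRη : R - μ ≤ η) (hCη : C * η ≤ n + 2 * a) (w : (Fin n → ℝ) × ℝ → ℝ)
    (hw : ContinuousOn w {z | 0 ≤ z.2 ∧ μ ≤ rho z ∧ rho z ≤ R})
    (hμ : ∀ x y, 0 ≤ y → rho (x, y) = μ → 0 ≤ w (x, y))
    (hR : ∀ x y, 0 ≤ y → rho (x, y) = R → 0 ≤ w (x, y))
    (h : ∀ x y, 0 < y → μ < rho (x, y) → rho (x, y) < R → w (x, y) < 0 →
      ∃ l ≤ C * (-w (x, y)), HasL a w x y l) :
    ∀ x y, 0 ≤ y → μ ≤ rho (x, y) → rho (x, y) ≤ R → 0 ≤ w (x, y) := by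
  intro x1 y1 hy1 h1 h2
  by_contra hneg
  push Not at hneg
  set A := {z : (Fin n → ℝ) × ℝ | 0 ≤ z.2 ∧ μ ≤ rho z ∧ rho z ≤ R} with hA
  have hK : IsCompact A := by
    refine (isCompact_rho R).of_isClosed_subset ?_ fun z hz => ⟨hz.1, hz.2.2⟩
    exact (isClosed_le continuous_const continuous_snd).inter
      ((isClosed_le continuous_const continuous_rho).inter (isClosed_le continuous_rho continuous_const))
  let H : (Fin n → ℝ) × ℝ → ℝ := fun z => 2 - η⁻¹ * (rho z - μ)
  have hHc : Continuous H := by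
    have := continuous_rho (n := n)
    fun_prop
  have hH1 : ∀ z ∈ A, 1 ≤ H z ∧ H z ≤ 2 := by
    rintro z ⟨_, h3, h4⟩
    have e1 : η⁻¹ * (rho z - μ) ≤ 1 := by
      rw [inv_mul_le_iff₀ hη]; linarith
    have e2 : 0 ≤ η⁻¹ * (rho z - μ) := mul_nonneg (inv_pos.2 hη).le (by linarith)
    constructor <;> simp only [H] <;> linarith
  have hqc : ContinuousOn (fun z => -w z / H z) A :=
    hw.neg.div hHc.continuousOn fun z hz => by linarith [(hH1 z hz).1]
  obtain ⟨⟨x0, y0⟩, hz0, hmax⟩ := hK.exists_isMaxOn ⟨(x1, y1), hy1, h1, h2⟩ hqc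
  set m := -w (x0, y0) / H (x0, y0) with hm
  have hmz : ∀ z ∈ A, -w z ≤ m * H z := fun z hz => by
    have := hmax hz
    simp only [mem_ofPred_eq] at this
    rwa [div_le_iff₀ (by linarith [(hH1 z hz).1])] at this
  have hm0 : 0 < m := by
    by_contra hc
    push Not at hc
    have := hmz (x1, y1) ⟨hy1, h1, h2⟩
    have h5 := (hH1 (x1, y1) ⟨hy1, h1, h2⟩).1
    nlinarith
  have hwz0 : w (x0, y0) = - (m * H (x0, y0)) := by
    rw [hm, div_mul_cancel₀]; ring
    linarith [(hH1 _ hz0).1]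
  have key := annulus_min ha (μ := μ) (R := R) (fun z => w z + m * (H z - 1)) ?_ ?_ ?_ ?_ x0 y0 hz0.1
    hz0.2.1 hz0.2.2
  · simp only [hwz0] at key; linarith
  · exact hw.add (by fun_prop)
  · intro x y hy h3
    by_cases h4 : μ ≤ R
    · have := (hH1 (x, y) ⟨hy, h3.ge, by linarith⟩).1
      have := mul_nonneg hm0.le (sub_nonneg.2 this)
      have := hμ x y hy h3
      linarith
    · linarith
  · intro x y hy h3
    by_cases h4 : μ ≤ R
    · have := (hH1 (x, y) ⟨hy, by linarith, h3.le⟩).1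
      have := mul_nonneg hm0.le (sub_nonneg.2 this)
      have := hR x y hy h3
      linarith
    · linarith
  · intro x y hy h3 h4 h5
    have hz : (x, y) ∈ A := ⟨hy.le, h3.le, h4.le⟩
    have e1 := hH1 _ hz
    have e2 := hmz _ hz
    have h6 : w (x, y) < 0 := by
      have := mul_nonneg hm0.le (sub_nonneg.2 e1.1)
      linarith
    obtain ⟨l, hl, hL⟩ := h x y hy h3 h4 h6
    have hLH : HasL a H x y (0 - η⁻¹ * (2 * (n + 2 * a) - 0)) :=
      (HasL.const 2).sub (((hasL_rho x y).sub (HasL.const μ)).const_mul _)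
    refine ⟨l + m * (0 - η⁻¹ * (2 * (n + 2 * a) - 0) - 0), ?_, hL.add ((hLH.sub (HasL.const 1)).const_mul m)⟩
    have e3 : C ≤ η⁻¹ * (n + 2 * a) := by
      rw [inv_mul_eq_div, le_div_iff₀ hη]; exact hCη
    have e4 : C * (-w (x, y)) ≤ C * (2 * m) := by
      apply mul_le_mul_of_nonneg_left _ hC
      nlinarith
    nlinarith

/-- Barrier function. -/
def phi {n : ℕ} (κ b : ℝ) (c : Fin n → ℝ) (z : (Fin n → ℝ) × ℝ) : ℝ :=
  κ * (z.2 - b) ^ 2 + ∑ i, (z.1 i - c i) ^ 2 + 0 * z.2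

theorem continuous_phi {n : ℕ} (κ b : ℝ) (c : Fin n → ℝ) : Continuous (phi κ b c) := by
  unfold phi; fun_prop

set_option maxHeartbeats 1000000 in
theorem propagate {n : ℕ} {a : ℝ} (ha : 1 < a) {yq M : ℝ} (hyq : 0 < yq) (hM : 0 < M)
    (xq : Fin n → ℝ) {κ : ℝ} (hκ : κ = 2 * (n + 1) / (a * yq))
    (w : (Fin n → ℝ) × ℝ → ℝ)
    (hw : ContinuousOn w {z | 0 ≤ z.2 ∧ phi κ yq xq z ≤ M})
    (hw0 : ∀ x y, 0 ≤ y → phi κ yq xq (x, y) ≤ M → 0 ≤ w (x, y))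
    (h : ∀ x y, 0 < y → phi κ yq xq (x, y) < M → ∃ l ≤ 0, HasL a w x y l)
    (hq : 0 < w (xq, yq)) :
    ∀ x y, 0 ≤ y → phi κ yq xq (x, y) < M → 0 < w (x, y) := by
  have hn : (0:ℝ) ≤ n := Nat.cast_nonneg n
  have hκ0 : 0 < κ := by rw [hκ]; positivity
  have hκa : κ * yq * a = 2 * (n + 1) := by rw [hκ]; field_simp
  set m := w (xq, yq) / 2 with hm
  have hm0 : 0 < m := by positivity
  have hphi0 : phi κ yq xq (xq, yq) = 0 := by simp [phi]
  obtain ⟨δ, hδ0, hδM, hδ⟩ : ∃ δ, 0 < δ ∧ δ < M ∧ ∀ x y, 0 ≤ y → phi κ yq xq (x, y) ≤ δ → m ≤ w (x, y) := by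
    have h1 := hw (xq, yq) ⟨hyq.le, by rw [hphi0]; exact hM.le⟩
    have h2 : ∀ᶠ z in 𝓝[{z | 0 ≤ z.2 ∧ phi κ yq xq z ≤ M}] (xq, yq), m < w z :=
      h1.eventually (lt_mem_nhds (by linarith))
    obtain ⟨ε, hε, h3⟩ := Metric.mem_nhdsWithin_iff.1 h2
    refine ⟨min (M / 2) (min (κ * (ε / 2) ^ 2) ((ε / 2) ^ 2)), by positivity, ?_, ?_⟩
    · exact (min_le_left _ _).trans_lt (by linarith)
    · intro x y hy hp
      have p1 := hp.trans (min_le_left _ _)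
      have p2 := hp.trans ((min_le_right _ _).trans (min_le_left _ _))
      have p3 := hp.trans ((min_le_right _ _).trans (min_le_right _ _))
      refine (h3 ⟨?_, hy, by linarith⟩ : m < w (x, y)).le
      have hs : 0 ≤ ∑ i, (x i - xq i) ^ 2 := Finset.sum_nonneg fun i _ => sq_nonneg _
      have hk : 0 ≤ κ * (y - yq) ^ 2 := by positivity
      simp only [phi] at p1 p2 p3
      have : dist (x, y) (xq, yq) ≤ ε / 2 := by
        rw [Prod.dist_eq, max_le_iff]
        constructor
        · rw [dist_pi_le_iff (by positivity)]
          intro i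
          have := Finset.single_le_sum (f := fun i => (x i - xq i) ^ 2) (fun i _ => sq_nonneg _) (Finset.mem_univ i)
          rw [Real.dist_eq]
          apply abs_le_of_sq_le_sq _ (by positivity)
          linarith
        · rw [Real.dist_eq]
          apply abs_le_of_sq_le_sq _ (by positivity)
          apply le_of_mul_le_mul_left _ hκ0
          linarith
      rw [Metric.mem_ball]; linarith
  set Y := yq + M / κ + 1 with hY
  have hY0 : 0 < Y := by positivity
  set T := 2 * κ * Y + 2 * a * κ * Y + 2 * n with hT
  have hT0 : 0 ≤ T := by positivity
  set K := T * (1 + a) / (4 * δ) + 1 with hK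
  have hK0 : 0 < K := by positivity
  have hKT : T ≤ K * (4 / (1 + a) * δ) := by
    rw [hK, add_mul]
    have : T * (1 + a) / (4 * δ) * (4 / (1 + a) * δ) = T := by field_simp
    rw [this]
    have : 0 ≤ 1 * (4 / (1 + a) * δ) := by positivity
    linarith
  set ψ : ((Fin n → ℝ) × ℝ) → ℝ := fun z => Real.exp (-K * phi κ yq xq z) - Real.exp (-K * M) with hψ
  have hψc : Continuous ψ := by
    have := continuous_phi κ yq xq
    fun_prop
  have hψL : ∀ x y, 0 < y → δ ≤ phi κ yq xq (x, y) → phi κ yq xq (x, y) ≤ M →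
      ∃ l ≥ 0, HasL a ψ x y l := by
    intro x y hy h1 h2
    have hF : HasD2 (fun s => Real.exp (-K * s) + (- Real.exp (-K * M))) (phi κ yq xq (x, y))
        (-K * Real.exp (-K * phi κ yq xq (x, y))) (K ^ 2 * Real.exp (-K * phi κ yq xq (x, y))) := by
      have := (HasD2.comp (g := fun s => -K * s) (HasD2.of_exp (-K * phi κ yq xq (x, y)))
        ((HasD2.id (phi κ yq xq (x, y))).const_mul (-K))).add (HasD2.const (- Real.exp (-K * M)) _)
      exact this.congr' (by ring) (by ring)
    have hJ := hasJ_quad κ yq 0 xq x y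
    have hL := HasL.comp (a := a) (f := phi κ yq xq) hJ hF
    refine ⟨_, ?_, hL⟩
    set e := Real.exp (-K * phi κ yq xq (x, y)) with he
    have he0 : 0 < e := Real.exp_pos _
    set S := ∑ i, (x i - xq i) ^ 2 with hS
    have hs : 0 ≤ S := Finset.sum_nonneg fun i _ => sq_nonneg _
    have hphi : phi κ yq xq (x, y) = κ * (y - yq) ^ 2 + S := by simp [phi, hS]
    have e1 : ∑ i, (2 * (x i - xq i)) ^ 2 = 4 * S := by
      rw [hS, Finset.mul_sum]; exact Finset.sum_congr rfl fun i _ => by ring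
    rw [e1]
    simp only [Finset.sum_const, Finset.card_univ, Fintype.card_fin, nsmul_eq_mul, add_zero]
    set Λ := y * (2 * κ) + a * (2 * κ * (y - yq)) + n * 2 with hΛ
    set G := y * (2 * κ * (y - yq)) ^ 2 + 4 * S with hG
    have hG0 : 0 ≤ G := by positivity
    have main : Λ ≤ K * G := by
      rcases le_total (y * (2 * (1 + a))) (a * yq) with hc | hc
      · have : Λ ≤ 0 := by
          rw [hΛ]
          have : κ * (y * (2 * (1 + a))) ≤ κ * (a * yq) := mul_le_mul_of_nonneg_left hc hκ0.le
          nlinarith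
        have : 0 ≤ K * G := by positivity
        linarith
      · have hyY : y ≤ Y := by
          have : (y - yq) ^ 2 ≤ M / κ := by
            rw [le_div_iff₀ hκ0]; linarith
          have : |y - yq| ≤ M / κ + 1 := by
            have : 0 ≤ M / κ := by positivity
            apply abs_le_of_sq_le_sq _ (by positivity)
            nlinarith
          have := le_abs_self (y - yq)
          linarith
        have l1 : Λ ≤ T := by
          rw [hΛ, hT]
          have p1 : κ * y ≤ κ * Y := mul_le_mul_of_nonneg_left hyY hκ0.le
          have p2 : 0 < a * κ * yq := by positivity
          have p3 : a * (κ * y) ≤ a * (κ * Y) := mul_le_mul_of_nonneg_left p1 (by linarith)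
          linarith
        have l2 : 4 / (1 + a) * δ ≤ G := by
          have p0 : κ * (a * yq) ≤ κ * (y * (2 * (1 + a))) := mul_le_mul_of_nonneg_left hc hκ0.le
          have p1 : 1 ≤ κ * y * (1 + a) := by linarith
          have p2 : κ * (y - yq) ^ 2 ≤ κ * (y - yq) ^ 2 * (κ * y * (1 + a)) :=
            le_mul_of_one_le_right (by positivity) p1
          rw [div_mul_eq_mul_div, div_le_iff₀ (by linarith), hG]
          have p3 : δ ≤ κ * (y - yq) ^ 2 + S := by linarith
          have p4 : 0 ≤ S * a := by positivity
          linarith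
        calc Λ ≤ T := l1
          _ ≤ K * (4 / (1 + a) * δ) := hKT
          _ ≤ K * G := mul_le_mul_of_nonneg_left l2 hK0.le
    have : -K * e * Λ + K ^ 2 * e * G = K * e * (K * G - Λ) := by ring
    rw [this]
    have := sub_nonneg.2 main
    positivity
  have hψ1 : ∀ z, 0 ≤ z.2 → 0 ≤ phi κ yq xq z → ψ z ≤ 1 := by
    intro z _ h1
    have p1 : Real.exp (-K * phi κ yq xq z) ≤ 1 := by
      rw [Real.exp_le_one_iff]; nlinarith
    have p2 := Real.exp_pos (-K * M)
    simp only [hψ]; linarith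
  have hKc : IsCompact {z : (Fin n → ℝ) × ℝ | 0 ≤ z.2 ∧ δ ≤ phi κ yq xq z ∧ phi κ yq xq z ≤ M} := by
    refine (isCompact_quad hκ0 yq 0 M le_rfl xq).of_isClosed_subset ?_ fun z hz => ⟨hz.1, hz.2.2⟩
    exact (isClosed_le continuous_const continuous_snd).inter
      ((isClosed_le continuous_const (continuous_phi κ yq xq)).inter
        (isClosed_le (continuous_phi κ yq xq) continuous_const))
  have key := min_principle ha hKc (fun z => w z - m * ψ z)
    ((hw.mono fun z hz => ⟨hz.1, hz.2.2⟩).sub (hψc.const_mul m |>.continuousOn)) ?_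
  · have all : ∀ x y, 0 < y → phi κ yq xq (x, y) ≤ M → m * ψ (x, y) ≤ w (x, y) := by
      intro x y hy h1
      rcases le_total δ (phi κ yq xq (x, y)) with h2 | h2
      · have := key x y ⟨hy.le, h2, h1⟩ hy
        linarith
      · have p1 := hδ x y hy.le h2
        have p2 : ψ (x, y) ≤ 1 := hψ1 _ hy.le (by unfold phi; positivity)
        nlinarith
    have pos : ∀ z, phi κ yq xq z < M → 0 < m * ψ z := by
      intro z hz
      refine mul_pos hm0 (sub_pos.2 (Real.exp_lt_exp.2 ?_))
      nlinarith
    intro x y hy h1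
    rcases hy.lt_or_eq with hy | rfl
    · exact (pos _ h1).trans_le (all x y hy h1.le)
    · have ev : ∀ᶠ t in 𝓝[>] (0:ℝ), 0 < t ∧ (x, t) ∈ {z : (Fin n → ℝ) × ℝ | 0 ≤ z.2 ∧ phi κ yq xq z ≤ M} := by
        have hc : Continuous (fun t : ℝ => phi κ yq xq (x, t)) := (continuous_phi κ yq xq).comp (by fun_prop)
        filter_upwards [(hc.continuousAt (x := 0)).tendsto.eventually (gt_mem_nhds h1) |>.filter_mono nhdsWithin_le_nhds,
          self_mem_nhdsWithin] with t h2 h3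
        exact ⟨h3, le_of_lt h3, le_of_lt h2⟩
      have h3 := (hw (x, 0) ⟨le_rfl, h1.le⟩).tendsto.comp (tendsto_up x (ev.mono fun t ht => ht.2))
      have h4 : Tendsto (fun t : ℝ => m * ψ (x, t)) (𝓝[>] 0) (𝓝 (m * ψ (x, 0))) := by
        have : Continuous (fun t : ℝ => m * ψ (x, t)) := by fun_prop
        exact (this.tendsto 0).mono_left nhdsWithin_le_nhds
      exact (pos _ h1).trans_le (le_of_tendsto_of_tendsto h4 h3 (ev.mono fun t ht => all x t ht.1 ht.2.2))
  · rintro x y ⟨h0, h1, h2⟩ hy hneg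
    have h1' : δ < phi κ yq xq (x, y) := by
      refine lt_of_le_of_ne h1 fun e => ?_
      have p1 := hδ x y hy.le e.ge
      have p2 : ψ (x, y) ≤ 1 := hψ1 _ hy.le (by unfold phi; positivity)
      nlinarith
    have h2' : phi κ yq xq (x, y) < M := by
      refine lt_of_le_of_ne h2 fun e => ?_
      have p1 := hw0 x y hy.le e.le
      have p2 : ψ (x, y) = 0 := by simp [hψ, e]
      rw [p2] at hneg; linarith
    constructor
    · have c1 := ((continuous_phi κ yq xq).continuousAt (x := (x, y))).tendsto
      have c2 : Tendsto (Prod.snd : (Fin n → ℝ) × ℝ → ℝ) (𝓝 (x, y)) (𝓝 y) := continuous_snd.continuousAt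
      filter_upwards [c1.eventually (lt_mem_nhds h1'), c1.eventually (gt_mem_nhds h2'),
        c2.eventually (lt_mem_nhds hy)] with z a b c using ⟨c.le, a.le, b.le⟩
    · obtain ⟨l, hl, hL⟩ := h x y hy h2'
      obtain ⟨l', hl', hL'⟩ := hψL x y hy h1 h2
      refine ⟨l - m * l', ?_, hL.sub (hL'.const_mul m)⟩
      have : 0 ≤ m * l' := by positivity
      linarith

theorem isPreconnected_ext {n : ℕ} (μ : ℝ) :
    IsPreconnected {z : (Fin n → ℝ) × ℝ | 0 ≤ z.2 ∧ μ < rho z} := by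
  refine isPreconnected_of_forall ((0, |μ| + 1) : (Fin n → ℝ) × ℝ) ?_
  rintro ⟨x, y⟩ ⟨hy, hz⟩
  simp only at hy
  have hrho : ∀ (x : Fin n → ℝ) y, 4 * y ≤ rho (x, y) := fun x y => by
    have : 0 ≤ ∑ i, x i ^ 2 := Finset.sum_nonneg fun i _ => sq_nonneg _
    simp only [rho_eq]; linarith
  have hμ := le_abs_self μ
  have hμ0 := abs_nonneg μ
  refine ⟨(univ ×ˢ Ioi |μ|) ∪ ({x} ×ˢ Ici y), ?_, Or.inl ⟨mem_univ _, by simp⟩, Or.inr ⟨rfl, self_mem_Ici⟩, ?_⟩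
  · rintro ⟨x', y'⟩ (⟨_, h⟩ | ⟨h1, h2⟩)
    · simp only [mem_Ioi] at h
      refine ⟨hμ0.trans h.le, ?_⟩
      have := hrho x' y'
      linarith
    · simp only [mem_singleton_iff, mem_Ici] at h1 h2
      subst h1
      refine ⟨hy.trans h2, ?_⟩
      simp only [rho_eq] at *; linarith
  · refine IsPreconnected.union (x, max y (|μ| + 1)) ⟨mem_univ _, ?_⟩ ⟨rfl, mem_Ici.2 (le_max_left _ _)⟩ ?_ ?_
    · simp
    · exact (convex_univ.prod (convex_Ioi _)).isPreconnected
    · exact ((convex_singleton x).prod (convex_Ici _)).isPreconnected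

theorem smp {n : ℕ} {a : ℝ} (ha : 1 < a) {μ : ℝ} (w : (Fin n → ℝ) × ℝ → ℝ)
    (hw : ContinuousOn w {z | 0 ≤ z.2 ∧ μ < rho z})
    (hw0 : ∀ x y, 0 ≤ y → μ < rho (x, y) → 0 ≤ w (x, y))
    (h : ∀ x y, 0 < y → μ < rho (x, y) → ∃ l ≤ 0, HasL a w x y l)
    {x0 : Fin n → ℝ} {y0 : ℝ} (hy0 : 0 ≤ y0) (hr0 : μ < rho (x0, y0)) (hp : 0 < w (x0, y0)) :
    ∀ x y, 0 ≤ y → μ < rho (x, y) → 0 < w (x, y) := by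
  have hn : (0:ℝ) ≤ n := Nat.cast_nonneg n
  set D := {z : (Fin n → ℝ) × ℝ | 0 ≤ z.2 ∧ μ < rho z} with hD
  set U := {z : (Fin n → ℝ) × ℝ | ∀ᶠ z' in 𝓝 z, z' ∈ D → 0 < w z'} with hU
  set V := {z : (Fin n → ℝ) × ℝ | ∀ᶠ z' in 𝓝 z, z' ∈ D → w z' = 0} with hV
  have hUo : IsOpen U := isOpen_iff_mem_nhds.2 fun z hz => eventually_eventually_nhds.2 hz
  have hVo : IsOpen V := isOpen_iff_mem_nhds.2 fun z hz => eventually_eventually_nhds.2 hz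
  have hDU : ∀ z ∈ D, 0 < w z → z ∈ U := fun z hz hpos => by
    have := (hw z hz).eventually (lt_mem_nhds hpos)
    exact eventually_nhdsWithin_iff.1 this
  have hDV : ∀ z ∈ D, w z = 0 → z ∈ V := by
    rintro ⟨xp, yp⟩ ⟨hyp, hrp⟩ hzero
    simp only at hyp
    have hball : ∀ᶠ z in 𝓝 (xp, yp), μ < rho z :=
      (continuous_rho.continuousAt (x := (xp, yp))).tendsto.eventually (lt_mem_nhds hrp)
    obtain ⟨ε, hε, hb⟩ := Metric.eventually_nhds_iff.1 hball
    set η := (ε / 4) ^ 2 / (1 + a * (yp + 1)) with hη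
    have hden : 0 < 1 + a * (yp + 1) := by positivity
    have hη0 : 0 < η := by positivity
    have hphi : ∀ᶠ z in 𝓝 (xp, yp), 0 < z.2 → phi (2 * (n + 1) / (a * z.2)) z.2 z.1 (xp, yp) < η := by
      have hs : Tendsto (fun z : (Fin n → ℝ) × ℝ => ∑ i, (xp i - z.1 i) ^ 2) (𝓝 (xp, yp)) (𝓝 0) := by
        have : Continuous (fun z : (Fin n → ℝ) × ℝ => ∑ i, (xp i - z.1 i) ^ 2) := by fun_prop
        have h2 := this.tendsto (xp, yp)
        simpa using h2
      have hk : ∃ g : ((Fin n → ℝ) × ℝ) → ℝ, Tendsto g (𝓝 (xp, yp)) (𝓝 0) ∧ ∀ z, 0 < z.2 →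
          2 * (n + 1) / (a * z.2) * (yp - z.2) ^ 2 = g z := by
        rcases hyp.lt_or_eq with hyp | rfl
        · refine ⟨_, ?_, fun z _ => rfl⟩
          have : ContinuousAt (fun z : (Fin n → ℝ) × ℝ => 2 * (n + 1) / (a * z.2) * (yp - z.2) ^ 2) (xp, yp) := by
            refine ContinuousAt.mul (ContinuousAt.div (by fun_prop) (by fun_prop) ?_) (by fun_prop)
            simp only; positivity
          have h2 := this.tendsto
          simpa using h2
        · refine ⟨fun z => 2 * (n + 1) / a * z.2, ?_, fun z hz => ?_⟩
          · have : Continuous (fun z : (Fin n → ℝ) × ℝ => 2 * (n + 1) / a * z.2) := by fun_prop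
            have h2 := this.tendsto (xp, 0)
            simpa using h2
          · field_simp; ring
      obtain ⟨g, hg, hg2⟩ := hk
      have := hg.add hs
      rw [add_zero] at this
      filter_upwards [this.eventually (gt_mem_nhds hη0)] with z hz hz2
      simp only [phi, zero_mul, add_zero]
      rw [hg2 z hz2]; exact hz
    have hzeropos : ∀ᶠ z in 𝓝 (xp, yp), 0 < z.2 → w z = 0 := by
      have hyl : ∀ᶠ z : (Fin n → ℝ) × ℝ in 𝓝 (xp, yp), z.2 < yp + 1 :=
        (continuous_snd.continuousAt (x := (xp, yp))).tendsto.eventually (gt_mem_nhds (by simp))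
      filter_upwards [hphi, Metric.ball_mem_nhds (xp, yp) (half_pos hε), hyl] with z h1 h2 h3 hz
      obtain ⟨xq, yq⟩ := z
      simp only at hz h1 h3
      specialize h1 hz
      by_contra hne
      have hqD : (xq, yq) ∈ D := ⟨hz.le, hb (lt_trans h2 (by linarith))⟩
      have hpos : 0 < w (xq, yq) := lt_of_le_of_ne (hw0 _ _ hz.le hqD.2) (Ne.symm hne)
      set κ := 2 * ((n:ℝ) + 1) / (a * yq) with hκ
      have hκ0 : 0 < κ := by positivity
      have hsub : ∀ x y, phi κ yq xq (x, y) ≤ η → μ < rho (x, y) := by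
        intro x y hph
        apply hb
        simp only [phi, zero_mul, add_zero] at hph
        have hs : 0 ≤ ∑ i, (x i - xq i) ^ 2 := Finset.sum_nonneg fun i _ => sq_nonneg _
        have hk : 0 ≤ κ * (y - yq) ^ 2 := by positivity
        have hηe : η * (1 + a * (yp + 1)) = (ε / 4) ^ 2 := by rw [hη]; field_simp
        have hay : 0 ≤ a * (yp + 1) := by positivity
        have : dist (x, y) (xq, yq) ≤ ε / 4 := by
          rw [Prod.dist_eq, max_le_iff]
          constructor
          · rw [dist_pi_le_iff (by positivity)]
            intro i
            have := Finset.single_le_sum (f := fun i => (x i - xq i) ^ 2) (fun i _ => sq_nonneg _) (Finset.mem_univ i)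
            rw [Real.dist_eq]
            apply abs_le_of_sq_le_sq _ (by positivity)
            have := mul_nonneg hη0.le hay
            linarith
          · rw [Real.dist_eq]
            apply abs_le_of_sq_le_sq _ (by positivity)
            have h5 : κ * (a * yq) = 2 * (n + 1) := by rw [hκ]; field_simp
            have h6 : (y - yq) ^ 2 ≤ η * (a * yq) := by
              have : κ * (y - yq) ^ 2 * (a * yq) ≤ η * (a * yq) :=
                mul_le_mul_of_nonneg_right (by linarith) (by positivity)
              have h7 : κ * (y - yq) ^ 2 * (a * yq) = 2 * (n + 1) * (y - yq) ^ 2 := by rw [← h5]; ring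
              have h8 : 0 ≤ (2 * n + 1) * (y - yq) ^ 2 := by positivity
              linarith
            have h9 : η * (a * yq) ≤ η * (a * (yp + 1)) :=
              mul_le_mul_of_nonneg_left (mul_le_mul_of_nonneg_left h3.le (by linarith)) hη0.le
            linarith
        have h4 := dist_triangle (x, y) (xq, yq) (xp, yp)
        rw [Metric.mem_ball] at h2
        linarith
      have := propagate ha hz hη0 xq hκ w (hw.mono fun z hz => ⟨hz.1, hsub z.1 z.2 hz.2⟩)
        (fun x y hy hph => hw0 x y hy (hsub x y hph)) (fun x y hy hph => h x y hy (hsub x y hph.le)) hpos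
        xp yp hyp h1
      linarith
    have hz2 := eventually_eventually_nhds.2 hzeropos
    filter_upwards [hz2] with z hz hzD
    obtain ⟨x, y⟩ := z
    rcases (show 0 ≤ y from hzD.1).lt_or_eq with hy | rfl
    · exact hz.self_of_nhds hy
    · have hc : Tendsto (fun t : ℝ => (x, t)) (𝓝[>] 0) (𝓝 (x, 0)) := by
        have hc : Continuous (fun t : ℝ => (x, t)) := by fun_prop
        exact (hc.tendsto 0).mono_left nhdsWithin_le_nhds
      have ev := hc.eventually hz
      have ev2 : ∀ᶠ t in 𝓝[>] (0:ℝ), (x, t) ∈ D := by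
        filter_upwards [self_mem_nhdsWithin] with t ht
        have ht' : 0 < t := ht
        refine ⟨ht'.le, ?_⟩
        have : μ < rho (x, (0:ℝ)) := hzD.2
        simp only [rho_eq] at *; linarith
      have h3 := (hw (x, 0) hzD).tendsto.comp (tendsto_up x ev2)
      refine tendsto_nhds_unique h3 ?_
      refine tendsto_const_nhds.congr' ?_
      filter_upwards [ev, self_mem_nhdsWithin] with t h4 h5
      exact (h4 h5).symm
  intro x y hy hr
  by_contra hneg
  have hz : w (x, y) = 0 := le_antisymm (not_lt.1 hneg) (hw0 x y hy hr)
  obtain ⟨z, hzD, hzU, hzV⟩ := isPreconnected_ext μ U V hUo hVo (fun z hz => by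
    rcases (hw0 z.1 z.2 hz.1 hz.2).lt_or_eq with h1 | h1
    · exact Or.inl (hDU z hz h1)
    · exact Or.inr (hDV z hz h1.symm)) ⟨(x0, y0), ⟨hy0, hr0⟩, hDU _ ⟨hy0, hr0⟩ hp⟩
    ⟨(x, y), ⟨hy, hr⟩, hDV _ ⟨hy, hr⟩ hz⟩
  have := hzU.self_of_nhds hzD
  have := hzV.self_of_nhds hzD
  linarith

theorem HasD2.of_inv {r : ℝ} (hr : 0 < r) : HasD2 (fun s : ℝ => s⁻¹) r (-(r ^ 2)⁻¹) (2 * (r ^ 3)⁻¹) := by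
  refine ⟨fun s => -(s ^ 2)⁻¹, ?_, rfl, ?_⟩
  · filter_upwards [lt_mem_nhds hr] with s hs using hasDerivAt_inv hs.ne'
  · have h1 := ((hasDerivAt_pow 2 r).inv (by positivity)).neg
    refine h1.congr_deriv ?_
    field_simp
    norm_num; ring

theorem hasD2_update {n : ℕ} (x : Fin n → ℝ) (i : Fin n) (y : ℝ) (t : ℝ) :
    HasD2 (fun s => (Function.update x i s, y)) t ((Pi.single i 1, 0) : (Fin n → ℝ) × ℝ) 0 := by
  refine ⟨fun _ => (Pi.single i 1, 0), Eventually.of_forall fun s => ?_, rfl, hasDerivAt_const _ _⟩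
  exact (hasDerivAt_update x i s).prodMk (hasDerivAt_const s y)

theorem hasD2_vert {n : ℕ} (x : Fin n → ℝ) (t : ℝ) :
    HasD2 (fun s => (x, s)) t ((0, 1) : (Fin n → ℝ) × ℝ) 0 := by
  refine ⟨fun _ => (0, 1), Eventually.of_forall fun s => ?_, rfl, hasDerivAt_const _ _⟩
  exact (hasDerivAt_const s x).prodMk (hasDerivAt_id s)

/-- The operator, through Frechet derivatives. -/
noncomputable def Lop {n : ℕ} (a : ℝ) (u : (Fin n → ℝ) × ℝ → ℝ) (z : (Fin n → ℝ) × ℝ) : ℝ :=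
  z.2 * fderiv ℝ (fderiv ℝ u) z (0, 1) (0, 1) + a * fderiv ℝ u z (0, 1)
    + ∑ i, fderiv ℝ (fderiv ℝ u) z (Pi.single i 1, 0) (Pi.single i 1, 0)

theorem hasJ_of_contDiffAt {n : ℕ} {u : (Fin n → ℝ) × ℝ → ℝ} {x : Fin n → ℝ} {y : ℝ}
    (hu : ContDiffAt ℝ 2 u (x, y)) :
    HasJ u x y (fderiv ℝ u (x, y) (0, 1)) (fderiv ℝ (fderiv ℝ u) (x, y) (0, 1) (0, 1))
      (fun i => fderiv ℝ u (x, y) (Pi.single i 1, 0))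
      (fun i => fderiv ℝ (fderiv ℝ u) (x, y) (Pi.single i 1, 0) (Pi.single i 1, 0)) := by
  constructor
  · have := HasD2.comp_vec (u := u) (c := fun s => (x, s)) hu (hasD2_vert x y)
    simpa using this
  · intro i
    have := HasD2.comp_vec (u := u) (c := fun s => (Function.update x i s, y)) (t := x i)
      (by simpa using hu) (hasD2_update x i y (x i))
    simpa using this

theorem hasL_of_contDiffAt {n : ℕ} (a : ℝ) {u : (Fin n → ℝ) × ℝ → ℝ} {x : Fin n → ℝ} {y : ℝ}
    (hu : ContDiffAt ℝ 2 u (x, y)) : HasL a u x y (Lop a u (x, y)) :=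
  (hasJ_of_contDiffAt hu).hasL

structure Sol {n : ℕ} (a α : ℝ) (u : (Fin n → ℝ) × ℝ → ℝ) : Prop where
  reg : ContDiffOn ℝ 2 u {p : (Fin n → ℝ) × ℝ | 0 ≤ p.2}
  nonneg : ∀ (x : Fin n → ℝ) (y : ℝ), 0 ≤ y → 0 ≤ u (x, y)
  eq : ∀ (x : Fin n → ℝ) (y : ℝ), 0 < y → Lop a u (x, y) = -(u (x, y) ^ α)

namespace Sol
variable {n : ℕ} {a α : ℝ} {u : (Fin n → ℝ) × ℝ → ℝ}

theorem c2 (hu : Sol a α u) {x : Fin n → ℝ} {y : ℝ} (hy : 0 < y) : ContDiffAt ℝ 2 u (x, y) := by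
  refine hu.reg.contDiffAt ?_
  have c2 : Tendsto (Prod.snd : (Fin n → ℝ) × ℝ → ℝ) (𝓝 (x, y)) (𝓝 y) := continuous_snd.continuousAt
  filter_upwards [c2.eventually (lt_mem_nhds hy)] with z hz using le_of_lt hz

theorem cont (hu : Sol a α u) : ContinuousOn u {p : (Fin n → ℝ) × ℝ | 0 ≤ p.2} := hu.reg.continuousOn

theorem hasL (hu : Sol a α u) {x : Fin n → ℝ} {y : ℝ} (hy : 0 < y) : HasL a u x y (-(u (x, y) ^ α)) := by
  rw [← hu.eq x y hy]; exact hasL_of_contDiffAt a (hu.c2 hy)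

theorem trans (hu : Sol a α u) (c : Fin n → ℝ) : Sol a α (fun z => u (z + (c, 0))) := by
  refine ⟨?_, ?_, ?_⟩
  · refine hu.reg.comp (by fun_prop) ?_
    intro z hz
    simpa using hz
  · intro x y hy
    simpa using hu.nonneg (x + c) y hy
  · intro x y hy
    have h1 : fderiv ℝ (fun z => u (z + (c, 0))) = fun z => fderiv ℝ u (z + (c, 0)) := by
      ext1 z; rw [fderiv_comp_add_right]
    have h2 : fderiv ℝ (fun z => fderiv ℝ u (z + (c, 0))) = fun z => fderiv ℝ (fderiv ℝ u) (z + (c, 0)) := by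
      ext1 z; rw [fderiv_comp_add_right (f := fderiv ℝ u)]
    have := hu.eq (x + c) y hy
    simp only [Lop] at *
    rw [h1, h2]
    simpa using this

end Sol

theorem sol_of {n : ℕ} {a α : ℝ} {u : (Fin n → ℝ) × ℝ → ℝ}
    (hreg : ContDiffOn ℝ 2 u {p : (Fin n → ℝ) × ℝ | 0 ≤ p.2})
    (hnonneg : ∀ (x : Fin n → ℝ) (y : ℝ), 0 ≤ y → 0 ≤ u (x, y))
    (heq : ∀ (x : Fin n → ℝ) (y : ℝ), 0 < y →
      y * deriv (fun t => deriv (fun s => u (x, s)) t) y + a * deriv (fun t => u (x, t)) y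
        + (∑ i, deriv (fun t => deriv (fun s => u (Function.update x i s, y)) t) (x i))
        + u (x, y) ^ α = 0) : Sol a α u := by
  refine ⟨hreg, hnonneg, ?_⟩
  intro x y hy
  have hu : ContDiffAt ℝ 2 u (x, y) := by
    refine hreg.contDiffAt ?_
    have c2 : Tendsto (Prod.snd : (Fin n → ℝ) × ℝ → ℝ) (𝓝 (x, y)) (𝓝 y) := continuous_snd.continuousAt
    filter_upwards [c2.eventually (lt_mem_nhds hy)] with z hz using le_of_lt hz
  obtain ⟨h1, h2⟩ := hasJ_of_contDiffAt hu
  have key := heq x y hy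
  have k1 : HasD2 (fun s => u (x, s)) y (deriv (fun s => u (x, s)) y) (deriv (deriv fun s => u (x, s)) y) := by
    apply HasD2.of_contDiffAt
    exact hu.comp y (f := fun s => (x, s)) (by fun_prop)
  have k2 : ∀ i, HasD2 (fun s => u (Function.update x i s, y)) (x i)
      (deriv (fun s => u (Function.update x i s, y)) (x i))
      (deriv (deriv fun s => u (Function.update x i s, y)) (x i)) := by
    intro i
    apply HasD2.of_contDiffAt
    refine ContDiffAt.comp (x i) (f := fun s => (Function.update x i s, y)) (by simpa using hu) ?_
    exact ((contDiff_update 2 x i).prodMk contDiff_const).contDiffAt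
  have e1 := h1.unique k1
  have e2 := fun i => ((h2 i).unique (k2 i)).2
  have e3 : (∑ i, deriv (fun t => deriv (fun s => u (Function.update x i s, y)) t) (x i)) =
     ∑ i, fderiv ℝ (fderiv ℝ u) (x, y) (Pi.single i 1, 0) (Pi.single i 1, 0) :=
    Finset.sum_congr rfl fun i _ => (e2 i).symm
  rw [e3] at key
  simp only [Lop]
  rw [e1.1, e1.2]
  linarith

/-- Kelvin transform with parameter `μ` (square of the radius). -/
noncomputable def kel {n : ℕ} (a μ : ℝ) (u : (Fin n → ℝ) × ℝ → ℝ) (z : (Fin n → ℝ) × ℝ) : ℝ :=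
  (μ / rho z) ^ ((n + 2 * a - 2) / 2) * u ((μ / rho z) • z.1, (μ / rho z) ^ 2 * z.2)

theorem hasD2_sf {r : ℝ → ℝ} {t r1 r2 μ γ : ℝ} (hμ : 0 < μ) (hr : HasD2 r t r1 r2) (hr0 : 0 < r t) :
    HasD2 (fun s => μ / r s) t (-(μ / r t) * r1 / r t) ((μ / r t) * (2 * r1 ^ 2 / r t ^ 2 - r2 / r t)) ∧
    HasD2 (fun s => (μ / r s) ^ γ) t (-(μ / r t) ^ γ * (γ * r1 / r t))
      ((μ / r t) ^ γ * (γ * (γ + 1) * r1 ^ 2 / r t ^ 2 - γ * r2 / r t)) := by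
  have h1 : HasD2 (fun s => μ / r s) t (-(μ / r t) * r1 / r t)
      ((μ / r t) * (2 * r1 ^ 2 / r t ^ 2 - r2 / r t)) := by
    have := (HasD2.comp (g := r) (HasD2.of_inv hr0) hr).const_mul μ
    refine (this.congr (Eventually.of_forall fun s => ?_)).congr' ?_ ?_
    · simp [div_eq_mul_inv]
    · field_simp
    · field_simp; ring
  refine ⟨h1, ?_⟩
  have hs : 0 < μ / r t := by positivity
  have := HasD2.comp (g := fun s => μ / r s) (HasD2.of_rpow hs γ) h1
  refine this.congr' ?_ ?_
  · rw [Real.rpow_sub_one hs.ne']; field_simp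
  · rw [show γ - 2 = γ - 1 - 1 by ring, Real.rpow_sub_one hs.ne', Real.rpow_sub_one hs.ne']; field_simp; ring

theorem kel_rhs {n : ℕ} {a α μ : ℝ} (ha : 1 < a) (hα : α = (n + 2 * a + 2) / (n + 2 * a - 2))
    (u : (Fin n → ℝ) × ℝ → ℝ) (z) (hμ : 0 < μ) (hr : 0 < rho z)
    (hu : 0 ≤ u ((μ / rho z) • z.1, (μ / rho z) ^ 2 * z.2)) :
    kel a μ u z ^ α = (μ / rho z) ^ ((n + 2 * a - 2) / 2) * ((μ / rho z) ^ 2 *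
      u ((μ / rho z) • z.1, (μ / rho z) ^ 2 * z.2) ^ α) := by
  have hs : 0 < μ / rho z := by positivity
  have hn : (0:ℝ) ≤ n := Nat.cast_nonneg n
  have : (0:ℝ) < n + 2 * a - 2 := by linarith
  unfold kel
  rw [Real.mul_rpow (Real.rpow_nonneg hs.le _) hu, ← Real.rpow_mul hs.le, ← mul_assoc,
    ← Real.rpow_natCast (μ / rho z) 2, ← Real.rpow_add hs]
  congr 2
  rw [hα]; push_cast; field_simp; ring


theorem kel_line {F : Type*} [NormedAddCommGroup F] [NormedSpace ℝ F] {u : F → ℝ} {X : ℝ → F} {X1 ε P : F}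
    {r η : ℝ → ℝ} {t r1 r2 η1 μ γ s s1 s2 : ℝ} (hμ : 0 < μ) (hr : HasD2 r t r1 r2) (hr0 : 0 < r t)
    (hX : HasD2 X t X1 0) (hη : HasD2 η t η1 0) (hs : s = μ / r t)
    (hs1 : s1 = -s * r1 / r t) (hs2 : s2 = s * (2 * r1 ^ 2 / r t ^ 2 - r2 / r t))
    (hP : P = s • X t + (s * s * η t) • ε) (hu : ContDiffAt ℝ 2 u P) :
    HasD2 (fun τ => (μ / r τ) ^ γ * u ((μ / r τ) • X τ + ((μ / r τ) * (μ / r τ) * η τ) • ε)) t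
      (s ^ γ * fderiv ℝ u P (s • X1 + s1 • X t + (s * s * η1 + 2 * s * s1 * η t) • ε)
        - s ^ γ * (γ * r1 / r t) * u P)
      (s ^ γ * (fderiv ℝ (fderiv ℝ u) P (s • X1 + s1 • X t + (s * s * η1 + 2 * s * s1 * η t) • ε)
          (s • X1 + s1 • X t + (s * s * η1 + 2 * s * s1 * η t) • ε)
        + fderiv ℝ u P ((2 * s1) • X1 + s2 • X t + (4 * s * s1 * η1 + 2 * (s1 ^ 2 + s * s2) * η t) • ε))
        - 2 * (s ^ γ * (γ * r1 / r t)) * fderiv ℝ u P (s • X1 + s1 • X t + (s * s * η1 + 2 * s * s1 * η t) • ε)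
        + s ^ γ * (γ * (γ + 1) * r1 ^ 2 / r t ^ 2 - γ * r2 / r t) * u P) := by
  obtain ⟨h1, h2⟩ := hasD2_sf (γ := γ) hμ hr hr0
  rw [← hs] at h1 h2
  rw [← hs1, ← hs2] at h1
  have hc : HasD2 (fun τ => (μ / r τ) • X τ + ((μ / r τ) * (μ / r τ) * η τ) • ε) t
      (s • X1 + s1 • X t + (s * s * η1 + 2 * s * s1 * η t) • ε)
      ((2 * s1) • X1 + s2 • X t + (4 * s * s1 * η1 + 2 * (s1 ^ 2 + s * s2) * η t) • ε) := by
    refine ((h1.smul hX).add (((h1.mul h1).mul hη).smul (HasD2.const ε t))).congr' ?_ ?_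
    · rw [← hs]; simp only [smul_zero, zero_add]; congr 2; ring
    · rw [← hs]; simp only [smul_zero, zero_add, add_zero]; congr 2; ring
  have h3 := HasD2.comp_vec (u := u) (c := fun τ => (μ / r τ) • X τ + ((μ / r τ) * (μ / r τ) * η τ) • ε) (t := t)
    (by simp only [← hs]; rw [← hP]; exact hu) hc
  simp only [← hs, ← hP] at h3
  have h4 := h2.mul h3
  simp only [← hs, ← hP] at h4
  refine h4.congr' ?_ ?_ <;> ring

set_option maxHeartbeats 2000000 in
theorem kel_hasL {n : ℕ} {a α μ : ℝ} (ha : 1 < a) (hα : α = (n + 2 * a + 2) / (n + 2 * a - 2))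
    {u : (Fin n → ℝ) × ℝ → ℝ} (hu : Sol a α u) (hμ : 0 < μ) {x : Fin n → ℝ} {y : ℝ} (hy : 0 < y) :
    HasL a (kel a μ u) x y (-(kel a μ u (x, y) ^ α)) := by
  have hsum : 0 ≤ ∑ i, x i ^ 2 := Finset.sum_nonneg fun i _ => sq_nonneg _
  have hr : 0 < rho (x, y) := by simp only [rho_eq]; linarith
  set r := rho (x, y) with hrdef
  set s := μ / r with hs
  have hs0 : 0 < s := by positivity
  set γ := ((n:ℝ) + 2 * a - 2) / 2 with hγ
  set f := s ^ γ with hf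
  set P : (Fin n → ℝ) × ℝ := (s • x, s ^ 2 * y) with hP
  have hPy : 0 < s ^ 2 * y := by positivity
  have hc2 : ContDiffAt ℝ 2 u P := hu.c2 hPy
  set D := fderiv ℝ u P with hD
  set B := fderiv ℝ (fderiv ℝ u) P with hB
  have hsymm : ∀ v w, B v w = B w v := by
    have := (hc2.isSymmSndFDerivAt (by simp))
    intro v w; exact this v w
  have hrhs : kel a μ u (x, y) ^ α = f * (s ^ 2 * u P ^ α) :=
    kel_rhs ha hα u (x, y) hμ hr (hu.nonneg _ _ hPy.le)
  have heq := hu.eq (s • x) (s ^ 2 * y) hPy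
  obtain ⟨jy, jx⟩ := hasJ_rho x y
  set e : Fin n → (Fin n → ℝ) × ℝ := fun i => (Pi.single i 1, 0) with he
  set ε : (Fin n → ℝ) × ℝ := (0, 1) with hε
  set X : (Fin n → ℝ) × ℝ := (x, 0) with hX
  have hXe : X = ∑ i, x i • e i := by
    rw [Prod.ext_iff]
    constructor
    · simp only [hX, he, Prod.fst_sum, Prod.smul_fst]
      ext j
      simp [Finset.sum_apply, Pi.single_apply]
    · simp [hX, he, Prod.snd_sum]
  have sC : ∑ i, x i * B (e i) X = B X X := by
    conv_rhs => rw [hXe]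
    rw [map_sum]
    simp only [map_smul, smul_eq_mul]
    rw [← hXe]
    exact Finset.sum_congr rfl fun i _ => by rw [hsymm]
  have sE : ∑ i, x i * B (e i) ε = B X ε := by
    conv_rhs => rw [hXe]
    rw [map_sum]
    simp only [_root_.sum_apply, map_smul, _root_.smul_apply, smul_eq_mul]
  have sD : ∑ i, x i * D (e i) = D X := by
    conv_rhs => rw [hXe]
    rw [map_sum]
    simp only [map_smul, smul_eq_mul]
  have sS : ∑ i, x i ^ 2 = r - 4 * y := by rw [hrdef, rho_eq]; ring
  have hPe : s • X + (s * s * y) • ε = P := by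
    ext <;> simp [hX, hε, hP, sq]
  have hv := kel_line (u := u) (X := fun _ => X) (ε := ε) (P := P) (γ := γ) (s := s) hμ jy hr
    (HasD2.const X y) (HasD2.id y) rfl rfl rfl hPe.symm hc2
  have hh := fun i => kel_line (u := u) (X := fun t => (Function.update x i t, (0:ℝ))) (ε := ε) (P := P)
    (γ := γ) (s := s) hμ (jx i) (by simpa using hr)
    (hasD2_update x i 0 (x i)) (HasD2.const y _) (by simp [hs, hrdef]) rfl rfl (by simp [hPe, ← hX]) hc2
  have hv' := hv.congr (g := fun t => kel a μ u (x, t)) (Eventually.of_forall fun t => by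
    simp only [kel]
    congr 2
    ext <;> simp [hX, hε, sq])
  have hh' := fun i => (hh i).congr (g := fun t => kel a μ u (Function.update x i t, y))
    (Eventually.of_forall fun t => by
      simp only [kel]
      congr 2
      ext <;> simp [hε, sq])
  refine ⟨_, _, _, _, ⟨hv', hh'⟩, ?_⟩
  rw [hrhs]
  have heq' : s ^ 2 * y * B ε ε + a * D ε + ∑ i, B (e i) (e i) = -(u P ^ α) := heq
  have hu' : u P ^ α = -(s ^ 2 * y * B ε ε + a * D ε + ∑ i, B (e i) (e i)) := by rw [heq']; ring
  rw [hu']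
  simp only [Function.update_eq_self, ← hX, ← hD, ← hB, ← hrdef, map_add, map_smul, smul_eq_mul,
    _root_.add_apply, _root_.smul_apply, map_zero, _root_.zero_apply, hsymm X, hsymm ε (e _),
    show ∀ i, ((Pi.single i 1, 0) : (Fin n → ℝ) × ℝ) = e i from fun _ => rfl]
  have sE' : ∑ i, x i * B (e i) ε = B ε X := by rw [sE, hsymm]
  set c0 := -2 * s / r * D X - 4 * s ^ 2 * y / r * D ε - 2 * γ / r * u P with hc0
  set c1 := 4 * s ^ 2 / r ^ 2 * B X X + 16 * s ^ 3 * y / r ^ 2 * B ε X + 16 * s ^ 4 * y ^ 2 / r ^ 2 * B ε ε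
    + 8 * s / r ^ 2 * D X + 24 * y * s ^ 2 / r ^ 2 * D ε + 8 * γ * s / r ^ 2 * D X
    + 16 * γ * s ^ 2 * y / r ^ 2 * D ε + 4 * γ * (γ + 1) / r ^ 2 * u P with hc1
  have hsumm : ∀ (g : Fin n → ℝ), (∀ i, g i = f * (c0 + c1 * x i ^ 2 + s ^ 2 * B (e i) (e i)
      + (-4 * s ^ 2 / r) * (x i * B (e i) X) + (-8 * s ^ 3 * y / r) * (x i * B (e i) ε)
      + (-(4 * s / r) - 4 * γ * s / r) * (x i * D (e i)))) →
      ∑ i, g i = f * (n * c0 + c1 * (r - 4 * y) + s ^ 2 * (∑ i, B (e i) (e i)) + (-4 * s ^ 2 / r) * B X X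
       + (-8 * s ^ 3 * y / r) * B ε X + (-(4 * s / r) - 4 * γ * s / r) * D X) := by
    intro g hg
    rw [Finset.sum_congr rfl fun i _ => hg i, ← Finset.mul_sum]
    simp only [Finset.sum_add_distrib, ← Finset.mul_sum, sS, sC, sE', sD]
    simp
  obtain ⟨A, hA⟩ : ∃ A, A = ∑ i, B (e i) (e i) := ⟨_, rfl⟩
  rw [← hA] at hsumm ⊢
  clear hv hh hv' hh'
  rw [hsumm _ (fun i => by rw [hc0, hc1, ← hf]; field_simp; ring)]
  have ha' : a = γ + 1 - n / 2 := by rw [hγ]; ring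
  rw [hc0, hc1, ← hf, ha']
  clear_value c0 c1 γ f s r D B e ε X
  field_simp
  ring

theorem rpow_sub_le {α b c : ℝ} (hα : 1 ≤ α) (hb : 0 ≤ b) (hc : 0 < c) :
    c ^ α - b ^ α ≤ α * c ^ (α - 1) * (c - b) := by
  have h := one_add_mul_self_le_rpow_one_add (s := b / c - 1) (by have : 0 ≤ b / c := by positivity
                                                                  linarith) hα
  have h1 : (1 + (b / c - 1)) ^ α = b ^ α / c ^ α := by
    rw [show 1 + (b / c - 1) = b / c by ring, Real.div_rpow hb hc.le]
  rw [h1, le_div_iff₀ (by positivity)] at h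
  have h2 : c ^ α = c ^ (α - 1) * c := by
    rw [← Real.rpow_add_one hc.ne']; congr 1; ring
  rw [h2] at h ⊢
  have h3 : (1 + α * (b / c - 1)) * (c ^ (α - 1) * c) = c ^ (α - 1) * c - α * c ^ (α - 1) * (c - b) := by
    field_simp; ring
  linarith

theorem rho_nonneg {n : ℕ} (x : Fin n → ℝ) {y : ℝ} (hy : 0 ≤ y) : 0 ≤ rho (x, y) := by
  have hsum : 0 ≤ ∑ i, x i ^ 2 := Finset.sum_nonneg fun i _ => sq_nonneg _
  simp only [rho_eq]; linarith

theorem rho_scale {n : ℕ} (s : ℝ) (x : Fin n → ℝ) (y : ℝ) : rho (s • x, s ^ 2 * y) = s ^ 2 * rho (x, y) := by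
  simp only [rho_eq, Pi.smul_apply, smul_eq_mul, mul_pow, ← Finset.mul_sum]; ring

section
variable {n : ℕ} {a α : ℝ} {u : (Fin n → ℝ) × ℝ → ℝ}

theorem gam_pos (n : ℕ) (ha : 1 < a) : 0 < ((n:ℝ) + 2 * a - 2) / 2 := by
  have : (0:ℝ) ≤ n := Nat.cast_nonneg n
  linarith

theorem alpha_gt (ha : 1 < a) (hα : α = (n + 2 * a + 2) / (n + 2 * a - 2)) : 1 < α := by
  have : (0:ℝ) ≤ n := Nat.cast_nonneg n
  rw [hα, lt_div_iff₀ (by linarith)]; linarith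

/-- auxiliary continuous function -/
noncomputable def Gk {n : ℕ} (a : ℝ) (u : (Fin n → ℝ) × ℝ → ℝ) (p : ℝ × ((Fin n → ℝ) × ℝ)) : ℝ :=
  |p.1| ^ ((n + 2 * a - 2) / 2) * u (p.1 • p.2.1, |p.1 ^ 2 * p.2.2|)

theorem continuous_Gk (ha : 1 < a) (hu : Sol a α u) : Continuous (Gk a u) := by
  unfold Gk
  refine Continuous.mul ?_ ?_
  · exact (continuous_fst.abs).rpow_const fun p => Or.inr (gam_pos n ha).le
  · refine hu.cont.comp_continuous (by fun_prop) fun p => ?_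
    show (0:ℝ) ≤ |p.1 ^ 2 * p.2.2|
    exact abs_nonneg _

theorem kel_eq_Gk {μ : ℝ} (hμ : 0 < μ) {x : Fin n → ℝ} {y : ℝ} (hy : 0 ≤ y) (hr : 0 < rho (x, y)) :
    kel a μ u (x, y) = rho (x, y) ^ (-(((n:ℝ) + 2 * a - 2) / 2)) *
      Gk a u (μ, ((rho (x, y))⁻¹ • x, (rho (x, y))⁻¹ ^ 2 * y)) := by
  unfold kel Gk
  simp only
  rw [Real.div_rpow hμ.le hr.le, Real.rpow_neg hr.le, abs_of_pos hμ, abs_of_nonneg (by positivity), smul_smul,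
    ← mul_assoc (μ ^ 2), ← mul_pow, div_eq_mul_inv, ← div_eq_mul_inv μ]
  ring

theorem kel_sphere {x : Fin n → ℝ} {y : ℝ} (hr : 0 < rho (x, y)) :
    kel a (rho (x, y)) u (x, y) = u (x, y) := by
  unfold kel; simp [div_self hr.ne']

theorem kel_cont (hu : Sol a α u) {μ : ℝ} (hμ : 0 < μ) :
    ContinuousOn (kel a μ u) {z | 0 ≤ z.2 ∧ 0 < rho z} := by
  unfold kel
  have h1 : ContinuousOn (fun z : (Fin n → ℝ) × ℝ => μ / rho z) {z | 0 ≤ z.2 ∧ 0 < rho z} :=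
    continuousOn_const.div continuous_rho.continuousOn fun z hz => hz.2.ne'
  refine ContinuousOn.mul ?_ ?_
  · exact h1.rpow_const fun z hz => Or.inl (div_pos hμ hz.2).ne'
  · refine hu.cont.comp ((h1.smul continuousOn_fst).prodMk ((h1.pow 2).mul continuousOn_snd)) ?_
    intro z hz
    exact mul_nonneg (sq_nonneg _) hz.1

theorem kel_le {μ S T : ℝ} (hμ : 0 < μ) (hS : ∀ x y, 0 ≤ y → rho (x, y) ≤ T → u (x, y) ≤ S)
    {x : Fin n → ℝ} {y : ℝ} (hy : 0 ≤ y) (hr : μ ≤ rho (x, y)) (hT : μ ≤ T) :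
    kel a μ u (x, y) ≤ (μ / rho (x, y)) ^ (((n:ℝ) + 2 * a - 2) / 2) * S := by
  have hr0 : 0 < rho (x, y) := hμ.trans_le hr
  unfold kel
  refine mul_le_mul_of_nonneg_left (hS _ _ (by positivity) ?_) (Real.rpow_nonneg (by positivity) _)
  rw [rho_scale]
  have : (μ / rho (x, y)) ^ 2 * rho (x, y) = μ * (μ / rho (x, y)) := by field_simp
  rw [this]
  have : μ / rho (x, y) ≤ 1 := by rw [div_le_one hr0]; exact hr
  nlinarith

theorem kel_le' (ha : 1 < a) {μ S T : ℝ} (hμ : 0 < μ) (hS0 : 0 ≤ S)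
    (hS : ∀ x y, 0 ≤ y → rho (x, y) ≤ T → u (x, y) ≤ S)
    {x : Fin n → ℝ} {y : ℝ} (hy : 0 ≤ y) (hr : μ ≤ rho (x, y)) (hT : μ ≤ T) :
    kel a μ u (x, y) ≤ S := by
  have hr0 : 0 < rho (x, y) := hμ.trans_le hr
  refine (kel_le hμ hS hy hr hT).trans ?_
  have : μ / rho (x, y) ≤ 1 := by rw [div_le_one hr0]; exact hr
  have := Real.rpow_le_one (by positivity) this (gam_pos n ha).le
  nlinarith

/-- One-sided bound for the difference. -/
theorem diff_hasL (ha : 1 < a) (hα : α = (n + 2 * a + 2) / (n + 2 * a - 2)) (hu : Sol a α u) {μ : ℝ} (hμ : 0 < μ)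
    {x : Fin n → ℝ} {y : ℝ} (hy : 0 < y) :
    HasL a (fun z => u z - kel a μ u z) x y (kel a μ u (x, y) ^ α - u (x, y) ^ α) := by
  have := (hu.hasL (x := x) hy).sub (kel_hasL ha hα hu hμ (x := x) hy)
  convert this using 1; ring

theorem exists_sup (hu : Sol a α u) (T : ℝ) :
    ∃ S, 0 < S ∧ ∀ x y, 0 ≤ y → rho (x, y) ≤ T → u (x, y) ≤ S := by
  obtain ⟨B, hB⟩ := ((isCompact_rho (n := n) T).image_of_continuousOn
    (hu.cont.mono fun z hz => hz.1)).isBounded.subset_closedBall 0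
  refine ⟨|B| + 1, by positivity, fun x y hy hr => ?_⟩
  have := hB (mem_image_of_mem u (show (x, y) ∈ {z | 0 ≤ z.2 ∧ rho z ≤ T} from ⟨hy, hr⟩))
  simp at this
  have h1 := le_abs_self (u (x, y))
  have h2 := le_abs_self B
  linarith

theorem narrow_step (ha : 1 < a) (hα : α = (n + 2 * a + 2) / (n + 2 * a - 2)) (hu : Sol a α u)
    (hpos : ∀ x y, 0 ≤ y → 0 < u (x, y))
    {μ R S T η : ℝ} (hμ : 0 < μ) (hη : 0 < η) (hS0 : 0 < S)
    (hS : ∀ x y, 0 ≤ y → rho (x, y) ≤ T → u (x, y) ≤ S) (hT : μ ≤ T)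
    (hRη : R - μ ≤ η) (hCη : α * S ^ (α - 1) * η ≤ n + 2 * a)
    (hR : ∀ x y, 0 ≤ y → R ≤ rho (x, y) → μ ≤ rho (x, y) → kel a μ u (x, y) ≤ u (x, y)) :
    ∀ x y, 0 ≤ y → μ ≤ rho (x, y) → kel a μ u (x, y) ≤ u (x, y) := by
  intro x y hy hr
  rcases le_total R (rho (x, y)) with h1 | h1
  · exact hR x y hy h1 hr
  have hα1 := alpha_gt ha hα
  have := narrow ha (μ := μ) (R := R) (C := α * S ^ (α - 1)) hη (by positivity) hRη hCη
    (fun z => u z - kel a μ u z) ?_ ?_ ?_ ?_ x y hy hr h1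
  · linarith
  · exact (hu.cont.mono fun z hz => hz.1).sub ((kel_cont hu hμ).mono fun z hz => ⟨hz.1, hμ.trans_le hz.2.1⟩)
  · intro x y hy hr
    have : 0 < rho (x, y) := by rw [hr]; exact hμ
    rw [← hr, kel_sphere this, sub_self]
  · intro x' y' hy' hr'
    have := hR x' y' hy' hr'.ge (by rw [hr']; exact hr.trans h1)
    linarith
  · intro x y hy h2 h3 h4
    refine ⟨_, ?_, diff_hasL ha hα hu hμ hy⟩
    have h5 := hpos x y hy.le
    have h6 : 0 < kel a μ u (x, y) := by linarith
    have h7 := rpow_sub_le hα1.le h5.le h6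
    refine h7.trans ?_
    rw [neg_sub]
    refine mul_le_mul_of_nonneg_right (mul_le_mul_of_nonneg_left ?_ (by linarith)) (by linarith)
    exact Real.rpow_le_rpow h6.le (kel_le' ha hμ hS0.le hS hy.le h2.le hT) (by linarith)

def Good (a : ℝ) (u : (Fin n → ℝ) × ℝ → ℝ) (μ : ℝ) : Prop :=
  ∀ x y, 0 ≤ y → μ ≤ rho (x, y) → kel a μ u (x, y) ≤ u (x, y)

theorem exists_inf {w : (Fin n → ℝ) × ℝ → ℝ} (R : ℝ) (hw : ContinuousOn w {z | 0 ≤ z.2 ∧ rho z = R})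
    (hpos : ∀ x y, 0 ≤ y → rho (x, y) = R → 0 < w (x, y)) :
    ∃ m, 0 < m ∧ ∀ x y, 0 ≤ y → rho (x, y) = R → m ≤ w (x, y) := by
  have hK : IsCompact {z : (Fin n → ℝ) × ℝ | 0 ≤ z.2 ∧ rho z = R} := by
    refine (isCompact_rho R).of_isClosed_subset ?_ fun z hz => ⟨hz.1, hz.2.le⟩
    exact (isClosed_le continuous_const continuous_snd).inter (isClosed_eq continuous_rho continuous_const)
  rcases eq_empty_or_nonempty {z : (Fin n → ℝ) × ℝ | 0 ≤ z.2 ∧ rho z = R} with he | hne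
  · refine ⟨1, one_pos, fun x y hy hr => ?_⟩
    have : (x, y) ∈ ({z : (Fin n → ℝ) × ℝ | 0 ≤ z.2 ∧ rho z = R}) := ⟨hy, hr⟩
    rw [he] at this; exact this.elim
  · obtain ⟨z, hz, hmin⟩ := hK.exists_isMinOn hne hw
    exact ⟨w z, hpos z.1 z.2 hz.1 hz.2, fun x y hy hr => hmin (show (x, y) ∈ _ from ⟨hy, hr⟩)⟩

theorem exists_eta (ha : 1 < a) {C : ℝ} (hC : 0 < C) : ∃ η, 0 < η ∧ η ≤ 1 ∧ C * η ≤ n + 2 * a := by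
  have : (0:ℝ) ≤ n := Nat.cast_nonneg n
  refine ⟨min 1 ((n + 2 * a) / C), ?_, min_le_left _ _, ?_⟩
  · have : 0 < (n + 2 * a) / C := by apply div_pos <;> linarith
    positivity
  · have := mul_le_mul_of_nonneg_left (min_le_right 1 ((n + 2 * a) / C)) hC.le
    rwa [mul_div_cancel₀ _ hC.ne'] at this

theorem hasL_nonpos (hα : 1 < α) (hu : Sol a α u) {x : Fin n → ℝ} {y : ℝ} (hy : 0 < y) :
    ∃ l ≤ 0, HasL a u x y l :=
  ⟨_, neg_nonpos.2 (Real.rpow_nonneg (hu.nonneg x y hy.le) _), hu.hasL hy⟩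

theorem good_small (ha : 1 < a) (hα : α = (n + 2 * a + 2) / (n + 2 * a - 2)) (hu : Sol a α u)
    (hpos : ∀ x y, 0 ≤ y → 0 < u (x, y)) : ∃ μ0 > 0, ∀ μ, 0 < μ → μ ≤ μ0 → Good a u μ := by
  have hα1 := alpha_gt ha hα
  have hγ := gam_pos n ha
  set γ := ((n:ℝ) + 2 * a - 2) / 2 with hγdef
  obtain ⟨S, hS0, hS⟩ := exists_sup hu 1
  obtain ⟨η, hη0, hη1, hη⟩ := exists_eta (n := n) ha (C := α * S ^ (α - 1)) (by positivity)
  obtain ⟨m, hm, hm'⟩ := exists_inf η (hu.cont.mono fun z hz => hz.1) fun x y hy _ => hpos x y hy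
  have far := far_lower ha hη0 hm u (hu.cont.mono fun z hz => hz.1) (fun x y hy _ => (hpos x y hy).le) hm'
    (fun x y hy _ => hasL_nonpos hα1 hu hy)
  rw [← hγdef] at far
  have hmS : 0 < m / S := by positivity
  refine ⟨min 1 (η * (m / S) ^ (1 / γ)), by positivity, ?_⟩
  intro μ hμ hle
  have hμ1 := hle.trans (min_le_left _ _)
  have hμ2 := hle.trans (min_le_right _ _)
  refine narrow_step ha hα hu hpos hμ hη0 hS0 hS hμ1 (R := η) (by linarith) hη ?_
  intro x y hy h1 h2
  have h0 : 0 < rho (x, y) := hη0.trans_le h1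
  refine (kel_le hμ hS hy h2 hμ1).trans (le_trans ?_ (far x y hy h1))
  rw [← hγdef, Real.div_rpow hμ.le h0.le, Real.rpow_neg h0.le, div_eq_mul_inv, mul_right_comm]
  refine mul_le_mul_of_nonneg_right ?_ (by positivity)
  have h3 : μ ^ γ ≤ η ^ γ * (m / S) := by
    have := Real.rpow_le_rpow hμ.le hμ2 hγ.le
    rwa [Real.mul_rpow hη0.le (by positivity), ← Real.rpow_mul hmS.le, one_div_mul_cancel hγ.ne', Real.rpow_one] at this
  calc μ ^ γ * S ≤ η ^ γ * (m / S) * S := mul_le_mul_of_nonneg_right h3 hS0.le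
    _ = m * η ^ γ := by field_simp

theorem kel_tendsto (ha : 1 < a) (hu : Sol a α u) {μ : ℝ} (hμ : 0 < μ) {x : Fin n → ℝ} {y : ℝ} (hy : 0 ≤ y)
    (hr : 0 < rho (x, y)) : Tendsto (fun ν => kel a ν u (x, y)) (𝓝 μ) (𝓝 (kel a μ u (x, y))) := by
  rw [kel_eq_Gk hμ hy hr]
  have hc : Continuous (fun ν : ℝ => rho (x, y) ^ (-(((n:ℝ) + 2 * a - 2) / 2)) *
      Gk a u (ν, ((rho (x, y))⁻¹ • x, (rho (x, y))⁻¹ ^ 2 * y))) :=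
    continuous_const.mul ((continuous_Gk ha hu).comp (by fun_prop))
  refine (hc.tendsto μ).congr' ?_
  filter_upwards [lt_mem_nhds hμ] with ν hν
  rw [kel_eq_Gk hν hy hr]

theorem good_closed (ha : 1 < a) (hu : Sol a α u) {μ : ℝ} (hμ : 0 < μ)
    (h : ∀ ν, 0 < ν → ν < μ → Good a u ν) : Good a u μ := by
  intro x y hy hr
  have := (kel_tendsto ha hu hμ hy (hμ.trans_le hr)).mono_left (nhdsWithin_le_nhds (s := Iio μ))
  refine le_of_tendsto this ?_
  filter_upwards [self_mem_nhdsWithin, nhdsWithin_le_nhds (lt_mem_nhds hμ)] with ν h1 h2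
  have h1' : ν < μ := h1
  exact h ν h2 h1 x y hy (h1'.le.trans hr)

theorem good_open (ha : 1 < a) (hα : α = (n + 2 * a + 2) / (n + 2 * a - 2)) (hu : Sol a α u)
    (hpos : ∀ x y, 0 ≤ y → 0 < u (x, y)) {μ : ℝ} (hμ : 0 < μ) (hg : Good a u μ)
    {x0 : Fin n → ℝ} {y0 : ℝ} (hy0 : 0 ≤ y0) (hr0 : μ < rho (x0, y0))
    (hlt : kel a μ u (x0, y0) < u (x0, y0)) : ∀ᶠ ν in 𝓝[>] μ, Good a u ν := by
  have hα1 := alpha_gt ha hα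
  have hγ := gam_pos n ha
  set γ := ((n:ℝ) + 2 * a - 2) / 2 with hγdef
  obtain ⟨S, hS0, hS⟩ := exists_sup hu (μ + 1)
  obtain ⟨η, hη0, hη1, hη⟩ := exists_eta (n := n) ha (C := α * S ^ (α - 1)) (by positivity)
  have hwc : ContinuousOn (fun z => u z - kel a μ u z) {z | 0 ≤ z.2 ∧ 0 < rho z} :=
    (hu.cont.mono fun z hz => hz.1).sub (kel_cont hu hμ)
  have kpos : ∀ x y, 0 ≤ y → μ ≤ rho (x, y) → 0 ≤ kel a μ u (x, y) := by
    intro x y hy hr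
    have : 0 < rho (x, y) := hμ.trans_le hr
    unfold kel
    exact mul_nonneg (Real.rpow_nonneg (by positivity) _) (hu.nonneg _ _ (by positivity))
  have hsup : ∀ x y, 0 < y → μ < rho (x, y) → ∃ l ≤ 0, HasL a (fun z => u z - kel a μ u z) x y l := by
    intro x y hy hr
    refine ⟨_, ?_, diff_hasL ha hα hu hμ hy⟩
    exact sub_nonpos.2 (Real.rpow_le_rpow (kpos x y hy.le hr.le) (hg x y hy.le hr.le) (by linarith))
  have hstrict := smp ha (μ := μ) (fun z => u z - kel a μ u z) (hwc.mono fun z hz => ⟨hz.1, hμ.trans hz.2⟩)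
    (fun x y hy hr => sub_nonneg.2 (hg x y hy hr.le)) hsup hy0 hr0 (sub_pos.2 hlt)
  set R := μ + η with hR
  have hR0 : 0 < R := by positivity
  have hμR : μ < R := by linarith
  obtain ⟨m, hm, hm'⟩ := exists_inf R (w := fun z => u z - kel a μ u z)
    (hwc.mono fun z hz => ⟨hz.1, by rw [hz.2]; exact hR0⟩)
    fun x y hy hr => hstrict x y hy (by linarith)
  have far := far_lower ha hR0 hm (fun z => u z - kel a μ u z)
    (hwc.mono fun z hz => ⟨hz.1, hR0.trans_le hz.2⟩) (fun x y hy hr => (hstrict x y hy (by linarith)).le) hm'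
    (fun x y hy hr => hsup x y hy (by linarith))
  rw [← hγdef] at far
  set c := m * R ^ γ with hc
  have hc0 : 0 < c := mul_pos hm (Real.rpow_pos_of_pos hR0 _)
  have hunif : ∀ᶠ ν in 𝓝 μ, ∀ z ∈ {z : (Fin n → ℝ) × ℝ | 0 ≤ z.2 ∧ rho z ≤ R⁻¹},
      Gk a u (ν, z) < Gk a u (μ, z) + c := by
    refine (isCompact_rho R⁻¹).eventually_forall_of_forall_eventually
      (P := fun ν z => Gk a u (ν, z) < Gk a u (μ, z) + c) ?_
    intro z _
    have h1 : Continuous (fun p : ℝ × ((Fin n → ℝ) × ℝ) => Gk a u (p.1, p.2)) := continuous_Gk ha hu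
    have h2 : Continuous (fun p : ℝ × ((Fin n → ℝ) × ℝ) => Gk a u (μ, p.2) + c) :=
      ((continuous_Gk ha hu).comp (by fun_prop)).add continuous_const
    exact (h1.continuousAt).eventually_lt h2.continuousAt (by simp only; linarith)
  filter_upwards [nhdsWithin_le_nhds hunif, Ioo_mem_nhdsGT hμR] with ν h1 h2
  have hν : 0 < ν := hμ.trans h2.1
  refine narrow_step ha hα hu hpos hν hη0 hS0 hS (by linarith [h2.2]) (R := R) (by linarith [h2.1]) hη ?_
  intro x y hy h3 h4
  have h0 : 0 < rho (x, y) := hR0.trans_le h3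
  have h5 := far x y hy h3
  have hz : (((rho (x, y))⁻¹ • x, (rho (x, y))⁻¹ ^ 2 * y) : (Fin n → ℝ) × ℝ) ∈ {z : (Fin n → ℝ) × ℝ | 0 ≤ z.2 ∧ rho z ≤ R⁻¹} := by
    refine ⟨by positivity, ?_⟩
    rw [rho_scale]
    have : (rho (x, y))⁻¹ ^ 2 * rho (x, y) = (rho (x, y))⁻¹ := by field_simp
    rw [this]
    exact inv_anti₀ hR0 h3
  have h6 := h1 _ hz
  rw [kel_eq_Gk hμ hy h0, ← hγdef] at h5
  rw [kel_eq_Gk hν hy h0, ← hγdef]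
  have h7 : 0 < rho (x, y) ^ (-γ) := Real.rpow_pos_of_pos h0 _
  have h8 := mul_lt_mul_of_pos_left h6 h7
  linarith

theorem kel_inv (hu : Sol a α u) {μ : ℝ} (hμ : 0 < μ)
    (h : ∀ x y, 0 ≤ y → μ < rho (x, y) → kel a μ u (x, y) = u (x, y)) :
    ∀ x y, 0 ≤ y → 0 < rho (x, y) → kel a μ u (x, y) = u (x, y) := by
  intro x y hy hr
  rcases lt_trichotomy μ (rho (x, y)) with h1 | h1 | h1
  · exact h x y hy h1
  · rw [h1]; exact kel_sphere hr
  · set r := rho (x, y) with hrd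
    set s := μ / r with hs
    have hs0 : 0 < s := by positivity
    have hrs : rho (s • x, s ^ 2 * y) = μ * s := by rw [rho_scale, ← hrd, hs]; field_simp
    have hs1 : 1 < s := by rw [hs, one_lt_div hr]; exact h1
    have h2 := h (s • x) (s ^ 2 * y) (by positivity) (by rw [hrs]; nlinarith)
    unfold kel at h2 ⊢
    simp only [hrs, ← hrd, ← hs] at h2 ⊢
    rw [← h2]
    have e1 : μ / (μ * s) = s⁻¹ := by field_simp
    rw [e1, ← mul_assoc, ← Real.mul_rpow hs0.le (by positivity), mul_inv_cancel₀ hs0.ne', Real.one_rpow, one_mul,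
      smul_smul, inv_mul_cancel₀ hs0.ne', one_smul, ← mul_assoc, ← mul_pow, inv_mul_cancel₀ hs0.ne', one_pow, one_mul]

theorem moving_spheres (ha : 1 < a) (hα : α = (n + 2 * a + 2) / (n + 2 * a - 2)) (hu : Sol a α u)
    (hpos : ∀ x y, 0 ≤ y → 0 < u (x, y)) :
    (∀ μ, 0 < μ → Good a u μ) ∨
      ∃ μ, 0 < μ ∧ ∀ x y, 0 ≤ y → 0 < rho (x, y) → kel a μ u (x, y) = u (x, y) := by
  by_contra hcon
  push Not at hcon
  obtain ⟨⟨μ1, hμ1, hbad⟩, hne⟩ := hcon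
  obtain ⟨μ0, hμ0, hsm⟩ := good_small ha hα hu hpos
  set A := {μ : ℝ | 0 < μ ∧ ∀ ν, 0 < ν → ν ≤ μ → Good a u ν} with hA
  have hA0 : μ0 ∈ A := ⟨hμ0, hsm⟩
  have hAb : BddAbove A := ⟨μ1, fun μ hμ => by
    by_contra hc
    exact hbad (hμ.2 μ1 hμ1 (not_le.1 hc).le)⟩
  set μ := sSup A with hμdef
  have hμ : 0 < μ := hμ0.trans_le (le_csSup hAb hA0)
  have hlt : ∀ ν, 0 < ν → ν < μ → Good a u ν := by
    intro ν h1 h2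
    obtain ⟨ξ, hξ, h3⟩ := exists_lt_of_lt_csSup ⟨μ0, hA0⟩ h2
    exact hξ.2 ν h1 h3.le
  have hg : Good a u μ := good_closed ha hu hμ hlt
  obtain ⟨x, y, hy, hr, hxy⟩ := hne μ hμ
  have : ∃ x y, 0 ≤ y ∧ μ < rho (x, y) ∧ kel a μ u (x, y) ≠ u (x, y) := by
    by_contra hc
    push Not at hc
    exact hxy (kel_inv hu hμ hc x y hy hr)
  obtain ⟨x0, y0, h1, h2, h3⟩ := this
  have ev := good_open ha hα hu hpos hμ hg h1 h2 (lt_of_le_of_ne (hg x0 y0 h1 h2.le) h3)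
  obtain ⟨ξ, hξ1, hξ⟩ := mem_nhdsGT_iff_exists_Ioo_subset.1 ev
  have hξ1' : μ < ξ := hξ1
  have : (μ + ξ) / 2 ∈ A := by
    refine ⟨by linarith, fun ν h1 h2 => ?_⟩
    rcases lt_trichotomy ν μ with h | h | h
    · exact hlt ν h1 h
    · rw [h]; exact hg
    · exact hξ ⟨h, by linarith⟩
  have := le_csSup hAb this
  linarith
end

theorem ode_contra_log {γ m β : ℝ} (hγ : 0 < γ) (hm : 0 ≤ m) {P s : ℝ → ℝ}
    (hP : ∀ τ, HasDerivAt P (-(P τ) ^ 2 + m * P τ + β - s τ) τ)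
    (hs : ∀ τ, HasDerivAt s (2 / γ * s τ * P τ) τ) (s0 : ∀ τ, 0 < s τ) (P0 : ∀ τ, 0 ≤ P τ)
    (hE : Tendsto (fun τ => s τ ^ γ * ((P τ) ^ 2 - β + s τ * (γ / (γ + 1)))) atBot (𝓝 0)) : False := by
  have hEd : ∀ τ, HasDerivAt (fun τ => s τ ^ γ * ((P τ) ^ 2 - β + s τ * (γ / (γ + 1))))
      (2 * m * (P τ) ^ 2 * s τ ^ γ) τ := by
    intro τ
    have h1 := (hs τ).rpow_const (p := γ) (Or.inl (s0 τ).ne')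
    have h2 := (((hP τ).pow 2).sub_const β).add ((hs τ).mul_const (γ / (γ + 1)))
    refine (h1.mul h2).congr_deriv ?_
    have h3 : s τ ^ (γ - 1) = s τ ^ γ / s τ := Real.rpow_sub_one (s0 τ).ne' γ
    have := (s0 τ).ne'
    simp only [Pi.pow_apply, Pi.add_apply, h3]
    have hγ1 : γ + 1 ≠ 0 := by linarith
    field_simp
    push_cast
    ring
  have hmono : Monotone (fun τ => s τ ^ γ * ((P τ) ^ 2 - β + s τ * (γ / (γ + 1)))) := by
    refine monotone_of_deriv_nonneg (fun τ => (hEd τ).differentiableAt) fun τ => ?_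
    rw [(hEd τ).deriv]
    have := Real.rpow_nonneg (s0 τ).le γ
    positivity
  have hE0 : ∀ τ, 0 ≤ (P τ) ^ 2 - β + s τ * (γ / (γ + 1)) := by
    intro τ
    have h1 := hmono.le_of_tendsto hE τ
    exact nonneg_of_mul_nonneg_right h1 (Real.rpow_pos_of_pos (s0 τ) γ)
  have smono : Monotone s := by
    refine monotone_of_deriv_nonneg (fun τ => (hs τ).differentiableAt) fun τ => ?_
    rw [(hs τ).deriv]
    have := s0 τ
    have := P0 τ
    positivity
  set κ := 1 / (γ + 1) with hκ
  have hκ0 : 0 < κ := by positivity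
  have hk2 : γ / (γ + 1) = 1 - κ := by rw [hκ]; field_simp; ring
  -- first
  have hΨ : ∀ τ, 0 ≤ τ → P τ - (m * γ / 2) * Real.log (s τ) + κ * s 0 * τ ≤ P 0 - (m * γ / 2) * Real.log (s 0) := by
    have hd : ∀ τ, HasDerivAt (fun τ => P τ - (m * γ / 2) * Real.log (s τ) + κ * s 0 * τ)
        (-(P τ) ^ 2 + m * P τ + β - s τ - m * P τ + κ * s 0) τ := by
      intro τ
      have h1 := (((hP τ).sub (((hs τ).log (s0 τ).ne').const_mul (m * γ / 2)))).add
        ((hasDerivAt_id τ).const_mul (κ * s 0))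
      refine h1.congr_deriv ?_
      have := (s0 τ).ne'
      field_simp
    intro τ hτ
    have hanti : AntitoneOn (fun τ => P τ - (m * γ / 2) * Real.log (s τ) + κ * s 0 * τ) (Ici 0) := by
      refine antitoneOn_of_deriv_nonpos (convex_Ici 0) (fun t _ => (hd t).continuousAt.continuousWithinAt)
        (fun t _ => (hd t).differentiableAt.differentiableWithinAt) fun t ht => ?_
      rw [(hd t).deriv]
      rw [interior_Ici] at ht
      have h1 := hE0 t
      rw [hk2] at h1
      have h2 : s 0 ≤ s t := smono (le_of_lt ht)
      nlinarith
    have := hanti (mem_Ici.2 le_rfl) (mem_Ici.2 hτ) hτ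
    simpa using this
  -- get large s
  obtain ⟨τ1, h1⟩ : ∃ τ1, ∀ τ, τ1 ≤ τ → m ^ 2 / 4 + β + 1 ≤ s τ := by
    by_contra hcon
    push Not at hcon
    set C := m ^ 2 / 4 + β + 1 with hC
    have hb : ∀ τ, s τ ≤ C := by
      intro τ
      obtain ⟨t, ht, ht2⟩ := hcon τ
      exact (smono ht).trans ht2.le
    have hC0 : 0 < C := (s0 0).trans_le (hb 0)
    obtain ⟨τ, hτ⟩ : ∃ τ, 0 ≤ τ ∧ (P 0 - (m * γ / 2) * Real.log (s 0) + (m * γ / 2) * Real.log C) < κ * s 0 * τ := by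
      have hx : 0 < κ * s 0 := mul_pos hκ0 (s0 0)
      refine ⟨max 0 ((P 0 - (m * γ / 2) * Real.log (s 0) + (m * γ / 2) * Real.log C + 1) / (κ * s 0)), le_max_left _ _, ?_⟩
      have := le_max_right 0 ((P 0 - (m * γ / 2) * Real.log (s 0) + (m * γ / 2) * Real.log C + 1) / (κ * s 0))
      rw [div_le_iff₀ hx] at this
      linarith
    have h3 := hΨ τ hτ.1
    have h4 : Real.log (s τ) ≤ Real.log C := Real.log_le_log (s0 τ) (hb τ)
    have h5 := mul_le_mul_of_nonneg_left h4 (show 0 ≤ m * γ / 2 by positivity)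
    have := P0 τ
    linarith [hτ.2]
  have hd : ∀ τ, HasDerivAt (fun τ => P τ + τ) (-(P τ) ^ 2 + m * P τ + β - s τ + 1) τ := fun τ =>
    (hP τ).add (hasDerivAt_id τ)
  have hanti : AntitoneOn (fun τ => P τ + τ) (Ici τ1) := by
    refine antitoneOn_of_deriv_nonpos (convex_Ici _) (fun t _ => (hd t).continuousAt.continuousWithinAt)
      (fun t _ => (hd t).differentiableAt.differentiableWithinAt) fun t ht => ?_
    rw [(hd t).deriv]
    rw [interior_Ici] at ht
    have h3 := h1 t (le_of_lt ht)
    nlinarith [sq_nonneg (P t - m / 2)]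
  have h3 := hanti (mem_Ici.2 le_rfl) (mem_Ici.2 (by linarith [P0 τ1] : τ1 ≤ τ1 + P τ1 + 1)) (by linarith [P0 τ1])
  simp only at h3
  linarith [P0 (τ1 + P τ1 + 1)]

theorem ode_contra {γ m a α : ℝ} (hγ : 0 < γ) (hm : 0 ≤ m) (ha : a = γ + 1 - m) (hα : γ * (α - 1) = 2)
    {f f' f'' : ℝ → ℝ} (f0 : ∀ y, 0 < y → 0 < f y)
    (h1 : ∀ y, 0 < y → HasDerivAt f (f' y) y) (h2 : ∀ y, 0 < y → HasDerivAt f' (f'' y) y)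
    (heq : ∀ y, 0 < y → y * f'' y + a * f' y + f y ^ α = 0)
    (hP : ∀ y, 0 < y → 0 ≤ γ / 2 + y * f' y / f y)
    {c c' : ℝ} (hf0 : Tendsto f (𝓝[>] 0) (𝓝 c)) (hf1 : Tendsto f' (𝓝[>] 0) (𝓝 c')) : False := by
  have hα1 : 0 < α - 1 := by
    by_contra h
    push Not at h
    nlinarith
  refine ode_contra_log (γ := γ) (m := m) (β := γ ^ 2 / 4 - γ * m / 2) hγ hm
    (P := fun τ => γ / 2 + Real.exp τ * f' (Real.exp τ) / f (Real.exp τ))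
    (s := fun τ => Real.exp τ * f (Real.exp τ) ^ (α - 1)) ?_ ?_ ?_ ?_ ?_
  · intro τ
    have e := Real.exp_pos τ
    set y := Real.exp τ with hy
    have d0 : HasDerivAt Real.exp y τ := Real.hasDerivAt_exp τ
    have d1 : HasDerivAt (fun τ => f (Real.exp τ)) (f' y * y) τ := (h1 y e).comp τ d0
    have d2 : HasDerivAt (fun τ => f' (Real.exp τ)) (f'' y * y) τ := (h2 y e).comp τ d0
    have d3 := ((d0.mul d2).div d1 (f0 y e).ne').const_add (γ / 2)
    refine d3.congr_deriv ?_
    simp only [Pi.mul_apply]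
    rw [← hy]
    have h3 : f y ^ α = f y ^ (α - 1) * f y := by
      rw [← Real.rpow_add_one (f0 y e).ne']; congr 1; ring
    have h4 : y * f'' y = - a * f' y - f y ^ (α - 1) * f y := by rw [← h3]; linarith [heq y e]
    have h5 := (f0 y e).ne'
    have : y * f' y + y * (f'' y * y) = y * f' y + y * (- a * f' y - f y ^ (α - 1) * f y) := by rw [← h4]; ring
    rw [this, ha]
    field_simp
    ring
  · intro τ
    have e := Real.exp_pos τ
    set y := Real.exp τ with hy
    have d0 : HasDerivAt Real.exp y τ := Real.hasDerivAt_exp τ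
    have d1 : HasDerivAt (fun τ => f (Real.exp τ)) (f' y * y) τ := (h1 y e).comp τ d0
    have d3 := d0.mul (d1.rpow_const (p := α - 1) (Or.inl (f0 y e).ne'))
    refine d3.congr_deriv ?_
    have h5 := (f0 y e).ne'
    rw [← hy, Real.rpow_sub_one h5 (α - 1)]
    have : α - 1 = 2 / γ := by field_simp; linarith
    generalize f y ^ (α - 1) = F
    rw [this]
    field_simp
  · intro τ
    have e := Real.exp_pos τ
    exact mul_pos e (Real.rpow_pos_of_pos (f0 _ e) _)
  · intro τ
    exact hP _ (Real.exp_pos τ)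
  · have key : ∀ τ, (fun y => y ^ γ * ((γ / 2 * f y + y * f' y) ^ 2 - (γ ^ 2 / 4 - γ * m / 2) * f y ^ 2
        + y * (f y ^ (α - 1) * f y ^ 2) * (γ / (γ + 1)))) (Real.exp τ) = 
        (Real.exp τ * f (Real.exp τ) ^ (α - 1)) ^ γ * ((γ / 2 + Real.exp τ * f' (Real.exp τ) / f (Real.exp τ)) ^ 2 -
          (γ ^ 2 / 4 - γ * m / 2) + Real.exp τ * f (Real.exp τ) ^ (α - 1) * (γ / (γ + 1))) := by
      intro τ
      have e := Real.exp_pos τ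
      set y := Real.exp τ with hy
      simp only []
      rw [Real.mul_rpow e.le (Real.rpow_nonneg (f0 y e).le _), ← Real.rpow_mul (f0 y e).le, mul_comm (α - 1), hα]
      have h5 := (f0 y e).ne'
      have h6 : f y ^ (2:ℝ) = f y ^ 2 := by exact_mod_cast Real.rpow_natCast (f y) 2
      rw [h6]
      field_simp
    refine Tendsto.congr key ?_
    have hexp : Tendsto Real.exp atBot (𝓝[>] 0) := Real.tendsto_exp_atBot_nhdsGT
    refine Tendsto.comp (g := fun y => y ^ γ * ((γ / 2 * f y + y * f' y) ^ 2 - (γ ^ 2 / 4 - γ * m / 2) * f y ^ 2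
        + y * (f y ^ (α - 1) * f y ^ 2) * (γ / (γ + 1)))) ?_ hexp
    have hid : Tendsto (fun y : ℝ => y) (𝓝[>] 0) (𝓝 0) := tendsto_nhdsWithin_of_tendsto_nhds tendsto_id
    have hp : Tendsto (fun y : ℝ => y ^ γ) (𝓝[>] 0) (𝓝 (0 ^ γ)) := hid.rpow_const (Or.inr hγ.le)
    rw [Real.zero_rpow hγ.ne'] at hp
    have hfa := hf0.rpow_const (p := α - 1) (Or.inr hα1.le)
    have := hp.mul (((((hf0.const_mul (γ/2)).add (hid.mul hf1)).pow 2).sub ((hf0.pow 2).const_mul (γ ^ 2 / 4 - γ * m / 2))).add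
      ((hid.mul (hfa.mul (hf0.pow 2))).mul_const (γ / (γ + 1))))
    rw [zero_mul] at this
    exact this

theorem HasD2.hasDerivAt_deriv {g : ℝ → ℝ} {t p q : ℝ} (h : HasD2 g t p q) : HasDerivAt (deriv g) q t := by
  obtain ⟨g', h1, h2, h3⟩ := h
  refine h3.congr_of_eventuallyEq ?_
  filter_upwards [h1] with s hs using hs.deriv

theorem deriv_nonneg_of_right_min {g : ℝ → ℝ} {t d : ℝ} (h : HasDerivAt g d t) (hm : ∀ s, t < s → g t ≤ g s) :
    0 ≤ d := by
  have h1 := (hasDerivWithinAt_iff_tendsto_slope' (s := Ioi t) (by simp)).1 (h.hasDerivWithinAt (s := Ioi t))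
  refine ge_of_tendsto h1 ?_
  filter_upwards [self_mem_nhdsWithin] with s hs
  rw [slope_def_field]
  exact div_nonneg (sub_nonneg.2 (hm s hs)) (sub_nonneg.2 (le_of_lt hs))

section
variable {n : ℕ} {a α : ℝ} {u : (Fin n → ℝ) × ℝ → ℝ}

/-- translate -/
def tr (c : Fin n → ℝ) (u : (Fin n → ℝ) × ℝ → ℝ) : (Fin n → ℝ) × ℝ → ℝ := fun z => u (z + (c, 0))

theorem tr_apply (c x : Fin n → ℝ) (y : ℝ) : tr c u (x, y) = u (x + c, y) := by simp [tr]

theorem tr_tr (c d : Fin n → ℝ) : tr d (tr c u) = tr (d + c) u := by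
  ext ⟨x, y⟩
  rw [tr_apply, tr_apply, tr_apply, add_assoc]

theorem good_scale (ha : 1 < a) (hpos : ∀ x y, 0 ≤ y → 0 < u (x, y)) (hg : ∀ μ, 0 < μ → Good a u μ)
    (x : Fin n → ℝ) {y m : ℝ} (hy : 0 ≤ y) (hm : 1 ≤ m) :
    u (x, y) ≤ m ^ (((n:ℝ) + 2 * a - 2) / 2) * u (m • x, m ^ 2 * y) := by
  have hγ := gam_pos n ha
  set γ := ((n:ℝ) + 2 * a - 2) / 2 with hγdef
  have hm0 : 0 < m := by linarith
  rcases (rho_nonneg x hy).eq_or_lt with h0 | h0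
  · have hs : 0 ≤ ∑ i, x i ^ 2 := Finset.sum_nonneg fun i _ => sq_nonneg _
    have hy0 : y = 0 := by simp only [rho_eq] at h0; linarith
    have hx0 : x = 0 := by
      have h1 : ∑ i, x i ^ 2 = 0 := by simp only [rho_eq] at h0; linarith
      rw [Finset.sum_eq_zero_iff_of_nonneg (fun i _ => sq_nonneg _)] at h1
      ext i
      simpa using h1 i (Finset.mem_univ i)
    subst hy0 hx0
    simp only [smul_zero, mul_zero]
    have h1 : 1 ≤ m ^ γ := Real.one_le_rpow hm hγ.le
    have := hpos (0 : Fin n → ℝ) 0 le_rfl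
    nlinarith
  · have hr : rho (m • x, m ^ 2 * y) = m ^ 2 * rho (x, y) := rho_scale m x y
    have hμ : 0 < m * rho (x, y) := by positivity
    have h1 := hg _ hμ (m • x) (m ^ 2 * y) (by positivity) (by rw [hr]; nlinarith [mul_nonneg (mul_nonneg hm0.le (sub_nonneg.2 hm)) h0.le])
    unfold kel at h1
    have h2 : m * rho (x, y) / (m ^ 2 * rho (x, y)) = m⁻¹ := by field_simp
    simp only [hr, h2, ← hγdef] at h1
    rw [smul_smul, inv_mul_cancel₀ hm0.ne', one_smul, ← mul_assoc, ← mul_pow, inv_mul_cancel₀ hm0.ne', one_pow,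
      one_mul, Real.inv_rpow hm0.le, inv_mul_le_iff₀ (by positivity)] at h1
    exact h1

theorem good_indep (ha : 1 < a) (hu : Sol a α u) (hpos : ∀ x y, 0 ≤ y → 0 < u (x, y))
    (hg : ∀ c, ∀ μ, 0 < μ → Good a (tr c u) μ) (x v : Fin n → ℝ) {y : ℝ} (hy : 0 ≤ y) :
    u (x, y) ≤ u (x + v, y) := by
  have hγ := gam_pos n ha
  set γ := ((n:ℝ) + 2 * a - 2) / 2 with hγdef
  have key : ∀ m : ℝ, 1 < m → u (x, y) ≤ m ^ γ * u (x + v, m ^ 2 * y) := by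
    intro m hm
    have hm1 : m - 1 ≠ 0 := by linarith
    have := good_scale (u := tr (x - (m - 1)⁻¹ • v) u) ha (fun x y hy => by rw [tr_apply]; exact hpos _ _ hy)
      (hg _) (x - (x - (m - 1)⁻¹ • v)) hy hm.le
    rw [tr_apply, tr_apply, ← hγdef] at this
    have e1 : x - (x - (m - 1)⁻¹ • v) + (x - (m - 1)⁻¹ • v) = x := by abel
    have e2 : m • (x - (x - (m - 1)⁻¹ • v)) + (x - (m - 1)⁻¹ • v) = x + v := by
      ext i; simp; field_simp; ring
    rwa [e1, e2] at this
  have hc : ContinuousWithinAt (fun m : ℝ => m ^ γ * u (x + v, m ^ 2 * y)) (Ioi 1) 1 := by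
    refine ContinuousWithinAt.mul ?_ ?_
    · exact (Real.continuousAt_rpow_const 1 γ (Or.inl one_ne_zero)).continuousWithinAt
    · have h1 : Continuous (fun m : ℝ => u (x + v, m ^ 2 * y)) := by
        refine hu.cont.comp_continuous (by fun_prop) fun m => ?_
        show (0:ℝ) ≤ m ^ 2 * y
        positivity
      exact h1.continuousWithinAt
  have := ge_of_tendsto hc.tendsto (by filter_upwards [self_mem_nhdsWithin] with m hm using key m hm)
  simpa using this

theorem Sol.line_smooth (hu : Sol a α u) (x : Fin n → ℝ) : ContDiffOn ℝ 2 (fun y => u (x, y)) (Ici 0) := by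
  refine hu.reg.comp (by fun_prop) ?_
  intro y hy
  exact hy

theorem Sol.line_deriv_tendsto (hu : Sol a α u) (x : Fin n → ℝ) :
    ∃ c', Tendsto (deriv fun y => u (x, y)) (𝓝[>] 0) (𝓝 c') := by
  have h1 := (hu.line_smooth x).continuousOn_derivWithin (uniqueDiffOn_Ici 0) (by norm_num)
  refine ⟨_, ((h1 0 self_mem_Ici).mono Ioi_subset_Ici_self).tendsto.congr' ?_⟩
  filter_upwards [self_mem_nhdsWithin] with y hy
  exact derivWithin_of_mem_nhds (Ici_mem_nhds hy)

theorem case_B (ha : 1 < a) (hα : α = (n + 2 * a + 2) / (n + 2 * a - 2)) (hu : Sol a α u)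
    (hpos : ∀ x y, 0 ≤ y → 0 < u (x, y)) (hg : ∀ c, ∀ μ, 0 < μ → Good a (tr c u) μ) : False := by
  have hγ := gam_pos n ha
  set γ := ((n:ℝ) + 2 * a - 2) / 2 with hγdef
  have hind : ∀ x y, 0 ≤ y → u (x, y) = u (0, y) := by
    intro x y hy
    refine le_antisymm ?_ ?_
    · simpa using good_indep ha hu hpos hg x (-x) hy
    · simpa using good_indep ha hu hpos hg 0 x hy
  set f : ℝ → ℝ := fun y => u (0, y) with hf
  have hd2 : ∀ y, 0 < y → HasD2 f y (deriv f y) (deriv (deriv f) y) := by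
    intro y hy
    exact HasD2.of_contDiffAt ((hu.line_smooth 0).contDiffAt (Ici_mem_nhds hy))
  obtain ⟨c', hc'⟩ := hu.line_deriv_tendsto 0
  have hc0 : Tendsto f (𝓝[>] 0) (𝓝 (f 0)) :=
    (((hu.line_smooth 0).continuousOn 0 self_mem_Ici).mono Ioi_subset_Ici_self).tendsto
  refine ode_contra (γ := γ) (m := n / 2) (a := a) (α := α) hγ (by positivity) (by rw [hγdef]; ring) ?_ (f := f)
    (f' := deriv f) (f'' := deriv (deriv f)) (fun y hy => hpos 0 y hy.le) (fun y hy => (hd2 y hy).hasDerivAt)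
    (fun y hy => (hd2 y hy).hasDerivAt_deriv) ?_ ?_ hc0 hc'
  · have : (n:ℝ) + 2 * a - 2 ≠ 0 := by linarith
    rw [hα, hγdef]; field_simp; ring
  · intro y hy
    obtain ⟨p, q, d, r, ⟨h1, h2⟩, h3⟩ := hu.hasL (x := 0) hy
    obtain ⟨e1, e2⟩ := h1.unique (hd2 y hy)
    have e3 : ∀ i, r i = 0 := by
      intro i
      refine ((h2 i).unique ((HasD2.const (u (0, y)) _).congr (Eventually.of_forall fun t => ?_))).2
      exact hind _ _ hy.le
    rw [e1, e2] at h3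
    simp only [e3, Finset.sum_const_zero] at h3
    show y * deriv (deriv f) y + a * deriv f y + u (0, y) ^ α = 0
    linarith
  · intro y hy
    have hg0 : ∀ μ, 0 < μ → Good a u μ := by
      have := hg 0
      have e : tr (0 : Fin n → ℝ) u = u := by ext ⟨x, y⟩; simp [tr_apply]
      rwa [e] at this
    have h1 : HasDerivAt (fun m : ℝ => m ^ γ * f (m ^ 2 * y)) (γ * f y + 2 * y * deriv f y) 1 := by
      have d1 : HasDerivAt (fun m : ℝ => m ^ 2 * y) (2 * y) 1 := by
        have := (hasDerivAt_pow 2 (1:ℝ)).mul_const y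
        simpa using this
      have d2 : HasDerivAt (fun m : ℝ => f (m ^ 2 * y)) (deriv f y * (2 * y)) 1 := by
        have := (hd2 y hy).hasDerivAt
        exact HasDerivAt.comp (h₂ := f) 1 (by simpa using this) d1
      have d3 := (Real.hasDerivAt_rpow_const (x := 1) (p := γ) (Or.inl one_ne_zero)).mul d2
      refine d3.congr_deriv ?_
      simp
      ring
    have h2 := deriv_nonneg_of_right_min h1 (fun s hs => by
      have := good_scale ha hpos hg0 0 hy.le hs.le
      simpa [f] using this)
    have h3 : 0 < f y := hpos 0 y hy.le
    rw [div_add_div _ _ two_ne_zero h3.ne']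
    apply div_nonneg _ (by positivity)
    linarith

theorem tendsto_zero_of_rho {ι : Type*} {l : Filter ι} {Z : ι → (Fin n → ℝ) × ℝ} (hZ : ∀ i, 0 ≤ (Z i).2)
    (h : Tendsto (fun i => rho (Z i)) l (𝓝 0)) : Tendsto Z l (𝓝 (0, 0)) := by
  have hs : ∀ i, 0 ≤ ∑ j, (Z i).1 j ^ 2 := fun i => Finset.sum_nonneg fun j _ => sq_nonneg _
  refine Tendsto.prodMk_nhds (mx := fun i => (Z i).1) (my := fun i => (Z i).2) ?_ ?_
  · rw [tendsto_pi_nhds]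
    intro j
    have h1 : Tendsto (fun i => |(Z i).1 j|) l (𝓝 0) := by
      have h2 : Tendsto (fun i => √(rho (Z i))) l (𝓝 0) := by simpa using h.sqrt
      refine squeeze_zero (fun i => abs_nonneg _) (fun i => ?_) h2
      refine Real.abs_le_sqrt ?_
      have := Finset.single_le_sum (f := fun j => (Z i).1 j ^ 2) (fun j _ => sq_nonneg _) (Finset.mem_univ j)
      simp only [rho]
      linarith [hZ i]
    exact (tendsto_zero_iff_abs_tendsto_zero _).2 h1
  · refine squeeze_zero hZ (fun i => ?_) h
    simp only [rho]
    linarith [hs i, hZ i]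

theorem kel_lim {ι : Type*} {l : Filter ι} {Z : ι → (Fin n → ℝ) × ℝ} (hZ : ∀ i, 0 ≤ (Z i).2)
    (h : Tendsto (fun i => rho (Z i)) l atTop) (ha : 1 < a) (hu : Sol a α u) {μ : ℝ} (hμ : 0 < μ) :
    Tendsto (fun i => rho (Z i) ^ (((n:ℝ) + 2 * a - 2) / 2) * kel a μ u (Z i)) l
      (𝓝 (μ ^ (((n:ℝ) + 2 * a - 2) / 2) * u (0, 0))) := by
  set γ := ((n:ℝ) + 2 * a - 2) / 2 with hγdef
  have hz : Tendsto (fun i => (((rho (Z i))⁻¹ • (Z i).1, (rho (Z i))⁻¹ ^ 2 * (Z i).2) : (Fin n → ℝ) × ℝ)) l (𝓝 (0, 0)) := by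
    refine tendsto_zero_of_rho (fun i => mul_nonneg (by positivity) (hZ i)) ?_
    refine (tendsto_inv_atTop_zero.comp h).congr' ?_
    filter_upwards [h.eventually_gt_atTop 0] with i hi
    rw [rho_scale]
    simp only [Function.comp, Prod.mk.eta]
    field_simp
  have h2 : Tendsto (fun i => Gk a u (μ, ((rho (Z i))⁻¹ • (Z i).1, (rho (Z i))⁻¹ ^ 2 * (Z i).2))) l (𝓝 (Gk a u (μ, (0, 0)))) :=
    ((continuous_Gk ha hu).tendsto _).comp (tendsto_const_nhds.prodMk_nhds hz)
  have h3 : Gk a u (μ, (0, 0)) = μ ^ γ * u (0, 0) := by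
    simp [Gk, abs_of_pos hμ, hγdef]
  rw [h3] at h2
  refine h2.congr' ?_
  filter_upwards [h.eventually_gt_atTop 0] with i hi
  have := kel_eq_Gk (a := a) (u := u) hμ (x := (Z i).1) (y := (Z i).2) (hZ i) hi
  simp only [Prod.mk.eta] at this
  rw [this, ← mul_assoc, ← hγdef, ← Real.rpow_add hi]
  simp

/-- inversion symmetry around `c` -/
def InvSym (a : ℝ) (u : (Fin n → ℝ) × ℝ → ℝ) (c : Fin n → ℝ) (μ : ℝ) : Prop :=
  ∀ x y, 0 ≤ y → 0 < rho (x, y) → kel a μ (tr c u) (x, y) = u (x + c, y)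

theorem not_mixed (ha : 1 < a) (hu : Sol a α u) (hpos : ∀ x y, 0 ≤ y → 0 < u (x, y))
    (hg : ∀ μ, 0 < μ → Good a u μ) {c : Fin n → ℝ} {μ : ℝ} (hμ : 0 < μ) (hs : InvSym a u c μ) : False := by
  have hγ := gam_pos n ha
  set γ := ((n:ℝ) + 2 * a - 2) / 2 with hγdef
  have hr : ∀ x : Fin n → ℝ, Tendsto (fun t : ℝ => rho (x, |t|)) atTop atTop := by
    intro x
    have h1 : Tendsto (fun t : ℝ => ∑ i, x i ^ 2 + 4 * |t|) atTop atTop :=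
      tendsto_atTop_add_const_left _ _ ((tendsto_abs_atTop_atTop).const_mul_atTop (by norm_num))
    exact h1
  have h1 := kel_lim (Z := fun t : ℝ => (-c, |t|)) (fun t => abs_nonneg t) (hr (-c)) ha (hu.trans c) hμ
  rw [← hγdef] at h1
  have hle : ∀ ν, 0 < ν → ν ^ γ * u (0, 0) ≤ μ ^ γ * u ((0, 0) + (c, 0)) := by
    intro ν hν
    have h2 := kel_lim (Z := fun t : ℝ => ((0 : Fin n → ℝ), |t|)) (fun t => abs_nonneg t) (hr 0) ha hu hν
    rw [← hγdef] at h2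
    refine le_of_tendsto_of_tendsto h2 h1 ?_
    filter_upwards [(hr 0).eventually_ge_atTop ν, eventually_gt_atTop 0] with t h3 ht
    have hν' := hν.trans_le h3
    have hrr : rho ((0 : Fin n → ℝ), |t|) ≤ rho (-c, |t|) := by
      simp only [rho_eq]
      have : 0 ≤ ∑ i, (-c) i ^ 2 := Finset.sum_nonneg fun i _ => sq_nonneg _
      simpa using this
    have h4 := hs (-c) |t| (abs_nonneg t) (hν'.trans_le hrr)
    have h5 := hg ν hν 0 |t| (abs_nonneg t) h3
    rw [neg_add_cancel] at h4
    have h6 : kel a μ (fun z => u (z + (c, 0))) (-c, |t|) = u (0, |t|) := h4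
    rw [h6]
    have h7 := (hpos 0 |t| (abs_nonneg t)).le
    calc _ ≤ rho ((0 : Fin n → ℝ), |t|) ^ γ * u (0, |t|) :=
          mul_le_mul_of_nonneg_left h5 (Real.rpow_nonneg hν'.le _)
      _ ≤ _ := mul_le_mul_of_nonneg_right (Real.rpow_le_rpow hν'.le hrr hγ.le) h7
  have h8 : Tendsto (fun ν : ℝ => ν ^ γ * u (0, 0)) atTop atTop :=
    (tendsto_rpow_atTop hγ).atTop_mul_const (hpos 0 0 le_rfl)
  obtain ⟨ν, h9, h10⟩ := ((h8.eventually_gt_atTop (μ ^ γ * u ((0, 0) + (c, 0)))).and (eventually_gt_atTop 0)).exists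
  exact absurd (hle ν h10) (not_le.2 h9)

theorem all_sym (ha : 1 < a) (hα : α = (n + 2 * a + 2) / (n + 2 * a - 2)) (hu : Sol a α u)
    (hpos : ∀ x y, 0 ≤ y → 0 < u (x, y)) : ∀ c, ∃ μ, 0 < μ ∧ InvSym a u c μ := by
  intro c
  have hp : ∀ c, ∀ x y, 0 ≤ y → 0 < tr c u (x, y) := fun c x y hy => by rw [tr_apply]; exact hpos _ _ hy
  rcases moving_spheres ha hα (hu.trans c) (hp c) with h | ⟨μ, h1, h2⟩
  · exfalso
    refine case_B (u := tr c u) ha hα (hu.trans c) (hp c) fun d => ?_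
    have hp' : ∀ x y, 0 ≤ y → 0 < tr d (tr c u) (x, y) := fun x y hy => by rw [tr_apply]; exact hp c _ _ hy
    rcases moving_spheres ha hα ((hu.trans c).trans d) hp' with h' | ⟨μ, h1, h2⟩
    · exact h'
    · exfalso
      refine not_mixed (u := tr c u) ha (hu.trans c) (hp c) h h1 (c := d) fun x y hy hr => ?_
      have := h2 x y hy hr
      rw [← tr_apply (u := tr c u)]
      exact this
  · refine ⟨μ, h1, fun x y hy hr => ?_⟩
    have := h2 x y hy hr
    rw [← tr_apply (u := u)]
    exact this
end

section
variable {n : ℕ} {a α : ℝ} {u : (Fin n → ℝ) × ℝ → ℝ}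

theorem bdry_curve {W : (Fin n → ℝ) → ℝ} (hd : Differentiable ℝ W) {x0 v : Fin n → ℝ} {μ : ℝ} (hμ : 0 < μ)
    (hv : 0 < ∑ i, v i ^ 2)
    (hW : ∀ x : Fin n → ℝ, 0 < ∑ i, x i ^ 2 → W (x + x0) = (∑ i, x i ^ 2) / μ * W ((μ / ∑ i, x i ^ 2) • x + x0)) :
    ∃ G : ℝ → ℝ, HasDerivAt G (fderiv ℝ W x0 v - 2 * (W x0 / μ) * ∑ i, v i * x0 i) 0 ∧
      G 0 = W x0 / μ * (∑ i, v i ^ 2) ∧ ∀ᶠ s in 𝓝[≠] 0, G s = s ^ 2 * W (s⁻¹ • v) := by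
  set q : ℝ → ℝ := fun s => ∑ i, (v i - s * x0 i) ^ 2 with hq
  have hq0 : q 0 = ∑ i, v i ^ 2 := by simp [hq]
  have hqd : HasDerivAt q (-2 * ∑ i, v i * x0 i) 0 := by
    have h1 : ∀ i ∈ Finset.univ, HasDerivAt (fun s : ℝ => (v i - s * x0 i) ^ 2) (-2 * (v i * x0 i)) 0 := by
      intro i _
      have := (((hasDerivAt_id (0:ℝ)).mul_const (x0 i)).const_sub (v i)).pow 2
      refine this.congr_deriv ?_
      simp; ring
    have := HasDerivAt.fun_sum h1
    rw [← Finset.mul_sum] at this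
    exact this
  have hqpos : 0 < q 0 := by rw [hq0]; exact hv
  refine ⟨fun s => q s / μ * W ((μ * s / q s) • (v - s • x0) + x0), ?_, ?_, ?_⟩
  · have hk : HasDerivAt (fun s => μ * s / q s) (μ / q 0) 0 := by
      have := ((hasDerivAt_id (0:ℝ)).const_mul μ).div hqd hqpos.ne'
      refine this.congr_deriv ?_
      simp; field_simp
    have hl : HasDerivAt (fun s : ℝ => v - s • x0) (-x0) 0 := by
      have := ((hasDerivAt_id (0:ℝ)).smul_const x0).const_sub v
      simpa using this
    have hc : HasDerivAt (fun s => (μ * s / q s) • (v - s • x0) + x0) ((μ / q 0) • v) 0 := by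
      have := (hk.smul hl).add_const x0
      refine this.congr_deriv ?_
      simp
    have hWd : HasDerivAt (fun s => W ((μ * s / q s) • (v - s • x0) + x0)) (fderiv ℝ W x0 ((μ / q 0) • v)) 0 := by
      have h1 : HasFDerivAt W (fderiv ℝ W x0) ((fun s : ℝ => (μ * s / q s) • (v - s • x0) + x0) 0) := by
        simpa using (hd x0).hasFDerivAt
      exact h1.comp_hasDerivAt 0 hc
    refine ((hqd.div_const μ).mul hWd).congr_deriv ?_
    simp only [map_smul, smul_eq_mul, mul_zero, zero_div, zero_smul, zero_add, sub_zero]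
    field_simp
    ring
  · simp [hq0]; ring
  · have h1 : ∀ᶠ s in 𝓝[≠] (0:ℝ), 0 < q s :=
      (hqd.continuousAt.eventually (lt_mem_nhds hqpos)).filter_mono nhdsWithin_le_nhds
    filter_upwards [h1, self_mem_nhdsWithin] with s hs hs0
    have hs0 : s ≠ 0 := hs0
    have hx : ∑ i, (s⁻¹ • v - x0) i ^ 2 = q s / s ^ 2 := by
      rw [hq]; simp only [Finset.sum_div]
      refine Finset.sum_congr rfl fun i _ => ?_
      simp; field_simp
    have h2 := hW (s⁻¹ • v - x0) (by rw [hx]; positivity)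
    rw [hx] at h2
    rw [sub_add_cancel] at h2
    rw [h2]
    have h3 : (μ / (q s / s ^ 2)) • (s⁻¹ • v - x0) = (μ * s / q s) • (v - s • x0) := by
      ext i; simp; field_simp
    rw [h3]
    field_simp

theorem eq_of_punctured {G H : ℝ → ℝ} {g h : ℝ} (hG : HasDerivAt G g 0) (hH : HasDerivAt H h 0)
    (he : ∀ᶠ s in 𝓝[≠] 0, G s = H s) : G 0 = H 0 ∧ g = h := by
  have h0 : G 0 = H 0 := by
    refine tendsto_nhds_unique (hG.continuousAt.tendsto.mono_left (nhdsWithin_le_nhds (s := {0}ᶜ))) ?_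
    exact (hH.continuousAt.tendsto.mono_left nhdsWithin_le_nhds).congr' (by filter_upwards [he] with s hs using hs.symm)
  refine ⟨h0, ?_⟩
  have h1 : G =ᶠ[𝓝 0] H := by
    rw [eventually_nhdsWithin_iff] at he
    filter_upwards [he] with s hs
    by_cases h : s = 0
    · rw [h, h0]
    · exact hs h
  exact hG.unique (hH.congr_of_eventuallyEq h1)

theorem bdry_quad (hn : 1 ≤ n) {W : (Fin n → ℝ) → ℝ} (hd : Differentiable ℝ W) (hpos : ∀ x, 0 < W x)
    {μ : (Fin n → ℝ) → ℝ} (hμ : ∀ x, 0 < μ x)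
    (hW : ∀ x0 x : Fin n → ℝ, 0 < ∑ i, x i ^ 2 →
      W (x + x0) = (∑ i, x i ^ 2) / μ x0 * W ((μ x0 / ∑ i, x i ^ 2) • x + x0)) :
    ∃ (c : Fin n → ℝ) (d : ℝ), 0 < d ∧ ∀ x, μ x = ∑ i, (x i - c i) ^ 2 + d := by
  set B := W 0 / μ 0 with hB
  have hB0 : 0 < B := div_pos (hpos 0) (hμ 0)
  have key : ∀ x0 v : Fin n → ℝ, 0 < ∑ i, v i ^ 2 → W x0 / μ x0 = B ∧
      fderiv ℝ W x0 v - 2 * (W x0 / μ x0) * ∑ i, v i * x0 i = fderiv ℝ W 0 v := by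
    intro x0 v hv
    obtain ⟨G, g1, g2, g3⟩ := bdry_curve hd (hμ x0) hv (hW x0)
    obtain ⟨H, k1, k2, k3⟩ := bdry_curve hd (hμ 0) hv (hW 0)
    obtain ⟨e1, e2⟩ := eq_of_punctured g1 k1 (by filter_upwards [g3, k3] with s h1 h2 using h1.trans h2.symm)
    rw [g2, k2] at e1
    refine ⟨mul_right_cancel₀ hv.ne' e1, ?_⟩
    rw [e2]; simp
  have hBx : ∀ x, μ x = W x / B := by
    intro x
    have := (key x (fun _ => 1) (by simp; omega)).1
    rw [← this]
    have := (hpos x).ne'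
    have := (hμ x).ne'
    field_simp
  set ℓ : Fin n → ℝ := fun i => fderiv ℝ W 0 (Pi.single i 1) with hℓ
  have hlin : ∀ x, fderiv ℝ W 0 x = ∑ i, x i * ℓ i := by
    intro x
    conv_lhs => rw [pi_eq_sum_univ' x]
    rw [map_sum]
    refine Finset.sum_congr rfl fun i _ => ?_
    rw [map_smul, smul_eq_mul]
  have hder : ∀ x0 v : Fin n → ℝ, fderiv ℝ W x0 v = fderiv ℝ W 0 v + 2 * B * ∑ i, v i * x0 i := by
    intro x0 v
    by_cases hv : v = 0
    · subst hv; simp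
    · have hv' : 0 < ∑ i, v i ^ 2 := by
        obtain ⟨i, hi⟩ := Function.ne_iff.1 hv
        exact Finset.sum_pos' (fun i _ => sq_nonneg _) ⟨i, Finset.mem_univ i, lt_of_le_of_ne (sq_nonneg _) (Ne.symm (pow_ne_zero 2 hi))⟩
      obtain ⟨h1, h2⟩ := key x0 v hv'
      rw [h1] at h2; linarith
  have hWx : ∀ x, W x = W 0 + ∑ i, x i * ℓ i + B * ∑ i, x i ^ 2 := by
    intro x
    have h1 : ∀ t : ℝ, HasDerivAt (fun t : ℝ => W (t • x) - t * (∑ i, x i * ℓ i) - B * (∑ i, x i ^ 2) * t ^ 2) 0 t := by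
      intro t
      have h2 : HasDerivAt (fun t : ℝ => t • x) x t := by simpa using (hasDerivAt_id t).smul_const x
      have h3 := ((hd (t • x)).hasFDerivAt.comp_hasDerivAt t h2)
      have h4 := (h3.sub ((hasDerivAt_id t).mul_const (∑ i, x i * ℓ i))).sub ((hasDerivAt_pow 2 t).const_mul (B * (∑ i, x i ^ 2)))
      refine h4.congr_deriv ?_
      rw [hder, hlin]
      have : ∑ i, x i * (t • x) i = t * ∑ i, x i ^ 2 := by
        rw [Finset.mul_sum]
        refine Finset.sum_congr rfl fun i _ => ?_
        simp; ring
      rw [this]; push_cast; ring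
    have h5 := is_const_of_deriv_eq_zero (fun t => (h1 t).differentiableAt) (fun t => (h1 t).deriv) 1 0
    simp at h5
    linarith
  set c : Fin n → ℝ := fun i => -(ℓ i) / (2 * B) with hc
  have hsq : ∀ x, W x = B * ∑ i, (x i - c i) ^ 2 + (W 0 - B * ∑ i, c i ^ 2) := by
    intro x
    rw [hWx x]
    have : ∀ i, (x i - c i) ^ 2 = x i ^ 2 + x i * ℓ i / B + c i ^ 2 := by
      intro i; simp only [hc]; field_simp; ring
    simp only [this, Finset.sum_add_distrib, ← Finset.sum_div]
    field_simp; ring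
  refine ⟨c, W c / B, div_pos (hpos c) hB0, fun x => ?_⟩
  rw [hBx x]
  have h1 := hsq x
  have h2 := hsq c
  simp at h2
  rw [h1, h2]; field_simp

/-- the negative power -/
noncomputable def vf (a : ℝ) (u : (Fin n → ℝ) × ℝ → ℝ) (z : (Fin n → ℝ) × ℝ) : ℝ :=
  u z ^ (-(((n:ℝ) + 2 * a - 2) / 2)⁻¹)

theorem vf_pos (hpos : ∀ x y, 0 ≤ y → 0 < u (x, y)) {x : Fin n → ℝ} {y : ℝ} (hy : 0 ≤ y) : 0 < vf a u (x, y) :=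
  Real.rpow_pos_of_pos (hpos x y hy) _

theorem vf_sym (ha : 1 < a) (hpos : ∀ x y, 0 ≤ y → 0 < u (x, y)) {c : Fin n → ℝ} {μ : ℝ} (hμ : 0 < μ)
    (hs : InvSym a u c μ) {x : Fin n → ℝ} {y : ℝ} (hy : 0 ≤ y) (hr : 0 < rho (x, y)) :
    vf a u (x + c, y) = rho (x, y) / μ * vf a u ((μ / rho (x, y)) • x + c, (μ / rho (x, y)) ^ 2 * y) := by
  have hγ := gam_pos n ha
  have h1 := hs x y hy hr
  unfold kel at h1
  rw [tr_apply] at h1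
  simp only [] at h1
  unfold vf
  set γ := ((n:ℝ) + 2 * a - 2) / 2 with hγdef
  have h2 : 0 < μ / rho (x, y) := by positivity
  have h3 := hpos ((μ / rho (x, y)) • x + c) ((μ / rho (x, y)) ^ 2 * y) (by positivity)
  rw [← h1, Real.mul_rpow (Real.rpow_nonneg h2.le _) h3.le, ← Real.rpow_mul h2.le, mul_neg, mul_inv_cancel₀ hγ.ne',
    Real.rpow_neg_one, inv_div]

theorem caseA1 (hn : 1 ≤ n) (ha : 1 < a) (hu : Sol a α u)
    (hpos : ∀ x y, 0 ≤ y → 0 < u (x, y)) (hall : ∀ c, ∃ μ, 0 < μ ∧ InvSym a u c μ) :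
    ∃ (c : Fin n → ℝ) (d : ℝ), 0 < d ∧ ∀ x0, InvSym a (tr c u) x0 (∑ i, x0 i ^ 2 + d) := by
  choose μ hμ hs using hall
  have hdiff : Differentiable ℝ (fun x : Fin n → ℝ => vf a u (x, 0)) := by
    have h1 : ContDiff ℝ 2 (fun x : Fin n → ℝ => u (x, 0)) := by
      rw [← contDiffOn_univ]
      refine hu.reg.comp (by fun_prop) ?_
      intro x _
      show (0:ℝ) ≤ 0
      exact le_rfl
    intro x
    exact (h1.differentiable (by norm_num) x).rpow_const (Or.inl (hpos x 0 le_rfl).ne')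
  have hW : ∀ x0 x : Fin n → ℝ, 0 < ∑ i, x i ^ 2 → (fun x => vf a u (x, 0)) (x + x0) =
      (∑ i, x i ^ 2) / μ x0 * (fun x => vf a u (x, 0)) ((μ x0 / ∑ i, x i ^ 2) • x + x0) := by
    intro x0 x hx
    have := vf_sym ha hpos (hμ x0) (hs x0) (x := x) (y := 0) le_rfl (by simpa [rho_eq] using hx)
    simpa [rho_eq] using this
  obtain ⟨c, d, hd, h⟩ := bdry_quad hn hdiff (fun x => vf_pos hpos le_rfl) hμ hW
  refine ⟨c, d, hd, fun x0 => ?_⟩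
  have h1 := hs (x0 + c)
  rw [h] at h1
  intro x y hy hr
  have h2 := h1 x y hy hr
  rw [tr_tr, tr_apply, add_assoc, ← h2]
  simp
end

theorem obata_alg {n a s H p q c0 N R : ℝ} (hs : s ≠ 0) (hs1 : 1 - s ^ 2 ≠ 0) (hH : H ≠ 0) (hN : N ≠ 0) (hNe : N = n + 2 * a)
    (hR : R = N / 2 * (1 - s ^ 2) * p ^ 2 / H - N / 2 * H + c0 / H)
    (hq : q = (R - (n / s - N * s) * p) / (1 - s ^ 2)) :
    (n / s - 2 * a * s / (1 - s ^ 2) + (1 - N) * p / H) * p * ((N - 1) / N * R - (n / s - (N - 1) * s) * p)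
      + q * ((N - 1) / N * R - (n / s - (N - 1) * s) * p)
      + p * ((N - 1) / N * (N / 2 * (-2 * s * p ^ 2 / H + (1 - s ^ 2) * (2 * p * q / H - p ^ 3 / H ^ 2)) - N / 2 * p - c0 * p / H ^ 2)
        - (n / s - (N - 1) * s) * q + (n / s ^ 2 + (N - 1)) * p)
    = (((N - 1) / N * R - (n / s - (N - 1) * s) * p) ^ 2 + n * ((1 - s ^ 2) * p / s - R / N) ^ 2
        + (2 * a - 1) * (s * p + R / N) ^ 2) / (1 - s ^ 2) := by
  have hn : n = N - 2 * a := by linarith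
  have hc : c0 = H * R - N / 2 * (1 - s ^ 2) * p ^ 2 + N / 2 * H ^ 2 := by
    rw [hR]; field_simp; ring
  rw [hq, hc, hn]
  clear hR hc hq hNe hn
  field_simp
  ring

theorem obata {n a N c0 : ℝ} (hn : 0 < n) (ha : 1 < a) (hN : N = n + 2 * a) {H H' H'' : ℝ → ℝ}
    (hpos : ∀ s, 0 < s → s < 1 → 0 < H s)
    (h1 : ∀ s, 0 < s → s < 1 → HasDerivAt H (H' s) s)
    (h2 : ∀ s, 0 < s → s < 1 → HasDerivAt H' (H'' s) s)
    (heq : ∀ s, 0 < s → s < 1 → (1 - s ^ 2) * H'' s + (n / s - N * s) * H' s =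
      N / 2 * (1 - s ^ 2) * H' s ^ 2 / H s - N / 2 * H s + c0 / H s)
    {g0 k0 g1 k1 : ℝ} (hg0 : 0 < g0) (hg1 : 0 < g1)
    (t0 : Tendsto H (𝓝[>] 0) (𝓝 g0)) (t0' : Tendsto (fun s => H' s / s) (𝓝[>] 0) (𝓝 k0))
    (t1 : Tendsto H (𝓝[<] 1) (𝓝 g1)) (t1' : Tendsto H' (𝓝[<] 1) (𝓝 k1)) :
    ∀ s, 0 < s → s < 1 → H s ^ 2 = 2 * c0 / N := by
  have hN0 : 0 < N := by rw [hN]; linarith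
  set R : ℝ → ℝ := fun s => N / 2 * (1 - s ^ 2) * H' s ^ 2 / H s - N / 2 * H s + c0 / H s with hR
  set e : ℝ → ℝ := fun s => (N - 1) / N * R s - (n / s - (N - 1) * s) * H' s with he
  set A : ℝ → ℝ := fun s => s ^ n * (1 - s ^ 2) ^ a * H s ^ (1 - N) with hA
  set X : ℝ → ℝ := fun s => A s * (H' s * e s) with hX
  set Q : ℝ → ℝ := fun s => (e s) ^ 2 + n * ((1 - s ^ 2) * H' s / s - R s / N) ^ 2 + (2 * a - 1) * (s * H' s + R s / N) ^ 2 with hQ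
  have hs2 : ∀ s : ℝ, 0 < s → s < 1 → 0 < 1 - s ^ 2 := fun s h0 h1 => by nlinarith
  have hApos : ∀ s, 0 < s → s < 1 → 0 < A s := by
    intro s p0 p1
    have := hs2 s p0 p1
    have := hpos s p0 p1
    simp only [hA]; positivity
  have hXd : ∀ s, 0 < s → s < 1 → HasDerivAt X (A s * (Q s / (1 - s ^ 2))) s := by
    intro s p0 p1
    have q2 := hs2 s p0 p1
    have q3 := hpos s p0 p1
    have dH := h1 s p0 p1
    have dH' := h2 s p0 p1
    have dsq : HasDerivAt (fun s : ℝ => 1 - s ^ 2) (-(2 * s)) s := by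
      have := (hasDerivAt_pow 2 s).const_sub 1
      simpa using this
    have dA : HasDerivAt A (A s * (n / s - 2 * a * s / (1 - s ^ 2) + (1 - N) * H' s / H s)) s := by
      have d1 : HasDerivAt (fun s : ℝ => s ^ n) (s ^ n * (n / s)) s := by
        refine (Real.hasDerivAt_rpow_const (x := s) (p := n) (Or.inl p0.ne')).congr_deriv ?_
        rw [Real.rpow_sub_one p0.ne']; field_simp
      have d2 : HasDerivAt (fun s : ℝ => (1 - s ^ 2) ^ a) ((1 - s ^ 2) ^ a * (- 2 * a * s / (1 - s ^ 2))) s := by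
        refine (dsq.rpow_const (p := a) (Or.inl q2.ne')).congr_deriv ?_
        rw [Real.rpow_sub_one q2.ne']; field_simp
      have d3 : HasDerivAt (fun s : ℝ => H s ^ (1 - N)) (H s ^ (1 - N) * ((1 - N) * H' s / H s)) s := by
        refine (dH.rpow_const (p := 1 - N) (Or.inl q3.ne')).congr_deriv ?_
        rw [Real.rpow_sub_one q3.ne']; field_simp
      refine ((d1.mul d2).mul d3).congr_deriv ?_
      simp only [hA, Pi.mul_apply]
      ring
    have dR : HasDerivAt R (N / 2 * (-2 * s * H' s ^ 2 / H s + (1 - s ^ 2) * (2 * H' s * H'' s / H s - H' s ^ 3 / H s ^ 2)) - N / 2 * H' s - c0 * H' s / H s ^ 2) s := by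
      have d1 := ((dsq.const_mul (N / 2)).mul (dH'.pow 2)).div dH q3.ne'
      have d2 := (d1.sub (dH.const_mul (N / 2))).add ((hasDerivAt_const s c0).div dH q3.ne')
      refine d2.congr_deriv ?_
      simp only [Pi.mul_apply, Pi.pow_apply]
      field_simp
      push_cast
      ring
    have de : HasDerivAt e ((N - 1) / N * (N / 2 * (-2 * s * H' s ^ 2 / H s + (1 - s ^ 2) * (2 * H' s * H'' s / H s - H' s ^ 3 / H s ^ 2)) - N / 2 * H' s - c0 * H' s / H s ^ 2)
        - (n / s - (N - 1) * s) * H'' s + (n / s ^ 2 + (N - 1)) * H' s) s := by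
      have d1 := ((hasDerivAt_const s n).div (hasDerivAt_id s) p0.ne').sub ((hasDerivAt_id s).const_mul (N - 1))
      have d2 := (dR.const_mul ((N - 1) / N)).sub (d1.mul dH')
      refine d2.congr_deriv ?_
      simp only [Pi.sub_apply, Pi.div_apply, id_eq]
      ring
    refine (dA.mul (dH'.mul de)).congr_deriv ?_
    have key := obata_alg (n := n) (a := a) (s := s) (H := H s) (p := H' s) (q := H'' s) (c0 := c0) (N := N) (R := R s)
      p0.ne' q2.ne' q3.ne' hN0.ne' hN rfl (by rw [eq_div_iff q2.ne']; have := heq s p0 p1; simp only [hR]; linarith)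
    have key2 : A s * (Q s / (1 - s ^ 2)) = A s * _ := congrArg (fun t => A s * t) key.symm
    rw [key2]
    simp only [Pi.mul_apply, he]
    ring
  have hn2 : 0 < 2 * a - 1 := by linarith
  have hQ0 : ∀ s, 0 ≤ Q s := by
    intro s
    simp only [hQ]; positivity
  have id0 : Tendsto (fun s : ℝ => s) (𝓝[>] 0) (𝓝 0) := tendsto_nhdsWithin_of_tendsto_nhds tendsto_id
  have id1 : Tendsto (fun s : ℝ => s) (𝓝[<] 1) (𝓝 1) := tendsto_nhdsWithin_of_tendsto_nhds tendsto_id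
  have t0H' : Tendsto H' (𝓝[>] 0) (𝓝 0) := by
    have := t0'.mul id0
    rw [mul_zero] at this
    refine this.congr' ?_
    filter_upwards [self_mem_nhdsWithin] with s hs
    have : s ≠ 0 := ne_of_gt hs
    field_simp
  have c : Tendsto (fun _ : ℝ => (1:ℝ)) (𝓝[>] 0) (𝓝 1) := tendsto_const_nhds
  have hX0 : Tendsto X (𝓝[>] 0) (𝓝 0) := by
    have r1 := (((((id0.pow 2).const_sub 1).const_mul (N / 2)).mul (t0H'.pow 2)).div t0 hg0.ne').sub (t0.const_mul (N / 2))
    have r2 := r1.add ((tendsto_const_nhds (x := c0)).div t0 hg0.ne')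
    have r3 := (r2.const_mul ((N - 1) / N)).sub ((t0'.const_mul n).sub ((id0.const_mul (N - 1)).mul t0H'))
    have r4 := ((id0.rpow_const (p := n) (Or.inr hn.le)).mul (((id0.pow 2).const_sub 1).rpow_const (p := a) (Or.inr (by linarith)))).mul
      (t0.rpow_const (p := 1 - N) (Or.inl hg0.ne'))
    have r5 := r4.mul (t0H'.mul r3)
    rw [zero_mul, mul_zero] at r5
    refine r5.congr' ?_
    filter_upwards [self_mem_nhdsWithin] with s hs
    have : s ≠ 0 := ne_of_gt hs
    simp only [hX, hA, he, hR, Pi.div_apply]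
    have e3 : n * (H' s / s) - (N - 1) * s * H' s = (n / s - (N - 1) * s) * H' s := by field_simp
    rw [e3]
  have hX1 : Tendsto X (𝓝[<] 1) (𝓝 0) := by
    have r1 := (((((id1.pow 2).const_sub 1).const_mul (N / 2)).mul (t1'.pow 2)).div t1 hg1.ne').sub (t1.const_mul (N / 2))
    have r2 := r1.add ((tendsto_const_nhds (x := c0)).div t1 hg1.ne')
    have r3 := (r2.const_mul ((N - 1) / N)).sub ((((tendsto_const_nhds (x := n)).div id1 one_ne_zero).sub (id1.const_mul (N - 1))).mul t1')
    have r4 := ((id1.rpow_const (p := n) (Or.inr hn.le)).mul (((id1.pow 2).const_sub 1).rpow_const (p := a) (Or.inr (by linarith)))).mul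
      (t1.rpow_const (p := 1 - N) (Or.inl hg1.ne'))
    have r5 := r4.mul (t1'.mul r3)
    have z : ((1:ℝ) - 1 ^ 2) ^ a = 0 := by norm_num; exact Real.zero_rpow (by linarith)
    rw [z, mul_zero, zero_mul, zero_mul] at r5
    exact r5
  have hmono : MonotoneOn X (Ioo 0 1) := by
    refine monotoneOn_of_deriv_nonneg (convex_Ioo 0 1) (fun t ht => (hXd t ht.1 ht.2).continuousAt.continuousWithinAt)
        (fun t ht => ?_) fun t ht => ?_
    · rw [interior_Ioo] at ht
      exact (hXd t ht.1 ht.2).differentiableAt.differentiableWithinAt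
    · rw [interior_Ioo] at ht
      rw [(hXd t ht.1 ht.2).deriv]
      exact mul_nonneg (hApos t ht.1 ht.2).le (div_nonneg (hQ0 t) (hs2 t ht.1 ht.2).le)
  have hXz : ∀ s, 0 < s → s < 1 → X s = 0 := by
    intro s p0 p1
    refine le_antisymm ?_ ?_
    · refine ge_of_tendsto hX1 ?_
      filter_upwards [Ioo_mem_nhdsLT p1] with t ht
      exact hmono ⟨p0, p1⟩ ⟨p0.trans ht.1, ht.2⟩ ht.1.le
    · refine le_of_tendsto hX0 ?_
      filter_upwards [Ioo_mem_nhdsGT p0] with t ht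
      exact hmono ⟨ht.1, ht.2.trans p1⟩ ⟨p0, p1⟩ ht.2.le
  intro s p0 p1
  have d0 : HasDerivAt X 0 s := by
    refine (hasDerivAt_const s (0:ℝ)).congr_of_eventuallyEq ?_
    filter_upwards [Ioo_mem_nhds p0 p1] with t ht using hXz t ht.1 ht.2
  have z := (hXd s p0 p1).unique d0
  have q2 := hs2 s p0 p1
  have q3 := hpos s p0 p1
  rw [mul_eq_zero, div_eq_zero_iff] at z
  have zQ : Q s = 0 := by
    rcases z with z | z | z
    · exact absurd z (hApos s p0 p1).ne'
    · exact z
    · exact absurd z q2.ne'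
  simp only [hQ] at zQ
  have w1 : (1 - s ^ 2) * H' s / s - R s / N = 0 := by
    have := mul_nonneg hn.le (sq_nonneg ((1 - s ^ 2) * H' s / s - R s / N))
    have := mul_nonneg hn2.le (sq_nonneg (s * H' s + R s / N))
    have : n * ((1 - s ^ 2) * H' s / s - R s / N) ^ 2 = 0 := by linarith [sq_nonneg (e s)]
    rcases mul_eq_zero.1 this with h | h
    · exact absurd h hn.ne'
    · exact pow_eq_zero_iff (two_ne_zero) |>.1 h
  have w2 : s * H' s + R s / N = 0 := by
    have := mul_nonneg hn.le (sq_nonneg ((1 - s ^ 2) * H' s / s - R s / N))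
    have := mul_nonneg hn2.le (sq_nonneg (s * H' s + R s / N))
    have : (2 * a - 1) * (s * H' s + R s / N) ^ 2 = 0 := by linarith [sq_nonneg (e s)]
    rcases mul_eq_zero.1 this with h | h
    · exact absurd h hn2.ne'
    · exact pow_eq_zero_iff (two_ne_zero) |>.1 h
  have w3 : H' s = 0 := by
    have : (1 - s ^ 2) * H' s / s + s * H' s = 0 := by linarith
    field_simp at this
    linarith
  have w4 : R s = 0 := by
    rw [w3] at w2
    have : R s / N = 0 := by linarith
    rcases div_eq_zero_iff.1 this with h | h
    · exact h
    · exact absurd h hN0.ne'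
  simp only [hR, w3] at w4
  field_simp at w4 ⊢
  linarith

section
variable {n : ℕ} {a α d : ℝ} {u : (Fin n → ℝ) × ℝ → ℝ}

/-- height -/
noncomputable def ys (d s : ℝ) : ℝ := d / 4 * ((1 - s) / (1 + s))

/-- profile -/
noncomputable def Hf (a d : ℝ) (u : (Fin n → ℝ) × ℝ → ℝ) (s : ℝ) : ℝ :=
  vf a u (0, ys d s) * ((1 + s) / (2 * d))

theorem vf_axis (hd : 0 < d) {y : ℝ} (hy : 0 ≤ y) :
    vf a u (0, y) = (d + 4 * y) * Hf a d u ((d - 4 * y) / (d + 4 * y)) := by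
  have h0 : d + 4 * y ≠ 0 := by positivity
  have h1 : 1 + (d - 4 * y) / (d + 4 * y) = 2 * d / (d + 4 * y) := by field_simp; ring
  have h2 : 1 - (d - 4 * y) / (d + 4 * y) = 8 * y / (d + 4 * y) := by field_simp; ring
  have h3 : ys d ((d - 4 * y) / (d + 4 * y)) = y := by
    unfold ys
    rw [h1, h2]; field_simp; ring
  unfold Hf
  rw [h3, h1]
  field_simp

theorem Hf_even (ha : 1 < a) (hd : 0 < d) (hpos : ∀ x y, 0 ≤ y → 0 < u (x, y)) (hS : InvSym a u 0 d)
    {s : ℝ} (h1 : -1 < s) (h2 : s < 1) : Hf a d u (-s) = Hf a d u s := by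
  have e1 : 0 < 1 - s := by linarith
  have e2 : 0 < 1 + s := by linarith
  have hy : 0 < ys d s := by unfold ys; positivity
  have hr : rho ((0 : Fin n → ℝ), ys d s) = 4 * ys d s := by simp [rho_eq]
  have h3 := vf_sym ha hpos hd hS (x := 0) (y := ys d s) hy.le (by rw [hr]; positivity)
  rw [hr] at h3
  simp only [add_zero, smul_zero] at h3
  have h4 : (d / (4 * ys d s)) ^ 2 * ys d s = ys d (-s) := by
    unfold ys; have := e1.ne'; have : 1 + -s ≠ 0 := by linarith
    rw [sub_neg_eq_add]; field_simp; ring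
  rw [h4] at h3
  unfold Hf
  rw [h3]
  unfold ys
  field_simp
  ring

theorem axis_map (hd : 0 < d) {x : Fin n → ℝ} {y : ℝ} (hx : 0 < ∑ i, x i ^ 2) (hy : 0 ≤ y) :
    ∃ τ : ℝ, τ < 0 ∧ τ * (1 - τ) * (∑ i, x i ^ 2) + 4 * y * τ + d * (1 - τ) = 0 := by
  set A := ∑ i, x i ^ 2 with hA
  set f : ℝ → ℝ := fun τ => τ * (1 - τ) * A + 4 * y * τ + d * (1 - τ) with hf
  have hc : Continuous f := by simp only [hf]; fun_prop
  have hT : 0 < 2 * d / A := by positivity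
  have f1 : f (-(2 * d / A)) < 0 := by
    have : f (-(2 * d / A)) = -d * (1 + 2 * d / A) - 4 * y * (2 * d / A) := by
      simp only [hf]; field_simp; ring
    rw [this]
    have : 0 < d * (1 + 2 * d / A) := by positivity
    have : 0 ≤ 4 * y * (2 * d / A) := by positivity
    linarith
  have f0 : 0 < f 0 := by simp [hf, hd]
  obtain ⟨τ, h1, h2⟩ := intermediate_value_Ioo (by linarith : -(2 * d / A) ≤ 0) hc.continuousOn ⟨f1, f0⟩
  exact ⟨τ, h1.2, h2⟩

theorem vf_rep (ha : 1 < a) (hd : 0 < d) (hpos : ∀ x y, 0 ≤ y → 0 < u (x, y))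
    (hS : ∀ x0, InvSym a u x0 (∑ i, x0 i ^ 2 + d)) (x : Fin n → ℝ) {y : ℝ} (hy : 0 ≤ y) :
    vf a u (x, y) = (rho (x, y) + d) * Hf a d u (√(1 - 16 * d * y / (rho (x, y) + d) ^ 2)) := by
  have hS0 : InvSym a u 0 d := by simpa using hS 0
  have axis : ∀ y : ℝ, 0 ≤ y → vf a u (0, y) = (4 * y + d) * Hf a d u (√(1 - 16 * d * y / (4 * y + d) ^ 2)) := by
    intro y hy
    have h0 : 0 < d + 4 * y := by positivity
    rw [vf_axis hd hy]
    have h1 : 1 - 16 * d * y / (4 * y + d) ^ 2 = ((d - 4 * y) / (d + 4 * y)) ^ 2 := by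
      have : 4 * y + d ≠ 0 := by linarith
      rw [add_comm d]; field_simp; ring
    rw [h1, Real.sqrt_sq_eq_abs, add_comm (4 * y)]
    congr 1
    rcases abs_choice ((d - 4 * y) / (d + 4 * y)) with h | h
    · rw [h]
    · rw [h]
      rcases hy.eq_or_lt with h2 | h2
      · exfalso
        rw [← h2] at h
        have : d / d = 1 := div_self hd.ne'
        simp [this] at h
        norm_num at h
      · refine (Hf_even ha hd hpos hS0 ?_ ?_).symm
        · rw [lt_div_iff₀ h0]; linarith
        · rw [div_lt_iff₀ h0]; linarith
  have hs : 0 ≤ ∑ i, x i ^ 2 := Finset.sum_nonneg fun i _ => sq_nonneg _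
  rcases hs.eq_or_lt with h0 | hx
  · have hx0 : x = 0 := by
      have h1 := h0.symm
      rw [Finset.sum_eq_zero_iff_of_nonneg (fun i _ => sq_nonneg _)] at h1
      ext i
      simpa using h1 i (Finset.mem_univ i)
    subst hx0
    have hr : rho ((0 : Fin n → ℝ), y) = 4 * y := by simp [rho_eq]
    rw [hr]; exact axis y hy
  · obtain ⟨τ, ht, heq⟩ := axis_map hd hx hy
    set A := ∑ i, x i ^ 2 with hA
    have hsum : ∀ k : ℝ, ∑ i, (k • x) i ^ 2 = k ^ 2 * A := by
      intro k; rw [hA, Finset.mul_sum]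
      exact Finset.sum_congr rfl fun i _ => by simp; ring
    have hr : rho ((1 - τ) • x, y) = (1 - τ) ^ 2 * A + 4 * y := by rw [rho_eq, hsum]
    have hr0 : 0 < (1 - τ) ^ 2 * A + 4 * y := by
      have : 0 < (1 - τ) ^ 2 := by nlinarith
      positivity
    have hμ : 0 < τ ^ 2 * A + d := by positivity
    have h1 := vf_sym ha hpos (c := τ • x) (μ := τ ^ 2 * A + d) hμ (by have := hS (τ • x); rwa [hsum] at this)
      (x := (1 - τ) • x) hy (by rw [hr]; exact hr0)
    rw [hr] at h1
    set s := (τ ^ 2 * A + d) / ((1 - τ) ^ 2 * A + 4 * y) with hsdef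
    have hs0 : 0 < s := by positivity
    have e6 : s * ((1 - τ) ^ 2 * A + 4 * y) = τ ^ 2 * A + d := div_mul_cancel₀ _ hr0.ne'
    have e1 : s * (1 - τ) + τ = 0 := by
      refine (mul_eq_zero.1 (?_ : (s * (1 - τ) + τ) * ((1 - τ) ^ 2 * A + 4 * y) = 0)).resolve_right hr0.ne'
      linear_combination (1 - τ) * e6 + heq
    have e2 : (1 - τ) • x + τ • x = x := by rw [← add_smul]; simp
    have e3 : s • (1 - τ) • x + τ • x = 0 := by rw [smul_smul, ← add_smul, e1, zero_smul]
    have e4 : ((1 - τ) ^ 2 * A + 4 * y) / (τ ^ 2 * A + d) = s⁻¹ := by rw [hsdef, inv_div]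
    rw [e2, e3, e4, axis _ (by positivity)] at h1
    have e5 : 4 * (s ^ 2 * y) + d = s * (A + 4 * y + d) := by
      linear_combination s * e6 - e6 - A * (s * (1 - τ) + τ) * e1
    rw [h1, rho_eq, ← hA, e5]
    have h5 : 16 * d * (s ^ 2 * y) / (s * (A + 4 * y + d)) ^ 2 = 16 * d * y / (A + 4 * y + d) ^ 2 := by
      have : A + 4 * y + d ≠ 0 := by positivity
      field_simp
    rw [h5]
    field_simp
end

theorem HasL.unique {n : ℕ} {a : ℝ} {f : (Fin n → ℝ) × ℝ → ℝ} {x : Fin n → ℝ} {y l m : ℝ}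
    (h : HasL a f x y l) (h' : HasL a f x y m) : l = m := by
  obtain ⟨p, q, d, r, ⟨h1, h2⟩, rfl⟩ := h
  obtain ⟨p', q', d', r', ⟨h1', h2'⟩, rfl⟩ := h'
  obtain ⟨e1, e2⟩ := h1.unique h1'
  rw [e1, e2, Finset.sum_congr rfl fun i _ => ((h2 i).unique (h2' i)).2]

theorem ode_alg {n a N γ d σ D y H H1 H2 p q r : ℝ} (hd : 0 < d) (hσ : 0 < σ) (hH : 0 < H)
    (hγ : 0 < γ) (hN : N = n + 2 * a) (hD : D = 2 * d / (1 + σ)) (hy : y = d / 4 * ((1 - σ) / (1 + σ)))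
    (hp : p = 4 * H - 4 * (1 + σ) * H1) (hq : q = 64 * d ^ 2 * H2 / D ^ 3)
    (hr : r = 2 * (H + (1 - σ ^ 2) * H1 / σ))
    (h : (D * H) * (y * q + a * p + n * r) = N / 2 * (y * p ^ 2) + 1 / γ) :
    (1 - σ ^ 2) * H2 + (n / σ - N * σ) * H1 =
      N / 2 * (1 - σ ^ 2) * H1 ^ 2 / H - N / 2 * H + (1 / (4 * γ * d)) / H := by
  have e : 0 < 1 + σ := by linarith
  subst hD hy hp hq hr
  have ha : n = N - 2 * a := by linarith
  subst ha
  field_simp at h ⊢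
  have key : ∀ X Y : ℝ, (1 + σ) * X = (1 + σ) * Y → X = Y := fun X Y h => mul_left_cancel₀ e.ne' h
  apply key
  linear_combination (1/8) * h

theorem horiz_deriv {H : ℝ → ℝ} {σ D k H1 : ℝ} (h0 : 0 < σ) (hD0 : 0 < D) (hσ2 : 1 - k / D ^ 2 = σ ^ 2)
    (h : HasDerivAt H H1 σ) :
    HasDerivAt (fun m => (m + D) * H (√(1 - k / (m + D) ^ 2))) (H σ + (1 - σ ^ 2) * H1 / σ) 0 := by
  have hne : (0 + D) ^ 2 ≠ 0 := by positivity
  have hk : k = (1 - σ ^ 2) * D ^ 2 := by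
    rw [← hσ2]; field_simp; ring
  have j0 : HasDerivAt (fun m : ℝ => m + D) 1 0 := (hasDerivAt_id 0).add_const D
  have j1 : HasDerivAt (fun m : ℝ => 1 - k / (m + D) ^ 2) (2 * (1 - σ ^ 2) / D) 0 := by
    have := (((hasDerivAt_const (0:ℝ) k).fun_div (j0.fun_pow 2) hne).const_sub 1)
    refine this.congr_deriv ?_
    rw [hk]; simp; field_simp
  have s0 : √(1 - k / (0 + D) ^ 2) = σ := by
    rw [zero_add, hσ2, Real.sqrt_sq h0.le]
  have j2 : HasDerivAt (fun m : ℝ => √(1 - k / (m + D) ^ 2)) ((1 - σ ^ 2) / (D * σ)) 0 := by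
    refine (j1.sqrt (by rw [zero_add, hσ2]; positivity)).congr_deriv ?_
    rw [s0]; field_simp
  have j3 : HasDerivAt (fun m : ℝ => H (√(1 - k / (m + D) ^ 2))) (H1 * ((1 - σ ^ 2) / (D * σ))) 0 :=
    HasDerivAt.comp (h₂ := H) (0:ℝ) (by rw [s0]; exact h) j2
  refine (j0.fun_mul j3).congr_deriv ?_
  rw [s0]; field_simp; ring

section
variable {n : ℕ} {a α d : ℝ} {u : (Fin n → ℝ) × ℝ → ℝ}

theorem Hf_smooth (hu : Sol a α u) (hd : 0 < d) (hpos : ∀ x y, 0 ≤ y → 0 < u (x, y)) :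
    ContDiffOn ℝ 2 (Hf a d u) (Ioc (-1) 1) := by
  have hys : ContDiffOn ℝ 2 (ys d) (Ioc (-1) 1) := by
    unfold ys
    refine contDiffOn_const.mul (ContDiffOn.div (by fun_prop) (by fun_prop) ?_)
    intro s hs; have := hs.1; linarith
  have hm : ∀ s ∈ Ioc (-1 : ℝ) 1, 0 ≤ ys d s := by
    intro s hs
    have e1 : 0 ≤ 1 - s := by linarith [hs.2]
    have e2 : 0 < 1 + s := by linarith [hs.1]
    unfold ys; positivity
  have h1 : ContDiffOn ℝ 2 (fun s => u (0, ys d s)) (Ioc (-1) 1) :=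
    (hu.line_smooth 0).comp hys hm
  unfold Hf vf
  refine ContDiffOn.mul (h1.rpow_const_of_ne fun s hs => (hpos _ _ (hm s hs)).ne') (by fun_prop)

theorem Hf_pos (hd : 0 < d) (hpos : ∀ x y, 0 ≤ y → 0 < u (x, y)) {s : ℝ} (h1 : -1 < s) (h2 : s ≤ 1) :
    0 < Hf a d u s := by
  have e1 : 0 ≤ 1 - s := by linarith
  have e2 : 0 < 1 + s := by linarith
  have : 0 ≤ ys d s := by unfold ys; positivity
  have := vf_pos (a := a) hpos (x := 0) this
  unfold Hf; positivity

set_option maxHeartbeats 1000000 in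
theorem Hf_ode (ha : 1 < a) (hα : α = (n + 2 * a + 2) / (n + 2 * a - 2)) (hu : Sol a α u) (hd : 0 < d)
    (hpos : ∀ x y, 0 ≤ y → 0 < u (x, y))
    (hS : ∀ x0, InvSym a u x0 (∑ i, x0 i ^ 2 + d)) {σ : ℝ} (h0 : 0 < σ) (h1 : σ < 1) :
    (1 - σ ^ 2) * deriv (deriv (Hf a d u)) σ + ((n:ℝ) / σ - ((n:ℝ) + 2 * a) * σ) * deriv (Hf a d u) σ =
      ((n:ℝ) + 2 * a) / 2 * (1 - σ ^ 2) * deriv (Hf a d u) σ ^ 2 / Hf a d u σ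
        - ((n:ℝ) + 2 * a) / 2 * Hf a d u σ + (1 / (4 * (((n:ℝ) + 2 * a - 2) / 2) * d)) / Hf a d u σ := by
  have hγ := gam_pos n ha
  set γ := ((n:ℝ) + 2 * a - 2) / 2 with hγdef
  set H := Hf a d u with hH
  have e1 : 0 < 1 - σ := by linarith
  have e2 : 0 < 1 + σ := by linarith
  have hsm : ContDiffAt ℝ 2 H σ := (Hf_smooth hu hd hpos).contDiffAt (Ioc_mem_nhds (by linarith) h1)
  have hHp : 0 < H σ := Hf_pos hd hpos (by linarith) h1.le
  have hD2 := HasD2.of_contDiffAt hsm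
  set y := ys d σ with hy
  have hy0 : 0 < y := by rw [hy]; unfold ys; positivity
  have hy' : y = d / 4 * ((1 - σ) / (1 + σ)) := rfl
  set D := d + 4 * y with hD
  have hD' : D = 2 * d / (1 + σ) := by rw [hD, hy']; field_simp; ring
  have hD0 : 0 < D := by positivity
  have hσ : σ = (d - 4 * y) / D := by rw [hD', hy']; field_simp; ring
  have hσ2 : 1 - 16 * d * y / D ^ 2 = σ ^ 2 := by
    rw [hD', hy']; field_simp; ring
  -- vertical
  have hv : HasD2 (fun t => vf a u (0, t)) y (4 * H σ - 4 * (1 + σ) * deriv H σ)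
      (64 * d ^ 2 * deriv (deriv H) σ / D ^ 3) := by
    have l1 : HasD2 (fun t : ℝ => d + 4 * t) y 4 0 := by
      simpa using (HasD2.const d y).add ((HasD2.id y).const_mul 4)
    have l2 := HasD2.comp (g := fun t : ℝ => d + 4 * t) (HasD2.of_inv (r := d + 4 * y) hD0) l1
    have l3 : HasD2 (fun t : ℝ => -1 + 2 * d * (d + 4 * t)⁻¹) y (-8 * d / D ^ 2) (64 * d / D ^ 3) := by
      refine ((HasD2.const (-1) y).add (l2.const_mul (2 * d))).congr' ?_ ?_
      · simp only [← hD]; field_simp; ring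
      · simp only [← hD]; field_simp; ring
    have hs3 : -1 + 2 * d * (d + 4 * y)⁻¹ = σ := by
      rw [← hD, hD']; field_simp; ring
    have l4 := HasD2.comp (f := H) (g := fun t : ℝ => -1 + 2 * d * (d + 4 * t)⁻¹)
      (by simp only [hs3]; exact hD2) l3
    have l5 := l1.mul l4
    refine (l5.congr ?_).congr' ?_ ?_
    · filter_upwards [lt_mem_nhds hy0] with t ht
      rw [vf_axis hd ht.le]
      have : d + 4 * t ≠ 0 := by positivity
      congr 2
      field_simp; ring
    · simp only [← hD, hD']; field_simp; ring
    · simp only [← hD, hD']; field_simp; ring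
  -- horizontal
  have hh : ∀ i : Fin n, HasD2 (fun t => vf a u (Function.update 0 i t, y)) ((0 : Fin n → ℝ) i) 0
      (2 * (H σ + (1 - σ ^ 2) * deriv H σ / σ)) := by
    intro i
    set G : ℝ → ℝ := fun m => (m + D) * H (√(1 - 16 * d * y / (m + D) ^ 2)) with hG
    have s0 : √(1 - 16 * d * y / (0 + D) ^ 2) = σ := by
      rw [zero_add, hσ2, Real.sqrt_sq h0.le]
    have g1 : ContDiffAt ℝ 2 G 0 := by
      have hne : (0 + D) ^ 2 ≠ 0 := by positivity
      have i1 : ContDiffAt ℝ 2 (fun m : ℝ => 1 - 16 * d * y / (m + D) ^ 2) 0 :=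
        contDiffAt_const.sub (contDiffAt_const.div (by fun_prop) hne)
      have i2 := i1.sqrt (by rw [zero_add, hσ2]; positivity)
      have i3 : ContDiffAt ℝ 2 (fun m => H (√(1 - 16 * d * y / (m + D) ^ 2))) 0 :=
        ContDiffAt.comp (g := H) 0 (by rw [s0]; exact hsm) i2
      exact ContDiffAt.mul (by fun_prop) i3
    have g2 : HasDerivAt G (H σ + (1 - σ ^ 2) * deriv H σ / σ) 0 := horiz_deriv h0 hD0 hσ2 hD2.hasDerivAt
    have g3 := HasD2.of_contDiffAt g1
    have g4 := HasD2.comp (f := G) (g := fun t : ℝ => t ^ 2) (t := 0)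
      (by simpa using g3) (HasD2.of_sq 0)
    simp only [Pi.zero_apply]
    refine (g4.congr (Eventually.of_forall fun t => ?_)).congr' ?_ ?_
    · rw [vf_rep ha hd hpos hS _ hy0.le]
      have : rho (Function.update (0 : Fin n → ℝ) i t, y) + d = t ^ 2 + D := by
        have := sum_update_sub_sq 0 0 i t
        simp only [Pi.zero_apply, sub_zero] at this
        rw [rho_eq, this, hD]; simp; ring
      rw [this]
    · simp
    · rw [g2.deriv]; ring
  have hJ : HasJ (vf a u) 0 y _ _ (fun _ => 0) (fun _ => 2 * (H σ + (1 - σ ^ 2) * deriv H σ / σ)) := ⟨hv, hh⟩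
  have hV0 : vf a u (0, y) = D * H σ := by rw [vf_axis hd hy0.le, ← hD, ← hσ]
  have hVp : 0 < D * H σ := by positivity
  have hL := HasL.comp (a := a) hJ (F := fun s => s ^ (-γ)) (by rw [hV0]; exact HasD2.of_rpow hVp (-γ))
  have hL2 := (hu.hasL (x := 0) hy0)
  have hLc : ∀ z : (Fin n → ℝ) × ℝ, 0 ≤ z.2 → u z = vf a u z ^ (-γ) := by
    intro z hz
    have := hpos z.1 z.2 hz
    unfold vf
    rw [← Real.rpow_mul this.le, ← hγdef]
    rw [show -γ⁻¹ * -γ = 1 by field_simp, Real.rpow_one]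
  have hL3 : HasL a u 0 y _ := hL.congr (by
    have c2 : Tendsto (Prod.snd : (Fin n → ℝ) × ℝ → ℝ) (𝓝 (0, y)) (𝓝 y) := continuous_snd.continuousAt
    filter_upwards [c2.eventually (lt_mem_nhds hy0)] with z hz using hLc z (le_of_lt hz))
  have key := hL3.unique hL2
  rw [hLc (0, y) hy0.le, hV0, ← Real.rpow_mul hVp.le] at key
  have hga : -γ * α = -γ - 2 := by
    have : (n:ℝ) + 2 * a - 2 ≠ 0 := by intro h; rw [hγdef, h] at hγ; simp at hγ
    rw [hα, hγdef]; field_simp; ring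
  rw [hga, show -γ - 1 = (-γ - 2) + 1 by ring, Real.rpow_add hVp, Real.rpow_one] at key
  have hW : 0 < (D * H σ) ^ (-γ - 2) := by positivity
  set W := (D * H σ) ^ (-γ - 2)
  refine ode_alg (n := n) (a := a) (γ := γ) (y := y) (D := D) hd h0 hHp hγ rfl hD' hy' rfl rfl rfl ?_
  have hN : ((n:ℝ) + 2 * a) / 2 = γ + 1 := by rw [hγdef]; ring
  rw [hN]
  simp only [Finset.sum_const, Finset.card_univ, Fintype.card_fin, nsmul_eq_mul] at key
  refine mul_left_cancel₀ (mul_pos hγ hW).ne' ?_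
  have : γ * W * (1 / γ) = W := by field_simp
  linear_combination (-1) * key - this
end

section
variable {n : ℕ} {a α d : ℝ} {u : (Fin n → ℝ) × ℝ → ℝ}

theorem Hf_const (hn : 1 ≤ n) (ha : 1 < a) (hα : α = (n + 2 * a + 2) / (n + 2 * a - 2)) (hu : Sol a α u)
    (hd : 0 < d) (hpos : ∀ x y, 0 ≤ y → 0 < u (x, y))
    (hS : ∀ x0, InvSym a u x0 (∑ i, x0 i ^ 2 + d)) {s : ℝ} (h0 : 0 ≤ s) (h1 : s ≤ 1) :
    Hf a d u s ^ 2 = 1 / (((n:ℝ) + 2 * a) * ((n:ℝ) + 2 * a - 2) * d) := by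
  have hγ := gam_pos n ha
  have hn0 : 0 < (n:ℝ) := by exact_mod_cast hn
  set H := Hf a d u with hH
  have hS0 : InvSym a u 0 d := by simpa using hS 0
  have hsm := Hf_smooth hu hd hpos
  rw [← hH] at hsm
  have hat : ∀ s, -1 < s → s < 1 → HasD2 H s (deriv H s) (deriv (deriv H) s) := fun s e1 e2 =>
    HasD2.of_contDiffAt (hsm.contDiffAt (Ioc_mem_nhds e1 e2))
  have hcont0 : ContinuousAt H 0 := (hat 0 (by norm_num) (by norm_num)).hasDerivAt.continuousAt
  have hd0 : deriv H 0 = 0 := by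
    have k1 := (hat 0 (by norm_num) (by norm_num)).hasDerivAt
    have k2 : HasDerivAt (fun s => H (-s)) (-deriv H 0) 0 := by
      have := HasDerivAt.comp (h₂ := H) (h₂' := deriv H 0) (0:ℝ) (by rw [neg_zero]; exact k1) (hasDerivAt_neg (0:ℝ))
      simpa [Function.comp_def] using this
    have k3 : H =ᶠ[𝓝 0] fun s => H (-s) := by
      filter_upwards [Ioo_mem_nhds (show (-1:ℝ) < 0 by norm_num) (show (0:ℝ) < 1 by norm_num)] with s hs
      exact (Hf_even ha hd hpos hS0 hs.1 hs.2).symm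
    have := k1.unique (k2.congr_of_eventuallyEq k3)
    linarith
  have t0' : Tendsto (fun s => deriv H s / s) (𝓝[>] 0) (𝓝 (deriv (deriv H) 0)) := by
    have k1 := (hat 0 (by norm_num) (by norm_num)).hasDerivAt_deriv
    have k2 := (hasDerivAt_iff_tendsto_slope.1 k1).mono_left (nhdsGT_le_nhdsNE 0)
    refine k2.congr fun s => ?_
    rw [slope_def_field, hd0]; simp
  have hc1 : Tendsto H (𝓝[<] 1) (𝓝 (H 1)) := by
    have k := hsm.continuousOn 1 (by norm_num)
    have : 𝓝[<] (1:ℝ) ≤ 𝓝[Ioc (-1) 1] 1 := by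
      rw [← nhdsWithin_Ioo_eq_nhdsLT (show (-1:ℝ) < 1 by norm_num)]
      exact nhdsWithin_mono _ Ioo_subset_Ioc_self
    exact k.tendsto.mono_left this
  have hc1' : Tendsto (deriv H) (𝓝[<] 1) (𝓝 (derivWithin H (Ioc (-1) 1) 1)) := by
    have k := hsm.continuousOn_derivWithin (uniqueDiffOn_Ioc _ _) (by norm_num) 1 (by norm_num)
    have e := nhdsWithin_Ioo_eq_nhdsLT (show (-1:ℝ) < 1 by norm_num)
    have : 𝓝[<] (1:ℝ) ≤ 𝓝[Ioc (-1) 1] 1 := by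
      rw [← e]
      exact nhdsWithin_mono _ Ioo_subset_Ioc_self
    refine (k.tendsto.mono_left this).congr' ?_
    rw [← e]
    filter_upwards [self_mem_nhdsWithin] with y hy
    exact derivWithin_of_mem_nhds (Ioc_mem_nhds hy.1 hy.2)
  have hob := obata (n := n) (a := a) (N := (n:ℝ) + 2 * a) (c0 := 1 / (4 * (((n:ℝ) + 2 * a - 2) / 2) * d))
    hn0 ha rfl (H := H) (H' := deriv H) (H'' := deriv (deriv H))
    (fun s e1 e2 => Hf_pos hd hpos (by linarith) e2.le)
    (fun s e1 e2 => (hat s (by linarith) e2).hasDerivAt)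
    (fun s e1 e2 => (hat s (by linarith) e2).hasDerivAt_deriv)
    (fun s e1 e2 => Hf_ode ha hα hu hd hpos hS e1 e2)
    (Hf_pos hd hpos (by norm_num) (by norm_num) : 0 < H 0) (Hf_pos hd hpos (by norm_num) le_rfl : 0 < H 1)
    (hcont0.tendsto.mono_left nhdsWithin_le_nhds) t0' hc1 hc1'
  have hval : 2 * (1 / (4 * (((n:ℝ) + 2 * a - 2) / 2) * d)) / ((n:ℝ) + 2 * a)
      = 1 / (((n:ℝ) + 2 * a) * ((n:ℝ) + 2 * a - 2) * d) := by
    have : (n:ℝ) + 2 * a - 2 ≠ 0 := by linarith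
    have : (n:ℝ) + 2 * a ≠ 0 := by linarith
    field_simp; norm_num
  rw [hval] at hob
  rcases h0.eq_or_lt with h | h
  · rw [← h]
    have hq : Tendsto H (𝓝[>] (0:ℝ)) (𝓝 (H 0)) := hcont0.tendsto.mono_left nhdsWithin_le_nhds
    refine tendsto_nhds_unique (hq.pow 2)
      (tendsto_const_nhds.congr' ?_)
    filter_upwards [Ioo_mem_nhdsGT (show (0:ℝ) < 1 by norm_num)] with s hs using (hob s hs.1 hs.2).symm
  · rcases h1.eq_or_lt with h' | h'
    · rw [h']
      refine tendsto_nhds_unique (hc1.pow 2) (tendsto_const_nhds.congr' ?_)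
      filter_upwards [Ioo_mem_nhdsLT (show (0:ℝ) < 1 by norm_num)] with s hs using (hob s hs.1 hs.2).symm
    · exact hob s h h'

theorem final_form (hn : 1 ≤ n) (ha : 1 < a) (hα : α = (n + 2 * a + 2) / (n + 2 * a - 2)) (hu : Sol a α u)
    (hd : 0 < d) (hpos : ∀ x y, 0 ≤ y → 0 < u (x, y))
    (hS : ∀ x0, InvSym a u x0 (∑ i, x0 i ^ 2 + d)) (x : Fin n → ℝ) {y : ℝ} (hy : 0 ≤ y) :
    u (x, y) = (√d * √(((n:ℝ) + 2 * a) * ((n:ℝ) + 2 * a - 2)) / (rho (x, y) + d)) ^ (((n:ℝ) + 2 * a - 2) / 2) := by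
  have hγ := gam_pos n ha
  have hn0 : 0 < (n:ℝ) := by exact_mod_cast hn
  have hr := vf_rep ha hd hpos hS x hy
  have hr0 : 0 ≤ rho (x, y) := rho_nonneg _ hy
  have hR : 0 < rho (x, y) + d := by linarith
  set s := √(1 - 16 * d * y / (rho (x, y) + d) ^ 2) with hs
  have hs0 : 0 ≤ s := Real.sqrt_nonneg _
  have hs1 : s ≤ 1 := by
    rw [hs, Real.sqrt_le_iff]
    have : 0 ≤ 16 * d * y / (rho (x, y) + d) ^ 2 := by positivity
    constructor <;> linarith
  have hH := Hf_const hn ha hα hu hd hpos hS hs0 hs1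
  have hHp : 0 < Hf a d u s := Hf_pos hd hpos (by linarith) hs1
  set K := √d * √(((n:ℝ) + 2 * a) * ((n:ℝ) + 2 * a - 2)) with hK
  have hM : 0 < ((n:ℝ) + 2 * a) * ((n:ℝ) + 2 * a - 2) := mul_pos (by linarith) (by linarith)
  have hK0 : 0 < K := by positivity
  have hK2 : K ^ 2 = ((n:ℝ) + 2 * a) * ((n:ℝ) + 2 * a - 2) * d := by
    rw [hK, mul_pow, Real.sq_sqrt hd.le, Real.sq_sqrt hM.le]; ring
  have hHK : Hf a d u s = K⁻¹ := by
    rw [← hK2] at hH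
    have : Hf a d u s ^ 2 = (K⁻¹) ^ 2 := by rw [hH]; simp
    exact (pow_left_inj₀ hHp.le (by positivity) (by norm_num)).1 this
  have hup := hpos x y hy
  have hV : (vf a u (x, y))⁻¹ = K / (rho (x, y) + d) := by
    rw [hr, hHK]; field_simp
  rw [← hV]
  unfold vf
  rw [Real.rpow_neg hup.le, inv_inv, ← Real.rpow_mul hup.le, inv_mul_cancel₀ hγ.ne', Real.rpow_one]

theorem zero_or_pos (ha : 1 < a) (hα : α = (n + 2 * a + 2) / (n + 2 * a - 2)) (hu : Sol a α u) :
    (∀ x y, 0 ≤ y → u (x, y) = 0) ∨ (∀ x y, 0 ≤ y → 0 < u (x, y)) := by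
  by_cases h : ∀ x y, 0 ≤ y → u (x, y) = 0
  · exact Or.inl h
  right
  push Not at h
  obtain ⟨x0, y0, hy0, hne⟩ := h
  have hα1 := alpha_gt ha hα
  have hp : 0 < u (x0, y0) := lt_of_le_of_ne (hu.nonneg _ _ hy0) hne.symm
  intro x y hy
  refine smp ha (μ := -1) u (hu.cont.mono fun z hz => hz.1) ?_ ?_ hy0 ?_ hp x y hy ?_
  · intro x y hy _; exact hu.nonneg x y hy
  · intro x y hy _; exact hasL_nonpos hα1 hu hy
  · have : 0 ≤ rho (x0, y0) := rho_nonneg _ hy0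
    linarith
  · have : 0 ≤ rho (x, y) := rho_nonneg _ hy
    linarith
end

end Helpers

/-- Theorem 1.1(2): classification of nonnegative solutions of
`y u_yy + a u_y + Δₓ u + u^α = 0` in the critical case `α = (n+2a+2)/(n+2a-2)`. -/
theorem liouville_critical (n : ℕ) (hn : 1 ≤ n) (a α : ℝ) (ha : 1 < a)
    (hα : α = (n + 2 * a + 2) / (n + 2 * a - 2))
    (u : (Fin n → ℝ) × ℝ → ℝ)
    (hreg : ContDiffOn ℝ 2 u {p : (Fin n → ℝ) × ℝ | 0 ≤ p.2})
    (hnonneg : ∀ (x : Fin n → ℝ) (y : ℝ), 0 ≤ y → 0 ≤ u (x, y))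
    (heq : ∀ (x : Fin n → ℝ) (y : ℝ), 0 < y →
      y * pdyy n u x y + a * pdy n u x y + (∑ i, pdxx n u i x y) + u (x, y) ^ α = 0) :
    ∃ (x₀ : Fin n → ℝ) (t : ℝ), 0 ≤ t ∧ ∀ (x : Fin n → ℝ) (y : ℝ), 0 ≤ y →
      u (x, y) = (t * Real.sqrt ((n + 2 * a) * (n + 2 * a - 2)) /
        (t ^ 2 + 4 * y + ∑ i, (x i - x₀ i) ^ 2)) ^ ((n + 2 * a - 2) / 2) := by
  have hu : Sol a α u := sol_of hreg hnonneg heq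
  rcases zero_or_pos ha hα hu with h | hpos
  · refine ⟨0, 0, le_rfl, fun x y hy => ?_⟩
    rw [h x y hy, zero_mul, zero_div, Real.zero_rpow (gam_pos n ha).ne']
  · obtain ⟨c, d, hd, hS⟩ := caseA1 hn ha hu hpos (all_sym ha hα hu hpos)
    refine ⟨c, Real.sqrt d, Real.sqrt_nonneg d, fun x y hy => ?_⟩
    have h1 := final_form hn ha hα (u := tr c u) (hu.trans c) hd
      (fun x y hy => by rw [tr_apply]; exact hpos _ _ hy) hS (x - c) hy
    rw [tr_apply, sub_add_cancel] at h1
    rw [h1, Real.sq_sqrt hd.le]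
    congr 2
    rw [rho_eq]
    simp only [Pi.sub_apply]
    ring
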